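/- Let N ≥ 2, 0 < R₀ < R₁, p ∈ (1,∞) and s ∈ (0, R₁ − R₀). Let u be a first eigenfunction of the p-Laplacian on Ω_s, and suppose the function t ↦ λ₁(p, Ω_t) is differentiable at s with derivative 0. Then there exist r₀ ∈ (R₀, R₁ − s) and a function g : ℝ → ℝ such that u(x) = g(‖x − s e₁‖) for every x with R₀ < ‖x − s e₁‖ < r₀, and moreover ∇u(x) = 0 for every x with ‖x − s e₁‖ = r₀. -/

import Mathlib

open MeasureTheory Metric Set Filter
open scoped RealInnerProductSpace ENNReal Topology

/-- The first Dirichlet eigenvalue of the p-Laplacian on `Ω`, defined variationally as the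
infimum of Rayleigh quotients of smooth, not identically zero functions with compact
support contained in `Ω`. -/
noncomputable def lam1 {N : ℕ} (p : ℝ) (Ω : Set (EuclideanSpace ℝ (Fin N))) : ℝ :=
  sInf { r : ℝ | ∃ u : EuclideanSpace ℝ (Fin N) → ℝ,
    ContDiff ℝ (⊤ : ℕ∞) u ∧ u ≠ 0 ∧ HasCompactSupport u ∧ tsupport u ⊆ Ω ∧
    r = (∫ x in Ω, ‖gradient u x‖ ^ p) / (∫ x in Ω, |u x| ^ p) }

/-- The first standard basis vector `e₁` of `ℝ^N`. -/
noncomputable def e1 (N : ℕ) : EuclideanSpace ℝ (Fin N) :=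
  (WithLp.equiv 2 (Fin N → ℝ)).symm (fun i => if (i : ℕ) = 0 then 1 else 0)

/-- The eccentric annulus `Ω_s = B_{R₁}(0) \ closure (B_{R₀}(s e₁))`. -/
noncomputable def Om (N : ℕ) (R₀ R₁ s : ℝ) : Set (EuclideanSpace ℝ (Fin N)) :=
  ball 0 R₁ \ closure (ball (s • e1 N) R₀)

/-- `u` is a first eigenfunction of the p-Laplacian on `Ω` with eigenvalue `lam`:
C¹ on an open set containing the closure of `Ω`, positive in `Ω`, zero on `∂Ω`, and a weak
solution of `−Δ_p u = lam · u^{p−1}`. -/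
def IsFirstEigenfunction {N : ℕ} (p : ℝ) (Ω : Set (EuclideanSpace ℝ (Fin N)))
    (lam : ℝ) (u : EuclideanSpace ℝ (Fin N) → ℝ) : Prop :=
  (∃ V : Set (EuclideanSpace ℝ (Fin N)), IsOpen V ∧ closure Ω ⊆ V ∧ ContDiffOn ℝ 1 u V) ∧
  (∀ x ∈ Ω, 0 < u x) ∧
  (∀ x ∈ frontier Ω, u x = 0) ∧
  (∀ φ : EuclideanSpace ℝ (Fin N) → ℝ, ContDiff ℝ (⊤ : ℕ∞) φ → HasCompactSupport φ →
    tsupport φ ⊆ Ω →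
    ∫ x in Ω, ‖gradient u x‖ ^ (p - 2) * ⟪gradient u x, gradient φ x⟫ =
      lam * ∫ x in Ω, (u x) ^ (p - 1) * φ x)


section PLall
open MeasureTheory Metric Set Filter
open scoped RealInnerProductSpace ENNReal Topology NNReal

namespace PL
section P1
set_option linter.unusedSectionVars false
variable {E : Type*} [NormedAddCommGroup E] [InnerProductSpace ℝ E] [FiniteDimensional ℝ E]
  [MeasurableSpace E] [BorelSpace E]

lemma norm_gradient_eq (f : E → ℝ) (x : E) : ‖gradient f x‖ = ‖fderiv ℝ f x‖ := by
  simp [gradient]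

lemma norm_gradient_le {f : E → ℝ} {K : ℝ≥0} (hf : LipschitzWith K f) (x : E) :
    ‖gradient f x‖ ≤ K := by
  rw [norm_gradient_eq]; exact norm_fderiv_le_of_lipschitz ℝ hf

lemma measurable_gradient (f : E → ℝ) : Measurable (gradient f) := by
  unfold gradient
  exact (LinearIsometryEquiv.continuous _).measurable.comp (measurable_fderiv ℝ f)

lemma ae_gradient_zero {f : E → ℝ} {K : ℝ≥0} (hf : LipschitzWith K f) :
    ∀ᵐ x, f x = 0 → gradient f x = 0 := by
  have hZ : MeasurableSet {x | f x = 0} :=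
    (isClosed_singleton.preimage hf.continuous).measurableSet
  rcases subsingleton_or_nontrivial E with hE | hE
  · exact Eventually.of_forall fun x _ => Subsingleton.elim _ _
  obtain ⟨e, he⟩ := exists_ne (0 : E)
  have h0 : ApproximatesLinearOn (fun x => f x • e) (0 : E →L[ℝ] E) {x | f x = 0} 0 := by
    intro x hx y hy
    have hx' : f x = 0 := hx
    have hy' : f y = 0 := hy
    simp [hx', hy']
  have hd := hf.ae_differentiableAt (μ := volume)
  let D := {x | DifferentiableAt ℝ f x}
  have hDm : MeasurableSet D := measurableSet_of_differentiableAt ℝ f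
  have h1 := (h0.mono_set (s := {x | f x = 0} ∩ D) inter_subset_left).norm_fderiv_sub_le
    volume (hZ.inter hDm) (fun x => (fderiv ℝ f x).smulRight e)
    (fun x hx => ((DifferentiableAt.hasFDerivAt hx.2).smul_const e).hasFDerivWithinAt)
  rw [ae_restrict_iff' (hZ.inter hDm)] at h1
  filter_upwards [h1, hd] with x hx hdx h
  have := hx ⟨h, hdx⟩
  have h2 : ‖fderiv ℝ f x‖ = 0 := by
    simpa [ContinuousLinearMap.norm_smulRight_apply, he] using this
  rw [← norm_le_zero_iff, norm_gradient_eq]; exact h2.le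

lemma gradient_eq_zero_of_eventually {f : E → ℝ} {x : E} (h : f =ᶠ[𝓝 x] 0) :
    gradient f x = 0 := by
  rw [h.gradient_eq]; exact gradient_fun_const x 0

lemma ae_gradient_eq {f g : E → ℝ} {K K' : ℝ≥0} (hf : LipschitzWith K f) (hg : LipschitzWith K' g) :
    ∀ᵐ x, f x = g x → gradient f x = gradient g x := by
  filter_upwards [ae_gradient_zero (hf.sub hg), hf.ae_differentiableAt (μ := volume),
    hg.ae_differentiableAt (μ := volume)] with x h1 h2 h3 h4
  have := h1 (by simp [h4])
  simp only [gradient] at this ⊢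
  rw [fderiv_fun_sub h2 h3] at this
  simpa [sub_eq_zero] using this

/-- bounded convergence of functions and gradients -/
structure BConv (f : ℕ → E → ℝ) (g : E → ℝ) : Prop where
  bd : ∃ K : ℝ, ∀ n x, |f n x| ≤ K ∧ ‖gradient (f n) x‖ ≤ K
  supp : ∃ R : ℝ, ∀ n x, x ∉ closedBall (0 : E) R → f n x = 0 ∧ gradient (f n) x = 0
  cont : ∀ n, Continuous (f n)
  conv : ∀ᵐ x, Tendsto (fun n => f n x) atTop (𝓝 (g x)) ∧
    Tendsto (fun n => gradient (f n) x) atTop (𝓝 (gradient g x))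

lemma BConv.tendsto_integral {f : ℕ → E → ℝ} {g : E → ℝ} (h : BConv f g)
    (Φ : E → ℝ → E → ℝ) (hΦm : Measurable (fun y : E × ℝ × E => Φ y.1 y.2.1 y.2.2))
    (hΦ0 : ∀ x, Φ x 0 0 = 0)
    (hΦc : ∀ᵐ x, Continuous (fun y : ℝ × E => Φ x y.1 y.2))
    (hΦb : ∀ K, ∃ M, ∀ᵐ x, ∀ a b, |a| ≤ K → ‖b‖ ≤ K → |Φ x a b| ≤ M) :
    Tendsto (fun n => ∫ x, Φ x (f n x) (gradient (f n) x)) atTop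
      (𝓝 (∫ x, Φ x (g x) (gradient g x))) := by
  obtain ⟨K, hK⟩ := h.bd
  obtain ⟨R, hR⟩ := h.supp
  obtain ⟨M, hM⟩ := hΦb K
  refine tendsto_integral_of_dominated_convergence ((closedBall (0 : E) R).indicator fun _ => M)
    ?_ ?_ ?_ ?_
  · intro n
    exact (hΦm.comp (measurable_id.prodMk
      ((h.cont n).measurable.prodMk (measurable_gradient (f n))))).aestronglyMeasurable
  · refine (integrable_indicator_iff measurableSet_closedBall).2 ?_
    exact integrableOn_const (measure_closedBall_lt_top).ne
  · intro n
    filter_upwards [hM] with x hM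
    by_cases hx : x ∈ closedBall (0 : E) R
    · rw [indicator_of_mem hx, Real.norm_eq_abs]
      exact hM _ _ (hK n x).1 (hK n x).2
    · rw [indicator_of_notMem hx, (hR n x hx).1, (hR n x hx).2, hΦ0]; simp
  · filter_upwards [h.conv, hΦc] with x hx hc
    exact (hc.tendsto (g x, gradient g x)).comp (hx.1.prodMk_nhds hx.2)

/-- mollification -/
lemma exists_mollify {f : E → ℝ} {K : ℝ≥0} (hf : LipschitzWith K f) (hc : HasCompactSupport f)
    {Ω : Set E} (hΩ : IsOpen Ω) (hs : tsupport f ⊆ Ω) :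
    ∃ φ : ℕ → E → ℝ, BConv φ f ∧ ∀ n, ContDiff ℝ (⊤ : ℕ∞) (φ n) ∧ HasCompactSupport (φ n) ∧
      tsupport (φ n) ⊆ Ω := by
  obtain ⟨δ, hδ, hδΩ⟩ := hc.isCompact.exists_cthickening_subset_open hΩ hs
  have hδ1 : 0 < min δ 1 := lt_min hδ one_pos
  let b : ℕ → ContDiffBump (0 : E) := fun n =>
    ⟨min δ 1 / (n + 1) / 2, min δ 1 / (n + 1), by positivity, by
      have : 0 < min δ 1 / ((n : ℝ) + 1) := by positivity
      linarith⟩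
  have hbr : ∀ n, (b n).rOut ≤ min δ 1 := fun n => by
    change min δ 1 / ((n : ℝ) + 1) ≤ min δ 1
    exact div_le_self hδ1.le (by linarith [n.cast_nonneg (α := ℝ)])
  have hb0 : Tendsto (fun n => (b n).rOut) atTop (𝓝 0) := by
    change Tendsto (fun n : ℕ => min δ 1 / ((n : ℝ) + 1)) atTop (𝓝 0)
    exact tendsto_const_nhds.div_atTop
      (tendsto_atTop_add_const_right _ _ tendsto_natCast_atTop_atTop)
  let φ : ℕ → E → ℝ := fun n => convolution ((b n).normed volume) f (ContinuousLinearMap.lsmul ℝ ℝ) volume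
  have hφ : ∀ n x, φ n x = ∫ y, (b n).normed volume y • f (x - y) := fun n x => rfl
  have hint : ∀ n x, Integrable (fun y => (b n).normed volume y • f (x - y)) := by
    intro n x
    refine Continuous.integrable_of_hasCompactSupport ?_ ?_
    · exact ((b n).continuous_normed).smul (hf.continuous.comp (by fun_prop))
    · exact ((b n).hasCompactSupport_normed).smul_right
  have hder : ∀ n x, HasFDerivAt (φ n) (∫ y, (b n).normed volume y • fderiv ℝ f (x - y)) x := by
    intro n x
    have := hasFDerivAt_integral_of_dominated_loc_of_lip (𝕜 := ℝ) (μ := (volume : Measure E))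
      (F := fun x y => (b n).normed volume y • f (x - y))
      (F' := fun y => (b n).normed volume y • fderiv ℝ f (x - y)) (x₀ := x) (s := univ)
      (bound := fun y => (b n).normed volume y * K)
      univ_mem (Eventually.of_forall fun x' => (hint n x').aestronglyMeasurable)
      (hint n x) ?_ ?_ ?_ ?_
    · exact this.2
    · refine Measurable.aestronglyMeasurable ?_
      exact ((b n).continuous_normed.measurable).smul
        ((measurable_fderiv ℝ f).comp (by fun_prop))
    · refine Eventually.of_forall fun y => ?_
      refine LipschitzOnWith.of_dist_le_mul fun a _ c _ => ?_
      have h1 : 0 ≤ (b n).normed volume y := (b n).nonneg_normed y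
      rw [dist_eq_norm, ← smul_sub, norm_smul, Real.norm_of_nonneg h1, ← dist_eq_norm]
      have h2 := hf.dist_le_mul (a - y) (c - y)
      rw [dist_sub_right] at h2
      rw [Real.coe_nnabs, abs_of_nonneg (by positivity), mul_assoc]
      exact mul_le_mul_of_nonneg_left h2 h1
    · exact ((b n).integrable_normed).mul_const _
    · have h1 : ∀ᵐ y, DifferentiableAt ℝ f (x - y) :=
        (Measure.measurePreserving_sub_left volume x).quasiMeasurePreserving.ae hf.ae_differentiableAt
      filter_upwards [h1] with y hy
      refine HasFDerivAt.const_smul (c := (b n).normed volume y)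
        (f := fun x' => f (x' - y)) (f' := fderiv ℝ f (x - y)) ?_
      have := hy.hasFDerivAt.comp x ((hasFDerivAt_id x).sub_const y)
      simpa [Function.comp_def] using this
  have hclose : ∀ n x, |φ n x - f x| ≤ K * (b n).rOut := by
    intro n x
    have := (b n).dist_normed_convolution_le (μ := volume) (g := f) (x₀ := x)
      (ε := K * (b n).rOut) hf.continuous.aestronglyMeasurable (fun y hy => by
        refine (hf.dist_le_mul y x).trans ?_
        exact mul_le_mul_of_nonneg_left (mem_ball.1 hy).le K.2)
    exact this
  have hts : ∀ n, tsupport (φ n) ⊆ cthickening δ (tsupport f) := by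
    intro n
    refine closure_minimal ?_ isClosed_cthickening
    refine (support_convolution_subset (ContinuousLinearMap.lsmul ℝ ℝ)).trans ?_
    rintro x ⟨y, hy, z, hz, rfl⟩
    rw [(b n).support_normed_eq, mem_ball_zero_iff] at hy
    refine mem_cthickening_of_dist_le _ z _ _ (subset_tsupport _ hz) ?_
    rw [dist_eq_norm]; simp only [add_sub_cancel_right]
    exact hy.le.trans ((hbr n).trans (min_le_left _ _))
  have hcpt : IsCompact (cthickening δ (tsupport f)) := hc.isCompact.cthickening
  refine ⟨φ, ⟨?_, ?_, ?_, ?_⟩, fun n => ⟨?_, ?_, (hts n).trans hδΩ⟩⟩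
  · obtain ⟨M, hM⟩ := hc.exists_bound_of_continuous hf.continuous
    refine ⟨max (M + K) K, fun n x => ⟨?_, ?_⟩⟩
    · refine le_max_of_le_left ?_
      have h1 := hclose n x
      have h2 := hM x
      rw [Real.norm_eq_abs] at h2
      have h3 : (K : ℝ) * (b n).rOut ≤ K * 1 :=
        mul_le_mul_of_nonneg_left ((hbr n).trans (min_le_right _ _)) K.2
      have := abs_add_le (φ n x - f x) (f x)
      rw [sub_add_cancel] at this
      linarith
    · refine le_max_of_le_right ?_
      rw [norm_gradient_eq, (hder n x).fderiv]
      refine (norm_integral_le_integral_norm _).trans ?_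
      calc _ ≤ ∫ y, (b n).normed volume y * K := by
            refine integral_mono_of_nonneg (Eventually.of_forall fun _ => norm_nonneg _)
              (((b n).integrable_normed).mul_const _) (Eventually.of_forall fun y => ?_)
            simp only
            rw [norm_smul, Real.norm_of_nonneg ((b n).nonneg_normed y)]
            exact mul_le_mul_of_nonneg_left (norm_fderiv_le_of_lipschitz ℝ hf)
              ((b n).nonneg_normed y)
        _ = K := by rw [integral_mul_const, (b n).integral_normed, one_mul]
  · obtain ⟨R, hR⟩ := hcpt.isBounded.subset_closedBall (0 : E)
    refine ⟨R, fun n x hx => ?_⟩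
    have h1 : x ∉ tsupport (φ n) := fun h => hx (hR (hts n h))
    have h2 := notMem_tsupport_iff_eventuallyEq.1 h1
    exact ⟨h2.eq_of_nhds, gradient_eq_zero_of_eventually h2⟩
  · exact fun n => continuous_iff_continuousAt.2 fun x => (hder n x).continuousAt
  · have h1 := ContDiffBump.ae_convolution_tendsto_right_of_locallyIntegrable
      (μ := (volume : Measure E)) (φ := b) (l := atTop) (K := 2) (g := fderiv ℝ f) hb0
      (Eventually.of_forall fun n => by
        change min δ 1 / ((n : ℝ) + 1) ≤ 2 * (min δ 1 / ((n : ℝ) + 1) / 2)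
        linarith) ?_
    · filter_upwards [h1] with x hx
      constructor
      · refine tendsto_iff_norm_sub_tendsto_zero.2 ?_
        refine squeeze_zero (fun _ => norm_nonneg _) (fun n => hclose n x) ?_
        simpa using hb0.const_mul (K : ℝ)
      · have : ∀ n, gradient (φ n) x = (InnerProductSpace.toDual ℝ E).symm
            (convolution ((b n).normed volume) (fderiv ℝ f) (ContinuousLinearMap.lsmul ℝ ℝ)
              volume x) := by
          intro n
          rw [gradient, (hder n x).fderiv]; rfl
        simp_rw [this]
        exact ((LinearIsometryEquiv.continuous _).tendsto _).comp hx
    · refine LocallyIntegrable.mono (f := fun _ => (K : ℝ)) (locallyIntegrable_const _)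
        (measurable_fderiv ℝ f).aestronglyMeasurable (Eventually.of_forall fun x => ?_)
      simpa using norm_fderiv_le_of_lipschitz ℝ hf
  · exact (b n).hasCompactSupport_normed.contDiff_convolution_left _ (b n).contDiff_normed
      hf.continuous.locallyIntegrable
  · exact hcpt.of_isClosed_subset (isClosed_tsupport _) (hts n)

/-- truncation -/
lemma exists_truncate {f : E → ℝ} {K : ℝ≥0} (hf : LipschitzWith K f) 
    {Ω : Set E} (hΩb : Bornology.IsBounded Ω) (hs : ∀ x ∉ Ω, f x = 0) :
    ∃ φ : ℕ → E → ℝ, BConv φ f ∧ ∀ n, LipschitzWith K (φ n) ∧ HasCompactSupport (φ n) ∧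
      tsupport (φ n) ⊆ Ω := by
  let S : ℝ → ℝ → ℝ := fun d t => max (t - d) 0 + min (t + d) 0
  have hS1 : ∀ d, 0 ≤ d → ∀ a b, |S d a - S d b| ≤ |a - b| := by
    intro d hd a b
    simp only [S]
    rcases max_cases (a - d) 0 with h1 | h1 <;> rcases max_cases (b - d) 0 with h2 | h2 <;>
    rcases min_cases (a + d) 0 with h3 | h3 <;> rcases min_cases (b + d) 0 with h4 | h4 <;>
    rw [h1.1, h2.1, h3.1, h4.1] <;>
    rcases abs_cases (a - b) with h5 | h5 <;> rw [abs_le] <;> constructor <;> linarith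
  have hS0 : ∀ d, ∀ t, |t| ≤ d → S d t = 0 := by
    intro d t h
    rw [abs_le] at h
    simp only [S]
    rw [max_eq_right (by linarith), min_eq_right (by linarith), add_zero]
  have hSt : ∀ d, 0 < d → ∀ t, |t| > d → (S d t = t - d ∧ t > d) ∨ (S d t = t + d ∧ t < -d) := by
    intro d hd t h
    simp only [S]
    rcases lt_abs.1 h with h | h
    · left; rw [max_eq_left (by linarith), min_eq_right (by linarith)]; constructor <;> linarith
    · right; rw [max_eq_right (by linarith), min_eq_left (by linarith)]; constructor <;> linarith
  have hdist : ∀ d, 0 ≤ d → ∀ t, |S d t - t| ≤ d := by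
    intro d hd t
    simp only [S]
    rcases max_cases (t - d) 0 with h1 | h1 <;> 
    rcases min_cases (t + d) 0 with h3 | h3 <;> 
    rw [h1.1, h3.1] <;> rw [abs_le] <;> constructor <;> linarith
  let δ : ℕ → ℝ := fun n => 1 / ((n : ℝ) + 1)
  have hδ : ∀ n, 0 < δ n := fun n => by positivity
  have hδ0 : Tendsto δ atTop (𝓝 0) := tendsto_one_div_add_atTop_nhds_zero_nat
  let φ : ℕ → E → ℝ := fun n x => S (δ n) (f x)
  have hL : ∀ n, LipschitzWith K (φ n) := fun n => by
    refine LipschitzWith.of_dist_le_mul fun x y => ?_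
    exact (hS1 _ (hδ n).le _ _).trans (hf.dist_le_mul x y)
  have hφ0 : ∀ n x, x ∉ Ω → φ n x = 0 := fun n x hx => by
    apply hS0; rw [hs x hx]; simpa using (hδ n).le
  have hts : ∀ n, tsupport (φ n) ⊆ {x | δ n ≤ |f x|} := by
    intro n
    refine closure_minimal ?_ (isClosed_le continuous_const hf.continuous.abs)
    intro x hx
    by_contra h
    exact hx (hS0 _ _ (not_le.1 h).le)
  have hts' : ∀ n, tsupport (φ n) ⊆ Ω := by
    intro n x hx
    by_contra h
    have := hts n hx
    simp only [mem_ofPred_eq, hs x h, abs_zero] at this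
    exact absurd (hδ n) (not_lt.2 this)
  obtain ⟨R, hR⟩ := hΩb.subset_closedBall (0 : E)
  have hcs : ∀ n, HasCompactSupport (φ n) := fun n =>
    (isCompact_closedBall (0 : E) R).of_isClosed_subset (isClosed_tsupport _)
      ((hts' n).trans hR)
  refine ⟨φ, ⟨?_, ?_, fun n => (hL n).continuous, ?_⟩, fun n => ⟨hL n, hcs n, hts' n⟩⟩
  · have hfc : HasCompactSupport f := by
      refine (isCompact_closedBall (0 : E) R).of_isClosed_subset (isClosed_tsupport _) ?_
      refine closure_minimal ?_ isClosed_closedBall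
      intro x hx
      by_contra h
      exact hx (hs x fun h' => h (hR h'))
    obtain ⟨M, hM⟩ := hfc.exists_bound_of_continuous hf.continuous
    refine ⟨max (M + 1) K, fun n x => ⟨le_max_of_le_left ?_, le_max_of_le_right ?_⟩⟩
    · have h1 := hdist _ (hδ n).le (f x)
      have h2 := hM x
      rw [Real.norm_eq_abs] at h2
      have := abs_add_le (φ n x - f x) (f x)
      rw [sub_add_cancel] at this
      have h3 : δ n ≤ 1 := by
        simp only [δ]; rw [div_le_one (by positivity)]; linarith [n.cast_nonneg (α := ℝ)]
      have h1' : |φ n x - f x| ≤ δ n := h1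
      linarith
    · exact norm_gradient_le (hL n) x
  · refine ⟨R, fun n x hx => ?_⟩
    have h1 : x ∉ tsupport (φ n) := fun h => hx (hR (hts' n h))
    have h2 := notMem_tsupport_iff_eventuallyEq.1 h1
    exact ⟨h2.eq_of_nhds, gradient_eq_zero_of_eventually h2⟩
  · filter_upwards [ae_gradient_zero hf] with x hx
    constructor
    · refine tendsto_iff_norm_sub_tendsto_zero.2 ?_
      exact squeeze_zero (fun _ => norm_nonneg _) (fun n => hdist _ (hδ n).le (f x)) hδ0
    · by_cases h0 : f x = 0
      · rw [hx h0]
        refine tendsto_const_nhds.congr fun n => ?_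
        symm
        refine gradient_eq_zero_of_eventually ?_
        have : ∀ᶠ y in 𝓝 x, |f y| < δ n := by
          refine (hf.continuous.abs.tendsto x).eventually_lt_const ?_
          rw [h0]; simpa using hδ n
        filter_upwards [this] with y hy
        exact hS0 _ _ hy.le
      · have h1 : ∀ᶠ n in atTop, δ n < |f x| := hδ0.eventually_lt_const (abs_pos.2 h0)
        refine tendsto_const_nhds.congr' ?_
        filter_upwards [h1] with n hn
        have h2 : ∀ᶠ y in 𝓝 x, δ n < |f y| :=
          (hf.continuous.abs.tendsto x).eventually_const_lt hn
        rcases hSt _ (hδ n) _ hn with h3 | h3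
        · have h4 : ∀ᶠ y in 𝓝 x, δ n < f y :=
            (hf.continuous.tendsto x).eventually_const_lt h3.2
          have h5 : φ n =ᶠ[𝓝 x] fun y => f y - δ n := by
            filter_upwards [h2, h4] with y hy hy'
            rcases hSt _ (hδ n) _ hy with h | h
            · exact h.1
            · linarith [h.2, hδ n]
          rw [h5.gradient_eq]; simp [gradient, fderiv_sub_const]
        · have h4 : ∀ᶠ y in 𝓝 x, f y < - δ n :=
            (hf.continuous.tendsto x).eventually_lt_const h3.2
          have h5 : φ n =ᶠ[𝓝 x] fun y => f y + δ n := by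
            filter_upwards [h2, h4] with y hy hy'
            rcases hSt _ (hδ n) _ hy with h | h
            · linarith [h.2, hδ n]
            · exact h.1
          rw [h5.gradient_eq]; simp [gradient, fderiv_add_const]

end P1
end PL

open MeasureTheory Metric Set Filter
open scoped RealInnerProductSpace ENNReal Topology NNReal

namespace PL
section P2
set_option linter.unusedSectionVars false
variable {E : Type*} [NormedAddCommGroup E] [InnerProductSpace ℝ E] [FiniteDimensional ℝ E]
  [MeasurableSpace E] [BorelSpace E]

/-- the vector field of the p-Laplacian -/
noncomputable def aF (p : ℝ) (ξ : E) : E := ‖ξ‖ ^ (p - 2) • ξ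

lemma norm_aF {p : ℝ} (hp : 1 < p) (ξ : E) : ‖aF p ξ‖ = ‖ξ‖ ^ (p - 1) := by
  rw [aF, norm_smul, Real.norm_of_nonneg (by positivity)]
  rcases eq_or_ne ξ 0 with h | h
  · simp [h, Real.zero_rpow (by linarith : p - 1 ≠ 0)]
  · have := norm_pos_iff.2 h
    nth_rewrite 2 [← Real.rpow_one ‖ξ‖]
    rw [← Real.rpow_add this]; ring_nf

lemma inner_aF_self {p : ℝ} (hp : 1 < p) (ξ : E) : ⟪aF p ξ, ξ⟫ = ‖ξ‖ ^ p := by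
  rw [aF, real_inner_smul_left, real_inner_self_eq_norm_sq]
  rcases eq_or_ne ξ 0 with h | h
  · simp [h, Real.zero_rpow (by linarith : p ≠ 0)]
  · have := norm_pos_iff.2 h
    rw [← Real.rpow_natCast, ← Real.rpow_add this]; norm_num

@[simp] lemma aF_zero (p : ℝ) : aF p (0 : E) = 0 := by simp [aF]

lemma continuous_aF {p : ℝ} (hp : 1 < p) : Continuous (aF p : E → E) := by
  have h1 : Continuous (fderiv ℝ (fun x : E => ‖x‖ ^ p)) :=
    (contDiff_norm_rpow hp).continuous_fderiv one_ne_zero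
  have h2 : (aF p : E → E) = fun x => p⁻¹ • (InnerProductSpace.toDual ℝ E).symm
      (fderiv ℝ (fun x : E => ‖x‖ ^ p) x) := by
    ext1 x
    rw [fderiv_norm_rpow x hp, mul_smul, map_smul, map_smul, smul_smul, inv_mul_cancel₀ (by linarith),
      one_smul, aF]
    congr 1
    rw [LinearIsometryEquiv.eq_symm_apply]
    rfl
  rw [h2]
  exact ((LinearIsometryEquiv.continuous _).comp h1).const_smul _

lemma aF_convex {p : ℝ} (hp : 1 < p) (a b : E) :
    ‖b‖ ^ p ≤ ‖a‖ ^ p + p * ⟪aF p b, b - a⟫ := by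
  rw [inner_sub_right, inner_aF_self hp]
  have h1 : ⟪aF p b, a⟫ ≤ ‖b‖ ^ (p - 1) * ‖a‖ := by
    refine (real_inner_le_norm _ _).trans ?_
    rw [norm_aF hp]
  have h2 := Real.young_inequality_of_nonneg (a := ‖a‖) (b := ‖b‖ ^ (p - 1)) (norm_nonneg _)
    (by positivity) (Real.HolderConjugate.conjExponent hp)
  have h3 : (‖b‖ ^ (p - 1)) ^ (Real.conjExponent p) = ‖b‖ ^ p := by
    rw [← Real.rpow_mul (norm_nonneg _), Real.conjExponent]
    congr 1
    have : p - 1 ≠ 0 := by linarith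
    field_simp
  rw [h3, Real.conjExponent] at h2
  have hp0 : (0 : ℝ) < p := by linarith
  have h4 : p * (‖a‖ * ‖b‖ ^ (p - 1)) ≤ ‖a‖ ^ p + (p - 1) * ‖b‖ ^ p := by
    calc _ ≤ p * (‖a‖ ^ p / p + ‖b‖ ^ p / (p / (p - 1))) := by gcongr
      _ = _ := by
        have : p - 1 ≠ 0 := by linarith
        field_simp
  nlinarith

lemma lip_indicator {Ω V : Set E} (hΩ : IsOpen Ω) (hΩb : Bornology.IsBounded Ω) (hV : IsOpen V)
    (hΩV : closure Ω ⊆ V) {u : E → ℝ} (hu : ContDiffOn ℝ 1 u V) (hpos : ∀ x ∈ Ω, 0 < u x)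
    (h0 : ∀ x ∈ frontier Ω, u x = 0) : ∃ L : ℝ≥0, LipschitzWith L (Ω.indicator u) := by
  have hcpt : IsCompact (closure Ω) := hΩb.isCompact_closure
  have hdc : ContinuousOn (fderiv ℝ u) (closure Ω) :=
    (hu.continuousOn_fderiv_of_isOpen hV le_rfl).mono hΩV
  obtain ⟨L, hL⟩ := hcpt.exists_bound_of_continuousOn hdc
  have hdiff : ∀ x ∈ closure Ω, DifferentiableAt ℝ u x := fun x hx =>
    (hu.differentiableOn one_ne_zero).differentiableAt (hV.mem_nhds (hΩV hx))
  have key1 : ∀ x y, segment ℝ x y ⊆ closure Ω → |u y - u x| ≤ L * ‖y - x‖ := by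
    intro x y h
    exact Convex.norm_image_sub_le_of_norm_fderiv_le (fun z hz => hdiff z (h hz))
      (fun z hz => hL z (h hz)) (convex_segment x y) (left_mem_segment ℝ x y)
      (right_mem_segment ℝ x y)
  have key2 : ∀ x ∈ Ω, ∀ y, ¬ segment ℝ x y ⊆ Ω → |u x| ≤ L * ‖y - x‖ := by
    intro x hx y hxy
    let γ : ℝ → E := fun t => x + t • (y - x)
    have hγ : Continuous γ := by fun_prop
    have hK : IsCompact {t | t ∈ Icc (0 : ℝ) 1 ∧ γ t ∉ Ω} :=
      isCompact_Icc.inter_right (hΩ.isClosed_compl.preimage hγ)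
    have hne : {t | t ∈ Icc (0 : ℝ) 1 ∧ γ t ∉ Ω}.Nonempty := by
      rw [segment_eq_image'] at hxy
      obtain ⟨z, ⟨t, ht, rfl⟩, hz⟩ := not_subset.1 hxy
      exact ⟨t, ht, hz⟩
    obtain ⟨t0, ⟨ht0, ht0'⟩, hmin⟩ := hK.exists_isLeast hne
    have ht0pos : 0 < t0 := by
      rcases ht0.1.lt_or_eq with h | h
      · exact h
      · exfalso; apply ht0'; rw [← h]; simpa [γ] using hx
    have hin : MapsTo γ (Ico 0 t0) Ω := by
      intro t ht
      by_contra h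
      exact absurd (hmin ⟨⟨ht.1, ht.2.le.trans ht0.2⟩, h⟩) (not_le.2 ht.2)
    have hcl : MapsTo γ (Icc 0 t0) (closure Ω) := by
      rw [← closure_Ico ht0pos.ne]
      exact hin.closure hγ
    have hfr : γ t0 ∈ frontier Ω := by
      rw [frontier, hΩ.interior_eq]
      exact ⟨hcl ⟨ht0pos.le, le_rfl⟩, ht0'⟩
    have hseg : segment ℝ x (γ t0) ⊆ closure Ω := by
      rw [segment_eq_image']
      rintro z ⟨s, hs, rfl⟩
      have : x + s • (γ t0 - x) = γ (s * t0) := by simp [γ, mul_smul]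
      change x + s • (γ t0 - x) ∈ closure Ω
      rw [this]
      exact hcl ⟨mul_nonneg hs.1 ht0pos.le, by nlinarith [hs.2]⟩
    have := key1 _ _ hseg
    rw [h0 _ hfr] at this
    have h3 : ‖γ t0 - x‖ ≤ ‖y - x‖ := by
      simp only [γ, add_sub_cancel_left, norm_smul, Real.norm_of_nonneg ht0.1]
      exact mul_le_of_le_one_left (norm_nonneg _) ht0.2
    have hL0 : 0 ≤ L := (norm_nonneg _).trans (hL x (subset_closure hx))
    simp only [zero_sub, abs_neg] at this
    exact this.trans (by gcongr)
  refine ⟨L.toNNReal, LipschitzWith.of_dist_le_mul fun x y => ?_⟩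
  have hLL : L ≤ L.toNNReal := Real.le_coe_toNNReal L
  rw [dist_eq_norm, dist_eq_norm, Real.norm_eq_abs]
  have hle : L * ‖y - x‖ ≤ L.toNNReal * ‖x - y‖ := by
    rw [norm_sub_rev]; gcongr
  by_cases hx : x ∈ Ω <;> by_cases hy : y ∈ Ω
  · rw [indicator_of_mem hx, indicator_of_mem hy]
    by_cases hs : segment ℝ x y ⊆ Ω
    · rw [abs_sub_comm]
      exact (key1 x y (hs.trans subset_closure)).trans hle
    · have h1 := key2 x hx y hs
      have h2 := key2 y hy x (by rwa [segment_symm])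
      rw [norm_sub_rev] at h2
      rw [abs_of_pos (hpos _ hx)] at h1
      rw [abs_of_pos (hpos _ hy)] at h2
      refine le_trans ?_ hle
      rw [abs_le]; constructor <;> linarith [hpos _ hx, hpos _ hy]
  · rw [indicator_of_mem hx, indicator_of_notMem hy, sub_zero]
    exact (key2 x hx y fun h => hy (h (right_mem_segment ℝ x y))).trans hle
  · rw [indicator_of_notMem hx, indicator_of_mem hy, zero_sub, abs_neg]
    refine (key2 y hy x fun h => hx (h (right_mem_segment ℝ y x))).trans ?_
    rw [norm_sub_rev y x] at hle; exact hle
  · rw [indicator_of_notMem hx, indicator_of_notMem hy]; simp; positivity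

lemma tendsto_energy {p : ℝ} (hp : 1 < p) {f : ℕ → E → ℝ} {g : E → ℝ} (h : BConv f g) :
    Tendsto (fun n => ∫ x, ‖gradient (f n) x‖ ^ p) atTop (𝓝 (∫ x, ‖gradient g x‖ ^ p)) := by
  refine h.tendsto_integral (fun _ _ b => ‖b‖ ^ p) ?_ ?_ ?_ ?_
  · fun_prop
  · intro x; simp [Real.zero_rpow (by linarith : p ≠ 0)]
  · exact Eventually.of_forall fun x => by
      exact (continuous_snd.norm).rpow_const fun _ => Or.inr (by linarith)
  · intro K
    refine ⟨K ^ p, Eventually.of_forall fun x a b _ hb => ?_⟩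
    rw [abs_of_nonneg (by positivity)]
    exact Real.rpow_le_rpow (norm_nonneg _) hb (by linarith)

lemma tendsto_mass {p : ℝ} (hp : 1 < p) {f : ℕ → E → ℝ} {g : E → ℝ} (h : BConv f g) :
    Tendsto (fun n => ∫ x, |f n x| ^ p) atTop (𝓝 (∫ x, |g x| ^ p)) := by
  refine h.tendsto_integral (fun _ a _ => |a| ^ p) ?_ ?_ ?_ ?_
  · fun_prop
  · intro x; simp [Real.zero_rpow (by linarith : p ≠ 0)]
  · exact Eventually.of_forall fun x => by
      exact (continuous_fst.abs).rpow_const fun _ => Or.inr (by linarith)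
  · intro K
    refine ⟨K ^ p, Eventually.of_forall fun x a b hb _ => ?_⟩
    rw [abs_of_nonneg (by positivity)]
    exact Real.rpow_le_rpow (abs_nonneg _) hb (by linarith)

lemma tendsto_weak1 {H : E → E} (hH : Measurable H) {M : ℝ} (hHb : ∀ x, ‖H x‖ ≤ M)
    {f : ℕ → E → ℝ} {g : E → ℝ} (h : BConv f g) :
    Tendsto (fun n => ∫ x, ⟪H x, gradient (f n) x⟫) atTop (𝓝 (∫ x, ⟪H x, gradient g x⟫)) := by
  refine h.tendsto_integral (fun x _ b => ⟪H x, b⟫) ?_ ?_ ?_ ?_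
  · exact (hH.comp measurable_fst).inner (by fun_prop)
  · intro x; simp
  · exact Eventually.of_forall fun x => by fun_prop
  · intro K
    refine ⟨M * K, Eventually.of_forall fun x a b _ hb => ?_⟩
    refine (abs_real_inner_le_norm _ _).trans ?_
    have := (norm_nonneg _).trans (hHb x)
    exact mul_le_mul (hHb x) hb (norm_nonneg _) this

lemma tendsto_weak2 {H : E → ℝ} (hH : Measurable H) {M : ℝ} (hHb : ∀ x, |H x| ≤ M)
    {f : ℕ → E → ℝ} {g : E → ℝ} (h : BConv f g) :
    Tendsto (fun n => ∫ x, H x * f n x) atTop (𝓝 (∫ x, H x * g x)) := by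
  refine h.tendsto_integral (fun x a _ => H x * a) ?_ ?_ ?_ ?_
  · exact (hH.comp measurable_fst).mul (by fun_prop)
  · intro x; simp
  · exact Eventually.of_forall fun x => by fun_prop
  · intro K
    refine ⟨M * K, Eventually.of_forall fun x a b hb _ => ?_⟩
    rw [abs_mul]
    have := (abs_nonneg _).trans (hHb x)
    exact mul_le_mul (hHb x) hb (abs_nonneg _) this

lemma gradient_zero_off {f : E → ℝ} {x : E} (hx : x ∉ tsupport f) : gradient f x = 0 :=
  gradient_eq_zero_of_eventually (notMem_tsupport_iff_eventuallyEq.1 hx)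

end P2

section P2b
variable {N : ℕ}

lemma lam1_nonneg (p : ℝ) (Ω : Set (EuclideanSpace ℝ (Fin N))) : 0 ≤ lam1 p Ω := by
  refine Real.sInf_nonneg ?_
  rintro r ⟨u, -, -, -, -, rfl⟩
  exact div_nonneg (integral_nonneg fun x => by positivity)
    (integral_nonneg fun x => by positivity)

lemma rayleigh {p : ℝ} (hp : 1 < p) {Ω : Set (EuclideanSpace ℝ (Fin N))} (hΩ : IsOpen Ω)
    (hΩb : Bornology.IsBounded Ω) {f : EuclideanSpace ℝ (Fin N) → ℝ} {K : ℝ≥0}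
    (hf : LipschitzWith K f) (hs : ∀ x ∉ Ω, f x = 0) :
    lam1 p Ω * ∫ x, |f x| ^ p ≤ ∫ x, ‖gradient f x‖ ^ p := by
  have hp0 : p ≠ 0 := by linarith
  -- smooth case
  have h1 : ∀ φ : EuclideanSpace ℝ (Fin N) → ℝ, ContDiff ℝ (⊤ : ℕ∞) φ → HasCompactSupport φ →
      tsupport φ ⊆ Ω → lam1 p Ω * ∫ x, |φ x| ^ p ≤ ∫ x, ‖gradient φ x‖ ^ p := by
    intro φ h1 h2 h3
    have e1 : ∫ x in Ω, ‖gradient φ x‖ ^ p = ∫ x, ‖gradient φ x‖ ^ p := by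
      refine setIntegral_eq_integral_of_forall_compl_eq_zero fun x hx => ?_
      rw [gradient_zero_off fun h => hx (h3 h), norm_zero, Real.zero_rpow hp0]
    have e2 : ∫ x in Ω, |φ x| ^ p = ∫ x, |φ x| ^ p := by
      refine setIntegral_eq_integral_of_forall_compl_eq_zero fun x hx => ?_
      rw [image_eq_zero_of_notMem_tsupport fun h => hx (h3 h), abs_zero, Real.zero_rpow hp0]
    rcases eq_or_ne φ 0 with h0 | h0
    · subst h0
      simp only [Pi.zero_apply, abs_zero, Real.zero_rpow hp0, integral_zero, mul_zero]
      exact integral_nonneg fun x => by positivity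
    have hnn : 0 ≤ ∫ x, |φ x| ^ p := integral_nonneg fun x => by positivity
    rcases hnn.eq_or_lt with h | h
    · rw [← h, mul_zero]; exact integral_nonneg fun x => by positivity
    · rw [← le_div_iff₀ h, ← e1, ← e2]
      refine csInf_le ⟨0, ?_⟩ ⟨φ, h1, h0, h2, h3, rfl⟩
      rintro r ⟨u, -, -, -, -, rfl⟩
      exact div_nonneg (integral_nonneg fun x => by positivity)
        (integral_nonneg fun x => by positivity)
  have h2 : ∀ (φ : EuclideanSpace ℝ (Fin N) → ℝ), LipschitzWith K φ → HasCompactSupport φ →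
      tsupport φ ⊆ Ω → lam1 p Ω * ∫ x, |φ x| ^ p ≤ ∫ x, ‖gradient φ x‖ ^ p := by
    intro φ h2 h3 h4
    obtain ⟨ψ, hψ, hψ'⟩ := exists_mollify h2 h3 hΩ h4
    exact le_of_tendsto_of_tendsto' ((tendsto_mass hp hψ).const_mul _) (tendsto_energy hp hψ)
      fun n => h1 _ (hψ' n).1 (hψ' n).2.1 (hψ' n).2.2
  obtain ⟨ψ, hψ, hψ'⟩ := exists_truncate hf hΩb hs
  exact le_of_tendsto_of_tendsto' ((tendsto_mass hp hψ).const_mul _) (tendsto_energy hp hψ)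
      fun n => h2 _ (hψ' n).1 (hψ' n).2.1 (hψ' n).2.2

lemma weak_lip {p : ℝ} (hp : 1 < p) {Ω : Set (EuclideanSpace ℝ (Fin N))} (hΩ : IsOpen Ω)
    (hΩb : Bornology.IsBounded Ω) {lam : ℝ} {u : EuclideanSpace ℝ (Fin N) → ℝ}
    (hu : IsFirstEigenfunction p Ω lam u) {L : ℝ≥0} (hL : LipschitzWith L (Ω.indicator u))
    {f : EuclideanSpace ℝ (Fin N) → ℝ} {K : ℝ≥0}
    (hf : LipschitzWith K f) (hs : ∀ x ∉ Ω, f x = 0) :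
    ∫ x, ⟪aF p (gradient (Ω.indicator u) x), gradient f x⟫ =
      lam * ∫ x, (Ω.indicator u x) ^ (p - 1) * f x := by
  have hpos : ∀ x, 0 ≤ Ω.indicator u x := fun x =>
    indicator_nonneg (fun x hx => (hu.2.1 x hx).le) x
  have hgrad : ∀ x ∈ Ω, gradient (Ω.indicator u) x = gradient u x := fun x hx =>
    Filter.EventuallyEq.gradient_eq (by
      filter_upwards [hΩ.mem_nhds hx] with y hy using indicator_of_mem hy u)
  have m1 : Measurable fun x => aF p (gradient (Ω.indicator u) x) :=
    (continuous_aF hp).measurable.comp (measurable_gradient _)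
  have b1 : ∀ x, ‖aF p (gradient (Ω.indicator u) x)‖ ≤ (L : ℝ) ^ (p - 1) := fun x => by
    rw [norm_aF hp]
    exact Real.rpow_le_rpow (norm_nonneg _) (norm_gradient_le hL x) (by linarith)
  have m2 : Measurable fun x => (Ω.indicator u x) ^ (p - 1) :=
    hL.continuous.measurable.pow_const _
  have hc : HasCompactSupport (Ω.indicator u) := by
    refine hΩb.isCompact_closure.of_isClosed_subset (isClosed_tsupport _) ?_
    exact closure_mono support_indicator_subset
  obtain ⟨M, hM⟩ := hc.exists_bound_of_continuous hL.continuous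
  have b2 : ∀ x, |(Ω.indicator u x) ^ (p - 1)| ≤ M ^ (p - 1) := fun x => by
    rw [abs_of_nonneg (Real.rpow_nonneg (hpos x) _)]
    exact Real.rpow_le_rpow (hpos x) ((le_abs_self _).trans (hM x)) (by linarith)
  have h1 : ∀ φ : EuclideanSpace ℝ (Fin N) → ℝ, ContDiff ℝ (⊤ : ℕ∞) φ → HasCompactSupport φ →
      tsupport φ ⊆ Ω → ∫ x, ⟪aF p (gradient (Ω.indicator u) x), gradient φ x⟫ =
      lam * ∫ x, (Ω.indicator u x) ^ (p - 1) * φ x := by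
    intro φ h1 h2 h3
    have := hu.2.2.2 φ h1 h2 h3
    have e1 : ∫ x in Ω, ⟪aF p (gradient (Ω.indicator u) x), gradient φ x⟫ =
        ∫ x, ⟪aF p (gradient (Ω.indicator u) x), gradient φ x⟫ := by
      refine setIntegral_eq_integral_of_forall_compl_eq_zero fun x hx => ?_
      rw [gradient_zero_off fun h => hx (h3 h), inner_zero_right]
    have e2 : ∫ x in Ω, (Ω.indicator u x) ^ (p - 1) * φ x =
        ∫ x, (Ω.indicator u x) ^ (p - 1) * φ x := by
      refine setIntegral_eq_integral_of_forall_compl_eq_zero fun x hx => ?_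
      rw [image_eq_zero_of_notMem_tsupport fun h => hx (h3 h), mul_zero]
    have e3 : ∫ x in Ω, ⟪aF p (gradient (Ω.indicator u) x), gradient φ x⟫ =
        ∫ x in Ω, ‖gradient u x‖ ^ (p - 2) * ⟪gradient u x, gradient φ x⟫ := by
      refine setIntegral_congr_fun hΩ.measurableSet fun x hx => ?_
      simp only [aF, hgrad x hx, real_inner_smul_left]
    have e4 : ∫ x in Ω, (Ω.indicator u x) ^ (p - 1) * φ x =
        ∫ x in Ω, (u x) ^ (p - 1) * φ x := by
      refine setIntegral_congr_fun hΩ.measurableSet fun x hx => ?_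
      simp only [indicator_of_mem hx]
    rw [← e1, ← e2, e3, e4, this]
  have h2 : ∀ (φ : EuclideanSpace ℝ (Fin N) → ℝ), LipschitzWith K φ → HasCompactSupport φ →
      tsupport φ ⊆ Ω → ∫ x, ⟪aF p (gradient (Ω.indicator u) x), gradient φ x⟫ =
      lam * ∫ x, (Ω.indicator u x) ^ (p - 1) * φ x := by
    intro φ h2 h3 h4
    obtain ⟨ψ, hψ, hψ'⟩ := exists_mollify h2 h3 hΩ h4
    refine tendsto_nhds_unique (tendsto_weak1 m1 b1 hψ)
      (((tendsto_weak2 m2 b2 hψ).const_mul lam).congr fun n => ?_)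
    exact (h1 _ (hψ' n).1 (hψ' n).2.1 (hψ' n).2.2).symm
  obtain ⟨ψ, hψ, hψ'⟩ := exists_truncate hf hΩb hs
  refine tendsto_nhds_unique (tendsto_weak1 m1 b1 hψ)
      (((tendsto_weak2 m2 b2 hψ).const_mul lam).congr fun n => ?_)
  exact (h2 _ (hψ' n).1 (hψ' n).2.1 (hψ' n).2.2).symm

end P2b
end PL

open MeasureTheory Metric Set Filter
open scoped RealInnerProductSpace ENNReal Topology NNReal

namespace PL
section P3
set_option linter.unusedSectionVars false
variable {E : Type*} [NormedAddCommGroup E] [InnerProductSpace ℝ E] [FiniteDimensional ℝ E]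
  [MeasurableSpace E] [BorelSpace E]

/-- linear reflection -/
noncomputable def rf (h : E) : E ≃ₗᵢ[ℝ] E := (ℝ ∙ h)ᗮ.reflection

lemma rf_apply {h : E} (hh : ‖h‖ = 1) (y : E) : rf h y = y - (2 * ⟪y, h⟫) • h := by
  rw [rf, Submodule.reflection_orthogonal_apply, Submodule.reflection_singleton_apply, hh,
    real_inner_comm]
  simp [mul_smul, two_smul]

lemma rf_rf (h y : E) : rf h (rf h y) = y := Submodule.reflection_reflection _ _

lemma rf_symm (h : E) : (rf h).symm = rf h := Submodule.reflection_symm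

/-- affine reflection -/
noncomputable def sg (c h x : E) : E := c + rf h (x - c)

lemma sg_sub (c h x : E) : sg c h x - c = rf h (x - c) := by simp [sg]

lemma sg_sg (c h x : E) : sg c h (sg c h x) = x := by
  rw [sg, sg_sub, rf_rf]; abel

lemma norm_sg_sub (c h x : E) : ‖sg c h x - c‖ = ‖x - c‖ := by
  rw [sg_sub, LinearIsometryEquiv.norm_map]

lemma sg_apply {c h : E} (hh : ‖h‖ = 1) (x : E) : sg c h x = x - (2 * ⟪x - c, h⟫) • h := by
  rw [sg, rf_apply hh]; abel

lemma inner_sg {c h : E} (hh : ‖h‖ = 1) (x : E) : ⟪sg c h x - c, h⟫ = - ⟪x - c, h⟫ := by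
  rw [sg_sub, rf_apply hh, inner_sub_left, real_inner_smul_left, real_inner_self_eq_norm_sq, hh]
  ring

lemma dist_sg (c h x y : E) : dist (sg c h x) (sg c h y) = dist x y := by
  simp [sg]

lemma lip_sg (c h : E) : LipschitzWith 1 (sg c h) :=
  LipschitzWith.of_dist_le_mul fun x y => by rw [dist_sg]; simp

lemma continuous_sg (c h : E) : Continuous (sg c h) := (lip_sg c h).continuous

lemma mp_sg (c h : E) : MeasurePreserving (sg c h) (volume : Measure E) volume := by
  have h1 := (rf h).measurePreserving
  have h2 := measurePreserving_sub_right (volume : Measure E) c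
  have h3 := measurePreserving_add_left (volume : Measure E) c
  exact h3.comp (h1.comp h2)

/-- as a measurable equiv-/
noncomputable def sgE (c h : E) : E ≃ₜ E where
  toFun := sg c h
  invFun := sg c h
  left_inv := sg_sg c h
  right_inv := sg_sg c h
  continuous_toFun := continuous_sg c h
  continuous_invFun := continuous_sg c h

lemma integral_sg (c h : E) (f : E → ℝ) : ∫ x, f (sg c h x) = ∫ x, f x :=
  (mp_sg c h).integral_comp (sgE c h).measurableEmbedding f

lemma norm_sg_sq {c h : E} (hh : ‖h‖ = 1) (x : E) :
    ‖sg c h x‖ ^ 2 = ‖x‖ ^ 2 - 4 * ⟪x - c, h⟫ * ⟪c, h⟫ := by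
  rw [sg_apply hh, norm_sub_sq_real, real_inner_smul_right, norm_smul, hh, mul_one, Real.norm_eq_abs,
    sq_abs, inner_sub_left]
  ring

lemma hasFDerivAt_sg (c h x : E) :
    HasFDerivAt (sg c h) ((rf h : E ≃L[ℝ] E) : E →L[ℝ] E) x := by
  have h1 := ((rf h : E ≃L[ℝ] E) : E →L[ℝ] E).hasFDerivAt (x := x - c)
  have h2 := h1.comp x ((hasFDerivAt_id x).sub_const c)
  exact h2.const_add c

lemma hasGradientAt_sg {f : E → ℝ} {c h x g : E} (hf : HasGradientAt f g (sg c h x)) :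
    HasGradientAt (fun y => f (sg c h y)) (rf h g) x := by
  rw [hasGradientAt_iff_hasFDerivAt] at hf ⊢
  have := hf.comp x (hasFDerivAt_sg c h x)
  refine this.congr_fderiv ?_
  ext y
  have := (rf h).inner_map_map g (rf h y)
  rw [rf_rf] at this
  simpa using this.symm

lemma gradient_sg (f : E → ℝ) (c h x : E) :
    gradient (fun y => f (sg c h y)) x = rf h (gradient f (sg c h x)) := by
  by_cases hd : DifferentiableAt ℝ f (sg c h x)
  · exact (hasGradientAt_sg hd.hasGradientAt).gradient
  · have hd' : ¬ DifferentiableAt ℝ (fun y => f (sg c h y)) x := by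
      intro H
      rw [← sg_sg c h x] at H
      have := H.comp (sg c h x) (hasFDerivAt_sg c h _).differentiableAt
      apply hd
      have e : (fun y => f (sg c h y)) ∘ sg c h = f := by
        ext y; simp only [Function.comp_apply, sg_sg]
      rwa [e] at this
    rw [gradient_eq_zero_of_not_differentiableAt hd, gradient_eq_zero_of_not_differentiableAt hd']
    simp

lemma conv_lt {p : ℝ} (hp : 1 < p) {a b : E} (hab : a ≠ b) {t : ℝ} (h0 : 0 < t) (h1 : t < 1) :
    ‖t • a + (1 - t) • b‖ ^ p < t * ‖a‖ ^ p + (1 - t) * ‖b‖ ^ p := by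
  by_cases hn : ‖a‖ = ‖b‖
  · have := norm_combo_lt_of_ne (le_refl ‖a‖) hn.ge hab h0 (sub_pos.2 h1) (by ring)
    calc _ < ‖a‖ ^ p := Real.rpow_lt_rpow (norm_nonneg _) this (by linarith)
      _ = _ := by rw [← hn]; ring
  · have h2 := (strictConvexOn_rpow hp).2 (norm_nonneg a) (norm_nonneg b) hn h0 (sub_pos.2 h1)
      (by ring)
    simp only [smul_eq_mul] at h2
    refine lt_of_le_of_lt ?_ h2
    refine Real.rpow_le_rpow (norm_nonneg _) ?_ (by linarith)
    refine (norm_add_le _ _).trans ?_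
    rw [norm_smul, norm_smul, Real.norm_of_nonneg h0.le, Real.norm_of_nonneg (sub_pos.2 h1).le]

lemma conv_le {p : ℝ} (hp : 1 < p) (a b : E) {t : ℝ} (h0 : 0 < t) (h1 : t < 1) :
    ‖t • a + (1 - t) • b‖ ^ p ≤ t * ‖a‖ ^ p + (1 - t) * ‖b‖ ^ p := by
  rcases eq_or_ne a b with rfl | h
  · rw [← add_smul]; simp [← add_mul]
  · exact (conv_lt hp h h0 h1).le

/-- p-mean of two functions -/
noncomputable def pm (p : ℝ) (f g : E → ℝ) (x : E) : ℝ := ((f x ^ p + g x ^ p) / 2) ^ (1 / p)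

lemma pm_aux {p : ℝ} (hp : 1 < p) {a b d : ℝ} (ha : 0 ≤ a) (hb : 0 ≤ b) (hd : 0 ≤ d) :
    (((a + d) ^ p + (b + d) ^ p) / 2) ^ (1 / p) ≤ ((a ^ p + b ^ p) / 2) ^ (1 / p) + d := by
  have h := Real.Lp_add_le_of_nonneg (s := (Finset.univ : Finset (Fin 2))) (f := ![a, b])
    (g := ![d, d]) (p := p) hp.le (by intro i _; fin_cases i <;> simpa)
    (by intro i _; fin_cases i <;> simpa)
  simp [Fin.sum_univ_two] at h
  have hp0 : p ≠ 0 := by linarith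
  have h2 : (0 : ℝ) < 2 ^ (1 / p) := by positivity
  rw [Real.div_rpow (by positivity) (by norm_num), Real.div_rpow (by positivity) (by norm_num),
    div_add' _ _ _ h2.ne', div_le_div_iff_of_pos_right h2]
  have h3 : (d ^ p + d ^ p) ^ p⁻¹ = d * 2 ^ p⁻¹ := by
    rw [← two_mul, Real.mul_rpow (by norm_num) (by positivity), Real.rpow_rpow_inv hd hp0, mul_comm]
  rw [h3] at h
  simpa using h

lemma lip_pm {p : ℝ} (hp : 1 < p) {f g : E → ℝ} {K K' : ℝ≥0} (hf : LipschitzWith K f)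
    (hg : LipschitzWith K' g) (hf0 : ∀ x, 0 ≤ f x) (hg0 : ∀ x, 0 ≤ g x) :
    LipschitzWith (max K K') (pm p f g) := by
  refine LipschitzWith.of_le_add_mul _ fun x y => ?_
  have h1 := (hf.weaken (le_max_left K K')).le_add_mul x y
  have h2 := (hg.weaken (le_max_right K K')).le_add_mul x y
  refine le_trans ?_ (pm_aux hp (hf0 y) (hg0 y) (by positivity))
  unfold pm
  have := hf0 x
  have := hg0 x
  have := hf0 y
  have := hg0 y
  gcongr

lemma pm_pow {p : ℝ} (hp : 1 < p) {f g : E → ℝ} (x : E) (hf0 : 0 ≤ f x) (hg0 : 0 ≤ g x) :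
    pm p f g x ^ p = (f x ^ p + g x ^ p) / 2 := by
  unfold pm
  rw [← Real.rpow_mul (by positivity), one_div, inv_mul_cancel₀ (by linarith), Real.rpow_one]

lemma pm_nonneg {p : ℝ} {f g : E → ℝ} (x : E) (hf0 : 0 ≤ f x) (hg0 : 0 ≤ g x) :
    0 ≤ pm p f g x := by
  unfold pm; positivity

lemma pm_pos {p : ℝ} {f g : E → ℝ} (x : E) (hf0 : 0 < f x) (hg0 : 0 < g x) :
    0 < pm p f g x := by
  unfold pm; positivity

lemma pm_grad {p : ℝ} (hp : 1 < p) {f g : E → ℝ} {x : E} (hf : DifferentiableAt ℝ f x)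
    (hg : DifferentiableAt ℝ g x) (hf0 : 0 < f x) (hg0 : 0 < g x) :
    ‖gradient (pm p f g) x‖ ^ p ≤ (‖gradient f x‖ ^ p + ‖gradient g x‖ ^ p) / 2 ∧
    (‖gradient (pm p f g) x‖ ^ p = (‖gradient f x‖ ^ p + ‖gradient g x‖ ^ p) / 2 →
      (f x)⁻¹ • gradient f x = (g x)⁻¹ • gradient g x) := by
  set w := pm p f g x with hw
  have hw0 : 0 < w := pm_pos x hf0 hg0
  have hwp : w ^ p = (f x ^ p + g x ^ p) / 2 := pm_pow hp x hf0.le hg0.le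
  have hfp : 0 < f x ^ p := by positivity
  have hgp : 0 < g x ^ p := by positivity
  have hwpp : 0 < w ^ p := by positivity
  set t := f x ^ p / (2 * w ^ p) with ht
  have ht' : 1 - t = g x ^ p / (2 * w ^ p) := by
    rw [ht, eq_div_iff (by positivity), sub_mul, div_mul_cancel₀ _ (by positivity), hwp]; ring
  have ht0 : 0 < t := by positivity
  have ht1 : t < 1 := by
    have : 0 < 1 - t := by rw [ht']; positivity
    linarith
  have hG : HasGradientAt (pm p f g) (w • (t • ((f x)⁻¹ • gradient f x) +
      (1 - t) • ((g x)⁻¹ • gradient g x))) x := by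
    rw [hasGradientAt_iff_hasFDerivAt]
    have h1 := hf.hasFDerivAt.rpow_const (p := p) (Or.inl hf0.ne')
    have h2 := hg.hasFDerivAt.rpow_const (p := p) (Or.inl hg0.ne')
    have h3 := ((h1.fun_add h2).mul_const (2⁻¹ : ℝ)).rpow_const (p := 1 / p) (Or.inl (by
      positivity))
    have h4 : pm p f g = fun x => ((f x ^ p + g x ^ p) * 2⁻¹) ^ (1 / p) := by
      ext x; simp only [pm, div_eq_mul_inv]
    rw [h4]
    refine h3.congr_fderiv ?_
    have e0 : (f x ^ p + g x ^ p) * 2⁻¹ = w ^ p := by rw [hwp, div_eq_mul_inv]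
    have e1 : (w ^ p) ^ (1 / p - 1) = w / w ^ p := by
      rw [Real.rpow_sub hwpp, Real.rpow_one, ← Real.rpow_mul hw0.le, mul_one_div_cancel (by linarith),
        Real.rpow_one]
    have e2 : f x ^ (p - 1) = f x ^ p / f x := by rw [Real.rpow_sub hf0, Real.rpow_one]
    have e3 : g x ^ (p - 1) = g x ^ p / g x := by rw [Real.rpow_sub hg0, Real.rpow_one]
    rw [e0, e1, e2, e3, ht', ht]
    ext y
    have hp0 : p ≠ 0 := by linarith
    simp [gradient]
    field_simp
  rw [hG.gradient]
  have hn : ∀ a : E, ‖w • a‖ ^ p = w ^ p * ‖a‖ ^ p := fun a => by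
    rw [norm_smul, Real.norm_of_nonneg hw0.le, Real.mul_rpow hw0.le (norm_nonneg _)]
  have h2 : w ^ p * (t * ‖(f x)⁻¹ • gradient f x‖ ^ p + (1 - t) * ‖(g x)⁻¹ • gradient g x‖ ^ p) =
      (‖gradient f x‖ ^ p + ‖gradient g x‖ ^ p) / 2 := by
    rw [norm_smul, norm_smul, Real.norm_of_nonneg (by positivity), Real.norm_of_nonneg (by positivity),
      Real.mul_rpow (by positivity) (norm_nonneg _), Real.mul_rpow (by positivity) (norm_nonneg _),
      Real.inv_rpow hf0.le, Real.inv_rpow hg0.le, ht', ht]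
    field_simp
  rw [hn, ← h2]
  refine ⟨by gcongr; exact conv_le hp _ _ ht0 ht1, fun h => ?_⟩
  by_contra hne
  have := conv_lt hp hne ht0 ht1
  exact this.ne (mul_left_cancel₀ hwpp.ne' h)

end P3
end PL

open MeasureTheory Metric Set Filter
open scoped RealInnerProductSpace ENNReal Topology NNReal

namespace PL
section P4
set_option linter.unusedSectionVars false
set_option linter.unusedVariables false

/-- eccentric annulus -/
def An {E : Type*} [NormedAddCommGroup E] [InnerProductSpace ℝ E] (R₀ R₁ : ℝ) (c : E) : Set E :=
  ball 0 R₁ \ closedBall c R₀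

/-- All data used in the proof. -/
structure Dat (E : Type*) [NormedAddCommGroup E] [InnerProductSpace ℝ E] [FiniteDimensional ℝ E]
    [MeasurableSpace E] [BorelSpace E] where
  p : ℝ
  R₀ : ℝ
  R₁ : ℝ
  s : ℝ
  lam : ℝ → ℝ
  e : E
  u : E → ℝ
  G : E → E
  L : ℝ≥0
  hp : 1 < p
  hR₀ : 0 < R₀
  hs : 0 < s
  hs' : R₀ + s < R₁
  he : ‖e‖ = 1
  hrank : 1 < Module.rank ℝ E
  lipU : LipschitzWith L ((An R₀ R₁ (s • e)).indicator u)
  hG : ∀ x, ‖x‖ < R₁ → R₀ ≤ ‖x - s • e‖ → HasGradientAt u (G x) x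
  hGc : ContinuousOn G {x | ‖x‖ < R₁ ∧ R₀ ≤ ‖x - s • e‖}
  u0 : ∀ x, ‖x - s • e‖ = R₀ → u x = 0
  upos : ∀ x ∈ An R₀ R₁ (s • e), 0 < u x
  ray : ∀ (t : ℝ) (f : E → ℝ) (K : ℝ≥0), LipschitzWith K f → (∀ x ∉ An R₀ R₁ (t • e), f x = 0) →
    lam t * ∫ x, |f x| ^ p ≤ ∫ x, ‖gradient f x‖ ^ p
  weak : ∀ (f : E → ℝ) (K : ℝ≥0), LipschitzWith K f → (∀ x ∉ An R₀ R₁ (s • e), f x = 0) →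
    ∫ x, ⟪aF p (gradient ((An R₀ R₁ (s • e)).indicator u) x), gradient f x⟫ =
      lam s * ∫ x, ((An R₀ R₁ (s • e)).indicator u x) ^ (p - 1) * f x
  lam0 : ∀ t, 0 ≤ lam t
  hder : HasDerivAt lam 0 s

namespace Dat
variable {E : Type*} [NormedAddCommGroup E] [InnerProductSpace ℝ E] [FiniteDimensional ℝ E]
  [MeasurableSpace E] [BorelSpace E] (d : Dat E)

/-- centre of the hole -/
def c : E := d.s • d.e
/-- domain -/
def Ω : Set E := An d.R₀ d.R₁ d.c
/-- extension by zero -/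
noncomputable def U : E → ℝ := d.Ω.indicator d.u
/-- concentric annulus -/
def A : Set E := {x | d.R₀ < ‖x - d.c‖ ∧ ‖x - d.c‖ < d.R₁ - d.s}

lemma mem_Ω {x : E} : x ∈ d.Ω ↔ ‖x‖ < d.R₁ ∧ d.R₀ < ‖x - d.c‖ := by
  simp [Ω, An, dist_eq_norm]

lemma isOpen_Ω : IsOpen d.Ω := isOpen_ball.sdiff isClosed_closedBall

lemma norm_c : ‖d.c‖ = d.s := by
  rw [c, norm_smul, d.he, mul_one, Real.norm_of_nonneg d.hs.le]

lemma norm_lt {x : E} (h : ‖x - d.c‖ < d.R₁ - d.s) : ‖x‖ < d.R₁ := by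
  have := norm_le_norm_sub_add x d.c
  rw [d.norm_c] at this; linarith

lemma A_sub : d.A ⊆ d.Ω := fun x hx => d.mem_Ω.2 ⟨d.norm_lt hx.2, hx.1⟩

lemma isOpen_A : IsOpen d.A := by
  have h : Continuous fun x : E => ‖x - d.c‖ := by fun_prop
  exact (isOpen_lt continuous_const h).inter (isOpen_lt h continuous_const)

lemma U_eq {x : E} (hx : x ∈ d.Ω) : d.U x = d.u x := indicator_of_mem hx _
lemma U_zero {x : E} (hx : x ∉ d.Ω) : d.U x = 0 := indicator_of_notMem hx _
lemma U_pos {x : E} (hx : x ∈ d.Ω) : 0 < d.U x := by rw [d.U_eq hx]; exact d.upos x hx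
lemma U_nonneg (x : E) : 0 ≤ d.U x := by
  by_cases hx : x ∈ d.Ω
  · exact (d.U_pos hx).le
  · exact (d.U_zero hx).ge
lemma lipU' : LipschitzWith d.L d.U := d.lipU
lemma contU : Continuous d.U := d.lipU'.continuous

lemma U_grad {x : E} (hx : x ∈ d.Ω) : HasGradientAt d.U (d.G x) x := by
  have h := d.mem_Ω.1 hx
  refine (d.hG x h.1 h.2.le).congr_of_eventuallyEq ?_
  filter_upwards [d.isOpen_Ω.mem_nhds hx] with y hy using d.U_eq hy

lemma U_gradient {x : E} (hx : x ∈ d.Ω) : gradient d.U x = d.G x := (d.U_grad hx).gradient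

lemma contG : ContinuousOn d.G d.Ω := d.hGc.mono fun x hx =>
  ⟨(d.mem_Ω.1 hx).1, (d.mem_Ω.1 hx).2.le⟩

lemma Ω_bdd : d.Ω ⊆ closedBall 0 d.R₁ := fun x hx => by
  simpa using (d.mem_Ω.1 hx).1.le

lemma hcU : HasCompactSupport d.U := by
  refine (isCompact_closedBall (0 : E) d.R₁).of_isClosed_subset (isClosed_tsupport _) ?_
  exact closure_minimal ((support_indicator_subset).trans d.Ω_bdd) isClosed_closedBall

lemma rayU {f : E → ℝ} {K : ℝ≥0} (hf : LipschitzWith K f) (h0 : ∀ x ∉ d.Ω, f x = 0) :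
    d.lam d.s * ∫ x, |f x| ^ d.p ≤ ∫ x, ‖gradient f x‖ ^ d.p := d.ray _ f K hf h0

lemma weakU {f : E → ℝ} {K : ℝ≥0} (hf : LipschitzWith K f) (h0 : ∀ x ∉ d.Ω, f x = 0) :
    ∫ x, ⟪aF d.p (gradient d.U x), gradient f x⟫ = d.lam d.s * ∫ x, d.U x ^ (d.p - 1) * f x :=
  d.weak f K hf h0

lemma energyU : ∫ x, ‖gradient d.U x‖ ^ d.p = d.lam d.s * ∫ x, d.U x ^ d.p := by
  have := d.weakU d.lipU' (fun x hx => d.U_zero hx)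
  simp only [inner_aF_self d.hp] at this
  rw [this]
  congr 1
  refine integral_congr_ae (Eventually.of_forall fun x => ?_)
  have h := d.U_nonneg x
  rcases h.eq_or_lt with h | h
  · simp [← h, Real.zero_rpow (by linarith [d.hp] : d.p ≠ 0)]
  · simp only
    nth_rewrite 2 [← Real.rpow_one (d.U x)]
    rw [← Real.rpow_add h]; ring_nf

end Dat

section general
variable {E : Type*} [NormedAddCommGroup E] [InnerProductSpace ℝ E] [FiniteDimensional ℝ E]
  [MeasurableSpace E] [BorelSpace E]

lemma integrable_of_bdd {g : E → ℝ} {B : Set E} (hB : Bornology.IsBounded B) (hBm : MeasurableSet B)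
    (hg : Measurable g) {M : ℝ} (hM : ∀ x, |g x| ≤ M) (h0 : ∀ x ∉ B, g x = 0) : Integrable g := by
  rw [← integrableOn_iff_integrable_of_support_subset (s := B) (fun x hx => by
    by_contra h; exact hx (h0 x h))]
  exact Measure.integrableOn_of_bounded hB.measure_lt_top.ne hg.aestronglyMeasurable
    (M := M) (ae_of_all _ hM)

lemma integrable_energy {p : ℝ} (hp : 1 < p) {f : E → ℝ} {K : ℝ≥0} (hf : LipschitzWith K f) {R : ℝ}
    (h0 : ∀ x ∉ closedBall (0 : E) R, f x = 0) : Integrable fun x => ‖gradient f x‖ ^ p := by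
  refine integrable_of_bdd (B := closedBall (0 : E) R) isBounded_closedBall
    isClosed_closedBall.measurableSet ((measurable_gradient f).norm.pow_const p) (M := K ^ p) ?_ ?_
  · intro x
    rw [abs_of_nonneg (by positivity)]
    exact Real.rpow_le_rpow (norm_nonneg _) (norm_gradient_le hf x) (by linarith)
  · intro x hx
    have : f =ᶠ[𝓝 x] 0 := by
      filter_upwards [isClosed_closedBall.isOpen_compl.mem_nhds hx] with y hy using h0 y hy
    rw [gradient_eq_zero_of_eventually this, norm_zero, Real.zero_rpow (by linarith)]

lemma integrable_mass {p : ℝ} (hp : 0 < p) {f : E → ℝ} (hf : Continuous f) {R : ℝ}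
    (h0 : ∀ x ∉ closedBall (0 : E) R, f x = 0) : Integrable fun x => f x ^ p := by
  have hc : Continuous fun x => f x ^ p := hf.rpow_const fun _ => Or.inr hp.le
  refine hc.integrable_of_hasCompactSupport (HasCompactSupport.intro (isCompact_closedBall (0:E) R) ?_)
  intro x hx; rw [h0 x hx, Real.zero_rpow hp.ne']

lemma swap_integral {c h : E} {O : Set E} (hO : MeasurableSet O) (hinv : sg c h ⁻¹' O = O) {g k : E → ℝ}
    (hg : Integrable g) (h1 : ∀ᵐ x, x ∈ O → k x = g (sg c h x)) (h2 : ∀ᵐ x, x ∉ O → k x = g x) :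
    ∫ x, k x = ∫ x, g x := by
  have e : ∀ᵐ x, k x = O.indicator (fun x => g (sg c h x)) x + Oᶜ.indicator g x := by
    filter_upwards [h1, h2] with x h1 h2
    by_cases hx : x ∈ O
    · simp [hx, h1 hx]
    · simp [hx, h2 hx]
  have hg' : Integrable fun x => g (sg c h x) := (mp_sg c h).integrable_comp_of_integrable hg
  rw [integral_congr_ae e, integral_add (hg'.indicator hO) (hg.indicator hO.compl),
    ← integral_add_compl hO hg, ← integral_indicator hO.compl, ← integral_indicator hO]
  congr 1
  rw [← integral_sg c h]
  refine integral_congr_ae (Eventually.of_forall fun x => ?_)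
  have : sg c h x ∈ O ↔ x ∈ O := by
    conv_rhs => rw [← hinv]
    rfl
  by_cases hx : x ∈ O
  · simp only [indicator_of_mem hx, indicator_of_mem (this.2 hx), sg_sg]
  · simp only [indicator_of_notMem hx, indicator_of_notMem (fun h => hx (this.1 h))]

lemma eq_of_ae_eq_open {F : Type*} [TopologicalSpace F] [T2Space F] {f g : E → F} {W : Set E}
    (hW : IsOpen W) (h : ∀ᵐ x, x ∈ W → f x = g x) (hf : ContinuousOn f W) (hg : ContinuousOn g W) :
    EqOn f g W := by
  refine Measure.eqOn_open_of_ae_eq (μ := (volume : Measure E)) ?_ hW hf hg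
  rw [EventuallyEq, ae_restrict_iff' hW.measurableSet]; exact h
end general

end P4
end PL

open MeasureTheory Metric Set Filter
open scoped RealInnerProductSpace ENNReal Topology NNReal

namespace PL
section P5
set_option linter.unusedSectionVars false
set_option linter.unusedVariables false
namespace Dat
variable {E : Type*} [NormedAddCommGroup E] [InnerProductSpace ℝ E] [FiniteDimensional ℝ E]
  [MeasurableSpace E] [BorelSpace E] (d : Dat E)

lemma inner_c {h : E} (hh : 0 ≤ ⟪h, d.e⟫) : 0 ≤ ⟪d.c, h⟫ := by
  rw [c, real_inner_smul_left, real_inner_comm]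
  exact mul_nonneg d.hs.le hh

lemma sg_Ω {h : E} (h1 : ‖h‖ = 1) (hh : 0 ≤ ⟪h, d.e⟫) {x : E} (ha : 0 ≤ ⟪x - d.c, h⟫) (hx : x ∈ d.Ω) :
    sg d.c h x ∈ d.Ω := by
  rw [mem_Ω] at hx ⊢
  rw [norm_sg_sub]
  refine ⟨lt_of_le_of_lt ?_ hx.1, hx.2⟩
  rw [← sq_le_sq₀ (norm_nonneg _) (norm_nonneg _), norm_sg_sq h1]
  have := mul_nonneg ha (d.inner_c hh)
  linarith

lemma sg_A {h : E} {x : E} (hx : x ∈ d.A) : sg d.c h x ∈ d.A := by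
  simpa only [A, mem_ofPred_eq, norm_sg_sub] using hx

/-- truncation used in the polarization -/
noncomputable def zz (h x : E) : ℝ :=
  min (max (d.U x - d.U (sg d.c h x)) 0) (2 * d.L * max ⟪x - d.c, h⟫ 0)

/-- polarized function -/
noncomputable def ff (h x : E) : ℝ := d.U x - d.zz h x + d.zz h (sg d.c h x)

lemma lip_ff {h : E} (h1 : ‖h‖ = 1) : ∃ K, LipschitzWith K (d.ff h) := by
  have hV : LipschitzWith (d.L * 1) (fun x => d.U (sg d.c h x)) := d.lipU'.comp (lip_sg d.c h)
  have ha : LipschitzWith 1 (fun x : E => ⟪x - d.c, h⟫) := by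
    refine LipschitzWith.of_dist_le_mul fun x y => ?_
    rw [dist_eq_norm, ← inner_sub_left, sub_sub_sub_cancel_right, dist_eq_norm]
    refine (norm_inner_le_norm _ _).trans ?_
    rw [h1]; simp
  have hz1 := (d.lipU'.sub hV).max_const 0
  have hz2 := (lipschitzWith_smul (α := ℝ) (β := ℝ) (2 * d.L : ℝ)).comp (ha.max_const 0)
  have hz : ∃ K, LipschitzWith K (d.zz h) := ⟨_, hz1.min hz2⟩
  obtain ⟨K, hK⟩ := hz
  exact ⟨_, (d.lipU'.sub hK).add (hK.comp (lip_sg d.c h))⟩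

lemma UV_le {h : E} (h1 : ‖h‖ = 1) (x : E) :
    |d.U x - d.U (sg d.c h x)| ≤ 2 * d.L * |⟪x - d.c, h⟫| := by
  have := d.lipU'.dist_le_mul x (sg d.c h x)
  rw [Real.dist_eq, dist_eq_norm, sg_apply h1, sub_sub_cancel, norm_smul, h1, mul_one,
    Real.norm_eq_abs, abs_mul, abs_two] at this
  rw [sg_apply h1]
  linarith

lemma zz_right {h : E} (h1 : ‖h‖ = 1) {x : E} (ha : 0 ≤ ⟪x - d.c, h⟫) :
    d.zz h x = max (d.U x - d.U (sg d.c h x)) 0 := by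
  rw [zz, min_eq_left]
  have := d.UV_le h1 x
  rw [abs_of_nonneg ha] at this
  rw [max_eq_left ha]
  exact max_le ((le_abs_self _).trans this) (by positivity)

lemma zz_left {h : E} {x : E} (ha : ⟪x - d.c, h⟫ ≤ 0) : d.zz h x = 0 := by
  rw [zz, max_eq_right ha, mul_zero, min_eq_right (le_max_right _ _)]

lemma ff_right {h : E} (h1 : ‖h‖ = 1) {x : E} (ha : 0 ≤ ⟪x - d.c, h⟫) :
    d.ff h x = min (d.U x) (d.U (sg d.c h x)) := by
  rw [ff, d.zz_right h1 ha, d.zz_left (by rw [inner_sg h1]; linarith), add_zero]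
  rcases le_total (d.U x) (d.U (sg d.c h x)) with H | H
  · rw [min_eq_left H, max_eq_right (by linarith)]; ring
  · rw [min_eq_right H, max_eq_left (by linarith)]; ring

lemma ff_left {h : E} (h1 : ‖h‖ = 1) {x : E} (ha : ⟪x - d.c, h⟫ ≤ 0) :
    d.ff h x = max (d.U x) (d.U (sg d.c h x)) := by
  rw [ff, d.zz_left ha, d.zz_right h1 (by rw [inner_sg h1]; linarith), sg_sg]
  rcases le_total (d.U x) (d.U (sg d.c h x)) with H | H
  · rw [max_eq_right H, max_eq_left (by linarith)]; ring
  · rw [max_eq_left H, max_eq_right (by linarith)]; ring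

/-- swapped set -/
def OO (h : E) : Set E := {x | 0 < ⟪x - d.c, h⟫ * (d.U x - d.U (sg d.c h x))}

lemma isOpen_OO (h : E) : IsOpen (d.OO h) := by
  have h1 : Continuous fun x => d.U (sg d.c h x) := d.contU.comp (continuous_sg _ _)
  have h2 := d.contU
  exact isOpen_lt continuous_const (by fun_prop)

lemma OO_inv {h : E} (h1 : ‖h‖ = 1) : sg d.c h ⁻¹' (d.OO h) = d.OO h := by
  ext x
  simp only [OO, mem_preimage, mem_ofPred_eq, inner_sg h1, sg_sg]
  rw [show -⟪x - d.c, h⟫ * (d.U (sg d.c h x) - d.U x) = ⟪x - d.c, h⟫ * (d.U x - d.U (sg d.c h x)) by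
    ring]

lemma ff_OO {h : E} (h1 : ‖h‖ = 1) {x : E} (hx : x ∈ d.OO h) : d.ff h x = d.U (sg d.c h x) := by
  rcases pos_and_pos_or_neg_and_neg_of_mul_pos
      (show 0 < ⟪x - d.c, h⟫ * (d.U x - d.U (sg d.c h x)) from hx) with ⟨ha, hb⟩ | ⟨ha, hb⟩
  · rw [d.ff_right h1 ha.le, min_eq_right (by linarith)]
  · rw [d.ff_left h1 ha.le, max_eq_right (by linarith)]

lemma ff_notOO {h : E} (h1 : ‖h‖ = 1) {x : E} (hx : x ∉ d.OO h) : d.ff h x = d.U x := by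
  simp only [OO, mem_ofPred_eq, not_lt] at hx
  rcases lt_trichotomy ⟪x - d.c, h⟫ 0 with ha | ha | ha
  · rw [d.ff_left h1 ha.le, max_eq_left]
    have := nonneg_of_mul_nonpos_right hx ha; linarith
  · have : sg d.c h x = x := by rw [sg_apply h1, ha]; simp
    rw [d.ff_right h1 ha.ge, this, min_self]
  · rw [d.ff_right h1 ha.le, min_eq_left]
    have := nonpos_of_mul_nonpos_right hx ha; linarith

lemma ff_zero {h : E} (h1 : ‖h‖ = 1) (hh : 0 ≤ ⟪h, d.e⟫) {x : E} (hx : x ∉ d.Ω) : d.ff h x = 0 := by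
  rcases le_total 0 ⟪x - d.c, h⟫ with ha | ha
  · rw [d.ff_right h1 ha, d.U_zero hx, min_eq_left (d.U_nonneg _)]
  · rw [d.ff_left h1 ha, d.U_zero hx, d.U_zero, max_self]
    intro H
    have := d.sg_Ω h1 hh (by rw [inner_sg h1]; linarith) H
    rw [sg_sg] at this; exact hx this

lemma ff_pos {h : E} (h1 : ‖h‖ = 1) (hh : 0 ≤ ⟪h, d.e⟫) {x : E} (hx : x ∈ d.Ω) : 0 < d.ff h x := by
  rcases le_total 0 ⟪x - d.c, h⟫ with ha | ha
  · rw [d.ff_right h1 ha]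
    exact lt_min (d.U_pos hx) (d.U_pos (d.sg_Ω h1 hh ha hx))
  · rw [d.ff_left h1 ha]
    exact lt_max_of_lt_left (d.U_pos hx)

lemma ff_mass {h : E} (h1 : ‖h‖ = 1) : ∫ x, d.ff h x ^ d.p = ∫ x, d.U x ^ d.p := by
  have hp := d.hp
  refine swap_integral (d.isOpen_OO h).measurableSet (d.OO_inv h1)
    (g := fun x => d.U x ^ d.p) (integrable_mass (by linarith) d.contU (R := d.R₁) fun x hx =>
      d.U_zero fun H => hx (d.Ω_bdd H)) ?_ ?_
  · exact Eventually.of_forall fun x hx => by rw [d.ff_OO h1 hx]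
  · exact Eventually.of_forall fun x hx => by rw [d.ff_notOO h1 hx]

lemma ff_grad_OO {h : E} (h1 : ‖h‖ = 1) {x : E} (hx : x ∈ d.OO h) :
    gradient (d.ff h) x = gradient (fun y => d.U (sg d.c h y)) x := by
  apply Filter.EventuallyEq.gradient_eq
  filter_upwards [(d.isOpen_OO h).mem_nhds hx] with y hy using d.ff_OO h1 hy

lemma ff_energy {h : E} (h1 : ‖h‖ = 1) :
    ∫ x, ‖gradient (d.ff h) x‖ ^ d.p = ∫ x, ‖gradient d.U x‖ ^ d.p := by
  have hp := d.hp
  obtain ⟨K, hK⟩ := d.lip_ff h1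
  refine swap_integral (d.isOpen_OO h).measurableSet (d.OO_inv h1)
    (g := fun x => ‖gradient d.U x‖ ^ d.p) (integrable_energy hp d.lipU' (R := d.R₁) fun x hx =>
      d.U_zero fun H => hx (d.Ω_bdd H)) ?_ ?_
  · exact Eventually.of_forall fun x hx => by
      rw [d.ff_grad_OO h1 hx, gradient_sg, LinearIsometryEquiv.norm_map]
  · filter_upwards [ae_gradient_eq hK d.lipU'] with x hx hx'
    rw [hx (d.ff_notOO h1 hx')]

lemma ff_log {h : E} (h1 : ‖h‖ = 1) (hh : 0 ≤ ⟪h, d.e⟫) :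
    ∀ᵐ x, x ∈ d.Ω → (d.U x)⁻¹ • gradient d.U x = (d.ff h x)⁻¹ • gradient (d.ff h) x := by
  have hp := d.hp
  obtain ⟨K, hK⟩ := d.lip_ff h1
  have hff0 : ∀ x, 0 ≤ d.ff h x := fun x => by
    by_cases hx : x ∈ d.Ω
    · exact (d.ff_pos h1 hh hx).le
    · exact (d.ff_zero h1 hh hx).ge
  have hw := lip_pm hp d.lipU' hK d.U_nonneg hff0
  have hw0 : ∀ x ∉ d.Ω, pm d.p d.U (d.ff h) x = 0 := fun x hx => by
    rw [pm, d.U_zero hx, d.ff_zero h1 hh hx, Real.zero_rpow (by linarith)]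
    simp only [add_zero, zero_div]
    exact Real.zero_rpow (by positivity)
  have out : ∀ {f : E → ℝ}, (∀ x ∉ d.Ω, f x = 0) → ∀ x ∉ closedBall (0 : E) d.R₁, f x = 0 :=
    fun hf x hx => hf x fun H => hx (d.Ω_bdd H)
  have iU := integrable_energy hp d.lipU' (out fun x hx => d.U_zero hx)
  have iF := integrable_energy hp hK (out fun x hx => d.ff_zero h1 hh hx)
  have iW := integrable_energy hp hw (out hw0)
  have mU : Integrable fun x => d.U x ^ d.p :=
    integrable_mass (by linarith) d.contU (out fun x hx => d.U_zero hx)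
  have mF : Integrable fun x => d.ff h x ^ d.p :=
    integrable_mass (by linarith) hK.continuous (out fun x hx => d.ff_zero h1 hh hx)
  have hr := d.rayU hw hw0
  have hm : ∫ x, |pm d.p d.U (d.ff h) x| ^ d.p = ∫ x, d.U x ^ d.p := by
    have : ∀ x, |pm d.p d.U (d.ff h) x| ^ d.p = (d.U x ^ d.p + d.ff h x ^ d.p) / 2 := fun x => by
      rw [abs_of_nonneg (pm_nonneg x (d.U_nonneg x) (hff0 x)), pm_pow hp x (d.U_nonneg x) (hff0 x)]
    simp only [this]
    rw [integral_div, integral_add mU mF, d.ff_mass h1]; ring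
  rw [hm, ← d.energyU] at hr
  let k : E → ℝ := fun x => (‖gradient d.U x‖ ^ d.p + ‖gradient (d.ff h) x‖ ^ d.p) / 2 -
    ‖gradient (pm d.p d.U (d.ff h)) x‖ ^ d.p
  have hk0 : 0 ≤ᵐ[volume] k := by
    filter_upwards [d.lipU'.ae_differentiableAt (μ := volume), hK.ae_differentiableAt (μ := volume),
      ae_gradient_zero hw] with x h2 h3 h4
    simp only [Pi.zero_apply, k, sub_nonneg]
    by_cases hx : x ∈ d.Ω
    · exact (pm_grad hp h2 h3 (d.U_pos hx) (d.ff_pos h1 hh hx)).1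
    · rw [h4 (hw0 x hx), norm_zero, Real.zero_rpow (by linarith)]; positivity
  have hki : Integrable k := ((iU.add iF).div_const 2).sub iW
  have hk : ∫ x, k x = 0 := by
    apply le_antisymm
    · simp only [k]
      have iUF : Integrable fun x => (‖gradient d.U x‖ ^ d.p + ‖gradient (d.ff h) x‖ ^ d.p) / 2 :=
        (iU.add iF).div_const 2
      rw [integral_sub iUF iW, integral_div, integral_add iU iF,
        d.ff_energy h1]
      linarith
    · exact integral_nonneg_of_ae hk0
  rw [integral_eq_zero_iff_of_nonneg_ae hk0 hki] at hk
  filter_upwards [d.lipU'.ae_differentiableAt (μ := volume), hK.ae_differentiableAt (μ := volume),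
      hk] with x h2 h3 h4 hx
  refine (pm_grad hp h2 h3 (d.U_pos hx) (d.ff_pos h1 hh hx)).2 ?_
  simp only [k, Pi.zero_apply] at h4
  linarith

/-- Step D -/
theorem refl_le {h : E} (h1 : ‖h‖ = 1) (hh : 0 ≤ ⟪h, d.e⟫) {x : E} (hx : x ∈ d.A)
    (ha : 0 ≤ ⟪x - d.c, h⟫) : d.U x ≤ d.U (sg d.c h x) := by
  by_contra! hlt
  have hW : IsOpen (d.OO h ∩ d.A) := (d.isOpen_OO h).inter d.isOpen_A
  have cV : Continuous fun x => d.U (sg d.c h x) := d.contU.comp (continuous_sg _ _)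
  have pV : ∀ y ∈ d.A, 0 < d.U (sg d.c h y) := fun y hy => d.U_pos (d.A_sub (d.sg_A hy))
  have pU : ∀ y ∈ d.A, 0 < d.U y := fun y hy => d.U_pos (d.A_sub hy)
  have gU : ∀ y ∈ d.A, HasGradientAt d.U (d.G y) y := fun y hy => d.U_grad (d.A_sub hy)
  have gV : ∀ y ∈ d.A, HasGradientAt (fun y => d.U (sg d.c h y)) (rf h (d.G (sg d.c h y))) y :=
    fun y hy => hasGradientAt_sg (d.U_grad (d.A_sub (d.sg_A hy)))
  have key : EqOn (fun y => (d.U y)⁻¹ • d.G y)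
      (fun y => (d.U (sg d.c h y))⁻¹ • rf h (d.G (sg d.c h y))) (d.OO h ∩ d.A) := by
    refine eq_of_ae_eq_open hW ?_ ?_ ?_
    · filter_upwards [d.ff_log h1 hh] with y hy hyW
      have := hy (d.A_sub hyW.2)
      rw [d.ff_OO h1 hyW.1, d.ff_grad_OO h1 hyW.1, (gU y hyW.2).gradient, (gV y hyW.2).gradient] at this
      exact this
    · refine ContinuousOn.smul (d.contU.continuousOn.inv₀ fun y hy => (pU y hy.2).ne') ?_
      exact d.contG.mono (inter_subset_right.trans d.A_sub)
    · refine ContinuousOn.smul (cV.continuousOn.inv₀ fun y hy => (pV y hy.2).ne') ?_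
      refine (rf h).continuous.comp_continuousOn (d.contG.comp (continuous_sg _ _).continuousOn ?_)
      exact fun y hy => d.A_sub (d.sg_A hy.2)
  let q : E → ℝ := fun y => Real.log (d.U y) - Real.log (d.U (sg d.c h y))
  have cq : ContinuousOn q d.A := (d.contU.continuousOn.log fun y hy => (pU y hy).ne').sub
    (cV.continuousOn.log fun y hy => (pV y hy).ne')
  have dq : ∀ y ∈ d.OO h ∩ d.A, HasFDerivAt q (0 : E →L[ℝ] ℝ) y := by
    intro y hy
    have a1 := (gU y hy.2).hasFDerivAt.log (pU y hy.2).ne'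
    have a2 := (gV y hy.2).hasFDerivAt.log (pV y hy.2).ne'
    refine (a1.fun_sub a2).congr_fderiv ?_
    have := key hy
    simp only at this
    have h3 := congrArg (InnerProductSpace.toDual ℝ E) this
    rw [map_smul, map_smul] at h3
    rw [h3, sub_self]
  have a0 : 0 < ⟪x - d.c, h⟫ := by
    refine lt_of_le_of_ne ha fun H => ?_
    have : sg d.c h x = x := by rw [sg_apply h1, ← H]; simp
    rw [this] at hlt; exact lt_irrefl _ hlt
  set κ := q x with hκ
  have κ0 : 0 < κ := sub_pos.2 (Real.log_lt_log (pV x hx) hlt)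
  let T : Set E := {y | y ∈ d.A ∧ 0 < ⟪y - d.c, h⟫ ∧ q y = κ}
  have hTW : T ⊆ d.OO h ∩ d.A := by
    rintro y ⟨hy, hya, hyq⟩
    refine ⟨?_, hy⟩
    refine mul_pos hya (sub_pos.2 ?_)
    have : 0 < q y := hyq ▸ κ0
    exact (Real.log_lt_log_iff (pV y hy) (pU y hy)).1 (sub_pos.1 this)
  have hcont : Continuous fun y : E => ⟪y - d.c, h⟫ := by fun_prop
  have hT : IsOpen T := by
    rw [Metric.isOpen_iff]
    intro y hy
    obtain ⟨ε, hε, hball⟩ := Metric.isOpen_iff.1 (hW.inter (isOpen_lt continuous_const hcont)) y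
      ⟨hTW hy, hy.2.1⟩
    refine ⟨ε, hε, fun z hz => ⟨(hball hz).1.2, (hball hz).2, ?_⟩⟩
    rw [← hy.2.2]
    exact isOpen_ball.is_const_of_fderiv_eq_zero (convex_ball y ε).isPreconnected
      (fun z hz => (dq z (hball hz).1).differentiableAt.differentiableWithinAt)
      (fun z hz => (dq z (hball hz).1).fderiv) hz (mem_ball_self hε)
  have hS : sphere d.c ‖x - d.c‖ ⊆ d.A := fun y hy => by
    rw [mem_sphere_iff_norm] at hy
    simp only [A, mem_ofPred_eq, hy]; exact hx
  have hsub : sphere d.c ‖x - d.c‖ ⊆ T := by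
    refine (isPreconnected_sphere d.hrank d.c ‖x - d.c‖).subset_of_closure_inter_subset hT
      ⟨x, by simp, hx, a0, rfl⟩ ?_
    rintro y ⟨hy, hyS⟩
    have hyA := hS hyS
    have hya : 0 ≤ ⟪y - d.c, h⟫ :=
      closure_minimal (fun z hz => hz.2.1.le) (isClosed_le continuous_const hcont) hy
    have hyq : q y = κ := by
      have hca : ContinuousAt q y := cq.continuousAt (d.isOpen_A.mem_nhds hyA)
      have : q y ∈ closure ({κ} : Set ℝ) := by
        refine closure_mono ?_ (mem_closure_image hca hy)
        rintro _ ⟨z, hz, rfl⟩; exact hz.2.2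
      simpa using this
    refine ⟨hyA, lt_of_le_of_ne hya fun H => ?_, hyq⟩
    have : sg d.c h y = y := by rw [sg_apply h1, ← H]; simp
    have h0 : q y = 0 := by simp only [q, this, sub_self]
    linarith
  have := (hsub (a := sg d.c h x) (by rw [mem_sphere_iff_norm, norm_sg_sub])).2.1
  rw [inner_sg h1] at this
  linarith

end Dat
end P5
end PL

open MeasureTheory Metric Set Filter
open scoped RealInnerProductSpace ENNReal Topology NNReal

namespace PL
section P6
set_option linter.unusedSectionVars false
set_option linter.unusedVariables false
section gen
variable {E : Type*} [NormedAddCommGroup E] [InnerProductSpace ℝ E] [FiniteDimensional ℝ E]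
  [MeasurableSpace E] [BorelSpace E]

lemma hg_add {f g : E → ℝ} {a b x : E} (hf : HasGradientAt f a x) (hg : HasGradientAt g b x) :
    HasGradientAt (fun y => f y + g y) (a + b) x := by
  rw [hasGradientAt_iff_hasFDerivAt] at *
  exact (hf.fun_add hg).congr_fderiv (by rw [map_add])

lemma hg_sub {f g : E → ℝ} {a b x : E} (hf : HasGradientAt f a x) (hg : HasGradientAt g b x) :
    HasGradientAt (fun y => f y - g y) (a - b) x := by
  rw [hasGradientAt_iff_hasFDerivAt] at *
  exact (hf.fun_sub hg).congr_fderiv (by rw [map_sub])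

lemma hg_mul {f g : E → ℝ} {a b x : E} (hf : HasGradientAt f a x) (hg : HasGradientAt g b x) :
    HasGradientAt (fun y => f y * g y) (f x • b + g x • a) x := by
  rw [hasGradientAt_iff_hasFDerivAt] at *
  exact (hf.fun_mul hg).congr_fderiv (by rw [map_add, map_smul, map_smul])

lemma hg_comp {f : E → ℝ} {φ : ℝ → ℝ} {φ' : ℝ} {a x : E} (hφ : HasDerivAt φ φ' (f x))
    (hf : HasGradientAt f a x) :
    HasGradientAt (fun y => φ (f y)) (φ' • a) x := by
  rw [hasGradientAt_iff_hasFDerivAt] at *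
  exact (hφ.comp_hasFDerivAt x hf).congr_fderiv (by rw [map_smul])

lemma gradient_comp_sub (f : E → ℝ) (a x : E) :
    gradient (fun y => f (y - a)) x = gradient f (x - a) := by
  simp only [gradient, fderiv_comp_sub]

lemma hg_comp_sub {f : E → ℝ} {a x g : E} (h : HasGradientAt f g (x - a)) :
    HasGradientAt (fun y => f (y - a)) g x := by
  rw [hasGradientAt_iff_hasFDerivAt] at *
  exact (h.comp x ((hasFDerivAt_id x).sub_const a)).congr_fderiv (by simp)

/-- directional derivative -/
lemma hg_dir {f : E → ℝ} {g x : E} (h : HasGradientAt f g x) (v : E) :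
    HasDerivAt (fun t : ℝ => f (x + t • v)) ⟪g, v⟫ 0 := by
  rw [hasGradientAt_iff_hasFDerivAt] at h
  have h1 : HasDerivAt (fun t : ℝ => x + t • v) v 0 := by
    simpa using ((hasDerivAt_id (0 : ℝ)).smul_const v).const_add x
  have h2 : HasFDerivAt f ((InnerProductSpace.toDual ℝ E) g) (x + (0 : ℝ) • v) := by simpa using h
  exact h2.comp_hasDerivAt (0 : ℝ) h1

lemma lip_mul {f g : E → ℝ} {K K' : ℝ≥0} (hf : LipschitzWith K f) (hg : LipschitzWith K' g)
    {A B : ℝ≥0} (hA : ∀ x, |f x| ≤ A) (hB : ∀ x, |g x| ≤ B) :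
    LipschitzWith (A * K' + B * K) (fun x => f x * g x) := by
  refine LipschitzWith.of_dist_le_mul fun x y => ?_
  have h1 := hf.dist_le_mul x y
  have h2 := hg.dist_le_mul x y
  rw [Real.dist_eq] at *
  have : f x * g x - f y * g y = f x * (g x - g y) + g y * (f x - f y) := by ring
  rw [this]
  refine (abs_add_le _ _).trans ?_
  rw [abs_mul, abs_mul]
  push_cast
  rw [add_mul, mul_assoc, mul_assoc]
  exact add_le_add (mul_le_mul (hA x) h2 (abs_nonneg _) A.2)
    (mul_le_mul (hB y) h1 (abs_nonneg _) B.2)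

lemma deriv_shift {g k : E → ℝ} {K : ℝ≥0} (hg : LipschitzWith K g) {M : ℝ} (hM : ∀ x, |g x| ≤ M)
    (hk : Measurable k) {B : ℝ} (hB : ∀ x, |k x| ≤ B) {R : ℝ}
    (h0 : ∀ x ∉ closedBall (0 : E) R, k x = 0) (v : E) :
    Integrable (fun x => ⟪gradient g x, v⟫ * k x) ∧
    HasDerivAt (fun τ : ℝ => ∫ x, g (x + τ • v) * k x) (∫ x, ⟪gradient g x, v⟫ * k x) 0 := by
  have hb : Bornology.IsBounded (closedBall (0 : E) R) := isBounded_closedBall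
  have hbm : MeasurableSet (closedBall (0 : E) R) := isClosed_closedBall.measurableSet
  have ik : Integrable k := integrable_of_bdd hb hbm hk hB h0
  have hm : ∀ τ : ℝ, Measurable fun x => g (x + τ • v) * k x := fun τ =>
    (hg.continuous.comp (continuous_add_const _)).measurable.mul hk
  refine hasDerivAt_integral_of_dominated_loc_of_lip (s := univ)
    (bound := fun x => K * ‖v‖ * |k x|) univ_mem
    (Eventually.of_forall fun τ => (hm τ).aestronglyMeasurable) ?_ ?_ ?_ ?_ ?_
  · refine integrable_of_bdd hb hbm (hm 0) (M := M * B) (fun x => ?_) (fun x hx => ?_)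
    · rw [abs_mul]
      exact mul_le_mul (hM _) (hB _) (abs_nonneg _) ((abs_nonneg _).trans (hM x))
    · rw [h0 x hx, mul_zero]
  · exact (((measurable_gradient g).inner measurable_const).mul hk).aestronglyMeasurable
  · refine Eventually.of_forall fun x => LipschitzOnWith.of_dist_le_mul fun a _ b _ => ?_
    rw [Real.dist_eq, Real.dist_eq, ← sub_mul, abs_mul, Real.coe_nnabs,
      abs_of_nonneg (show 0 ≤ K * ‖v‖ * |k x| by positivity)]
    have := hg.dist_le_mul (x + a • v) (x + b • v)
    rw [Real.dist_eq, dist_add_left, dist_eq_norm, ← sub_smul, norm_smul, Real.norm_eq_abs] at this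
    calc _ ≤ K * (|a - b| * ‖v‖) * |k x| := by gcongr
      _ = _ := by ring
  · exact ik.abs.const_mul _
  · filter_upwards [hg.ae_differentiableAt (μ := volume)] with x hx
    exact (hg_dir hx.hasGradientAt v).mul_const _

end gen
namespace Dat
variable {E : Type*} [NormedAddCommGroup E] [InnerProductSpace ℝ E] [FiniteDimensional ℝ E]
  [MeasurableSpace E] [BorelSpace E] (d : Dat E)

lemma U_bdd : ∃ M : ℝ≥0, ∀ x, |d.U x| ≤ M := by
  obtain ⟨M, hM⟩ := d.hcU.exists_bound_of_continuous d.contU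
  exact ⟨M.toNNReal, fun x => (hM x).trans (Real.le_coe_toNNReal M)⟩

/-- deformed function -/
noncomputable def fd (η : E → ℝ) (τ : ℝ) (x : E) : ℝ := d.U x + η x * (d.U (x - τ • d.e) - d.U x)

lemma lip_dd (τ : ℝ) : LipschitzWith (d.L + d.L) (fun x => d.U (x - τ • d.e) - d.U x) := by
  refine LipschitzWith.sub ?_ d.lipU'
  have := d.lipU'.comp (LipschitzWith.id.sub (LipschitzWith.const (τ • d.e)))
  rw [add_zero, mul_one] at this
  exact this

lemma abs_dd (τ : ℝ) (x : E) : |d.U (x - τ • d.e) - d.U x| ≤ d.L * |τ| := by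
  have := d.lipU'.dist_le_mul (x - τ • d.e) x
  rwa [Real.dist_eq, dist_eq_norm, sub_sub_cancel_left, norm_neg, norm_smul, d.he, mul_one,
    Real.norm_eq_abs] at this

lemma lip_fd {η : E → ℝ} {Kη : ℝ≥0} (hη : LipschitzWith Kη η) (h01 : ∀ x, 0 ≤ η x ∧ η x ≤ 1) :
    ∃ K, ∀ τ, LipschitzWith K (d.fd η τ) := by
  obtain ⟨M, hM⟩ := d.U_bdd
  refine ⟨_, fun τ => d.lipU'.add (lip_mul hη (d.lip_dd τ) (A := 1) (B := M + M) ?_ ?_)⟩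
  · intro x; rw [abs_of_nonneg (h01 x).1]; exact (h01 x).2
  · intro x
    exact (abs_sub _ _).trans (add_le_add (hM _) (hM _))

lemma fd_grad {η : E → ℝ} {τ : ℝ} {x a b g : E} (hη : HasGradientAt η g x)
    (ha : HasGradientAt d.U a x) (hb : HasGradientAt d.U b (x - τ • d.e)) :
    HasGradientAt (d.fd η τ) ((1 - η x) • a + η x • b + (d.U (x - τ • d.e) - d.U x) • g) x := by
  have := hg_add ha (hg_mul hη (hg_sub (hg_comp_sub hb) ha))
  unfold fd
  convert this using 1
  module

lemma fd_zero {η : E → ℝ} {ε τ : ℝ} (hε : 2 * ε < d.R₁ - d.s - d.R₀) (hτ : |τ| ≤ ε)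
    (η1 : ∀ x, ‖x - d.c‖ ≤ d.R₀ + ε → η x = 1) (η0 : ∀ x, d.R₀ + 2 * ε ≤ ‖x - d.c‖ → η x = 0)
    {x : E} (hx : x ∉ An d.R₀ d.R₁ ((d.s + τ) • d.e)) : d.fd η τ x = 0 := by
  have hcc : (d.s + τ) • d.e = d.c + τ • d.e := by rw [add_smul]; rfl
  have hx' : d.R₁ ≤ ‖x‖ ∨ ‖x - τ • d.e - d.c‖ ≤ d.R₀ := by
    simp only [An, Set.mem_sdiff, mem_ball_zero_iff, mem_closedBall, dist_eq_norm, not_and_or, not_lt,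
      not_not, hcc] at hx
    rcases hx with h | h
    · exact Or.inl h
    · right; rwa [sub_sub, add_comm]
  rcases hx' with h | h
  · have : d.R₀ + 2 * ε ≤ ‖x - d.c‖ := by
      have := norm_le_norm_sub_add x d.c
      rw [d.norm_c] at this; linarith
    rw [fd, η0 x this, zero_mul, add_zero]
    exact d.U_zero fun H => absurd (d.mem_Ω.1 H).1 (not_lt.2 h)
  · have h2 : ‖x - d.c‖ ≤ d.R₀ + ε := by
      have h3 : x - d.c = (x - τ • d.e - d.c) + τ • d.e := by abel
      rw [h3]
      refine (norm_add_le _ _).trans (add_le_add h ?_)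
      rwa [norm_smul, d.he, mul_one, Real.norm_eq_abs]
    rw [fd, η1 x h2, one_mul, add_sub_cancel]
    exact d.U_zero fun H => absurd (d.mem_Ω.1 H).2 (not_lt.2 h)

end Dat
end P6
end PL

open MeasureTheory Metric Set Filter
open scoped RealInnerProductSpace ENNReal Topology NNReal

namespace PL
section P7
set_option linter.unusedSectionVars false
set_option linter.unusedVariables false
namespace Dat
variable {E : Type*} [NormedAddCommGroup E] [InnerProductSpace ℝ E] [FiniteDimensional ℝ E]
  [MeasurableSpace E] [BorelSpace E] (d : Dat E)

lemma fd_at_zero (η : E → ℝ) : d.fd η 0 = d.U := by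
  ext x; simp [fd]

lemma conv_le' {p : ℝ} (hp : 1 < p) (a b : E) {t : ℝ} (h0 : 0 ≤ t) (h1 : t ≤ 1) :
    ‖(1 - t) • a + t • b‖ ^ p ≤ (1 - t) * ‖a‖ ^ p + t * ‖b‖ ^ p := by
  rcases h0.eq_or_lt with rfl | h0
  · simp
  rcases h1.eq_or_lt with rfl | h1
  · simp
  have := conv_le hp b a h0 h1
  rw [add_comm, add_comm ((1 - t) * _)]; exact this

section
variable {η : E → ℝ} {Kη : ℝ≥0} (hη : LipschitzWith Kη η) (h01 : ∀ x, 0 ≤ η x ∧ η x ≤ 1)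
  {ε : ℝ} (hε0 : 0 < ε) (hε : 2 * ε < d.R₁ - d.s - d.R₀)
  (η1 : ∀ x, ‖x - d.c‖ ≤ d.R₀ + ε → η x = 1) (η0 : ∀ x, d.R₀ + 2 * ε ≤ ‖x - d.c‖ → η x = 0)
include η1 η0 hε0 hε

lemma gradη_supp {x : E} (hx : gradient η x ≠ 0) :
    d.R₀ + ε ≤ ‖x - d.c‖ ∧ ‖x - d.c‖ ≤ d.R₀ + 2 * ε := by
  have hc : Continuous fun x : E => ‖x - d.c‖ := by fun_prop
  constructor
  · by_contra! h
    apply hx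
    have : η =ᶠ[𝓝 x] fun _ => 1 := by
      filter_upwards [(isOpen_lt hc continuous_const).mem_nhds h] with y hy using η1 y (le_of_lt hy)
    rw [this.gradient_eq]; exact gradient_fun_const x 1
  · by_contra! h
    apply hx
    apply gradient_eq_zero_of_eventually
    filter_upwards [(isOpen_lt continuous_const hc).mem_nhds h] with y hy using η0 y (le_of_lt hy)

lemma gradη_Ω {x : E} (hx : gradient η x ≠ 0) : x ∈ d.Ω := by
  have := d.gradη_supp hε0 hε η1 η0 hx
  exact d.A_sub ⟨by linarith, by linarith⟩

lemma η_ball {x : E} (hx : x ∉ closedBall (0 : E) d.R₁) : η x = 0 ∧ gradient η x = 0 := by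
  constructor
  · apply η0
    have := norm_le_norm_sub_add x d.c
    rw [d.norm_c] at this
    rw [mem_closedBall_zero_iff, not_le] at hx; linarith
  · by_contra h
    exact hx (d.Ω_bdd (d.gradη_Ω hε0 hε η1 η0 h))

include hη h01
lemma T2_deriv : HasDerivAt (fun τ : ℝ => ∫ x, (d.U (x - τ • d.e) - d.U x) *
      ⟪aF d.p (gradient (d.fd η τ) x), gradient η x⟫)
    (∫ x, -⟪gradient d.U x, d.e⟫ * ⟪aF d.p (gradient d.U x), gradient η x⟫) 0 := by
  have hp := d.hp
  obtain ⟨K, hK⟩ := d.lip_fd hη h01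
  rw [hasDerivAt_iff_tendsto_slope_zero]
  simp only [zero_add, zero_smul, sub_zero, sub_self, zero_mul, integral_zero, smul_eq_mul,
    ← integral_const_mul]
  have hne : ∀ᶠ τ : ℝ in 𝓝[≠] 0, τ ≠ 0 := eventually_mem_nhdsWithin
  refine tendsto_integral_filter_of_dominated_convergence
    (fun x => d.L * (K ^ (d.p - 1) * ‖gradient η x‖)) ?_ ?_ ?_ ?_
  · refine Eventually.of_forall fun τ => Measurable.aestronglyMeasurable ?_
    have m1 : Measurable fun x => d.U (x - τ • d.e) - d.U x := (d.lip_dd τ).continuous.measurable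
    exact (m1.mul (((continuous_aF hp).measurable.comp (measurable_gradient _)).inner
      (measurable_gradient η))).const_mul _
  · filter_upwards [hne] with τ hτ
    refine Eventually.of_forall fun x => ?_
    rw [← mul_assoc, norm_mul]
    refine mul_le_mul ?_ ?_ (norm_nonneg _) d.L.2
    · rw [norm_mul, norm_inv, inv_mul_le_iff₀ (norm_pos_iff.2 hτ), mul_comm]
      exact d.abs_dd τ x
    · refine (norm_inner_le_norm _ _).trans ?_
      gcongr
      rw [norm_aF hp]
      exact Real.rpow_le_rpow (norm_nonneg _) (norm_gradient_le (hK τ) x) (by linarith)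
  · refine Integrable.const_mul (Integrable.const_mul ?_ _) _
    refine integrable_of_bdd (B := closedBall (0 : E) d.R₁) isBounded_closedBall
      isClosed_closedBall.measurableSet (measurable_gradient η).norm (M := Kη) ?_ ?_
    · intro x; rw [abs_norm]; exact norm_gradient_le hη x
    · intro x hx; rw [(d.η_ball hε0 hε η1 η0 hx).2, norm_zero]
  · refine Eventually.of_forall fun x => ?_
    by_cases hg : gradient η x = 0
    · simp [hg]
    have hxΩ := d.gradη_Ω hε0 hε η1 η0 hg
    have hdη : HasGradientAt η (gradient η x) x := by
      by_cases h : DifferentiableAt ℝ η x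
      · exact h.hasGradientAt
      · exact absurd (gradient_eq_zero_of_not_differentiableAt h) hg
    have hsh : Tendsto (fun τ : ℝ => x - τ • d.e) (𝓝 0) (𝓝 x) := by
      have : Continuous fun τ : ℝ => x - τ • d.e := by fun_prop
      simpa using this.tendsto 0
    have hev : ∀ᶠ τ : ℝ in 𝓝 0, x - τ • d.e ∈ d.Ω := hsh.eventually (d.isOpen_Ω.mem_nhds hxΩ)
    have l1 : Tendsto (fun τ : ℝ => gradient (d.fd η τ) x) (𝓝 0) (𝓝 (d.G x)) := by
      have hGc : Tendsto (fun τ : ℝ => d.G (x - τ • d.e)) (𝓝 0) (𝓝 (d.G x)) :=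
        (d.contG.continuousAt (d.isOpen_Ω.mem_nhds hxΩ)).tendsto.comp hsh
      have hUc : Tendsto (fun τ : ℝ => d.U (x - τ • d.e) - d.U x) (𝓝 0) (𝓝 (d.U x - d.U x)) :=
        ((d.contU.tendsto x).comp hsh).sub_const _
      have : Tendsto (fun τ : ℝ => (1 - η x) • d.G x + η x • d.G (x - τ • d.e) +
          (d.U (x - τ • d.e) - d.U x) • gradient η x) (𝓝 0)
          (𝓝 ((1 - η x) • d.G x + η x • d.G x + (d.U x - d.U x) • gradient η x)) :=
        ((hGc.const_smul _).const_add _).add (hUc.smul_const _)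
      rw [sub_self, zero_smul, add_zero, ← add_smul, sub_add_cancel, one_smul] at this
      refine this.congr' ?_
      filter_upwards [hev] with τ hτ
      exact (d.fd_grad hdη (d.U_grad hxΩ) (d.U_grad hτ)).gradient.symm
    have l2 : Tendsto (fun τ : ℝ => τ⁻¹ * (d.U (x - τ • d.e) - d.U x)) (𝓝[≠] 0)
        (𝓝 (-⟪gradient d.U x, d.e⟫)) := by
      rw [d.U_gradient hxΩ]
      have := hg_dir (d.U_grad hxΩ) (-d.e)
      rw [hasDerivAt_iff_tendsto_slope_zero] at this
      simpa [sub_eq_add_neg] using this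
    have l3 := ((continuous_aF hp).tendsto _).comp (l1.mono_left (nhdsWithin_le_nhds (s := {(0:ℝ)}ᶜ)))
    have := l2.mul (l3.inner (tendsto_const_nhds (x := gradient η x)))
    rw [← d.U_gradient hxΩ] at this
    refine this.congr fun τ => ?_
    simp only [Function.comp_apply]; ring

theorem idC : (∫ x, ⟪gradient η x, d.e⟫ * ‖gradient d.U x‖ ^ d.p) +
    d.p * (∫ x, -⟪gradient d.U x, d.e⟫ * ⟪aF d.p (gradient d.U x), gradient η x⟫) -
    d.lam d.s * (d.p * ∫ x, ⟪gradient d.U x, -d.e⟫ * (d.U x ^ (d.p - 1) * η x)) = 0 := by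
  have hp := d.hp
  have hp0 : 0 < d.p := by linarith
  obtain ⟨K, hK⟩ := d.lip_fd hη h01
  obtain ⟨M, hM⟩ := d.U_bdd
  have hUR : ∀ x ∉ closedBall (0 : E) d.R₁, d.U x = 0 := fun x hx => d.U_zero fun H => hx (d.Ω_bdd H)
  have hηb : ∀ x, |η x| ≤ 1 := fun x => by rw [abs_of_nonneg (h01 x).1]; exact (h01 x).2
  have hEb : ∀ x, ‖gradient d.U x‖ ^ d.p ≤ (d.L : ℝ) ^ d.p := fun x =>
    Real.rpow_le_rpow (norm_nonneg _) (norm_gradient_le d.lipU' x) hp0.le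
  have hPb : ∀ x, d.U x ^ (d.p - 1) ≤ (M : ℝ) ^ (d.p - 1) := fun x =>
    Real.rpow_le_rpow (d.U_nonneg x) ((le_abs_self _).trans (hM x)) (by linarith)
  have mE : Measurable fun x => ‖gradient d.U x‖ ^ d.p := (measurable_gradient d.U).norm.pow_const _
  have mP : Measurable fun x => d.U x ^ (d.p - 1) * η x :=
    (d.contU.measurable.pow_const _).mul hη.continuous.measurable
  have hE0 : ∀ x ∉ closedBall (0 : E) d.R₁, ‖gradient d.U x‖ ^ d.p = 0 := fun x hx => by
    rw [gradient_eq_zero_of_eventually, norm_zero, Real.zero_rpow hp0.ne']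
    filter_upwards [isClosed_closedBall.isOpen_compl.mem_nhds hx] with y hy using hUR y hy
  have bb : Bornology.IsBounded (closedBall (0 : E) d.R₁) := isBounded_closedBall
  have bm : MeasurableSet (closedBall (0 : E) d.R₁) := isClosed_closedBall.measurableSet
  have iE : Integrable fun x => ‖gradient d.U x‖ ^ d.p := integrable_energy hp d.lipU' hUR
  have iM : Integrable fun x => d.U x ^ d.p := integrable_mass hp0 d.contU hUR
  -- T1
  have hT1 := (deriv_shift hη hηb mE (B := (d.L : ℝ) ^ d.p) (fun x => by
    rw [abs_of_nonneg (by positivity)]; exact hEb x) hE0 d.e).2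
  have hT2 := d.T2_deriv hη h01 hε0 hε η1 η0
  have hPη : ∀ x, |d.U x ^ (d.p - 1) * η x| ≤ (M : ℝ) ^ (d.p - 1) := fun x => by
    have := d.U_nonneg x
    rw [abs_mul, abs_of_nonneg (by positivity), ← mul_one ((M : ℝ) ^ _)]
    exact mul_le_mul (hPb x) (hηb x) (abs_nonneg _) (by positivity)
  have hPη0 : ∀ x ∉ closedBall (0 : E) d.R₁, d.U x ^ (d.p - 1) * η x = 0 := fun x hx => by
    rw [(d.η_ball hε0 hε η1 η0 hx).1, mul_zero]
  have hT3 := (deriv_shift d.lipU' hM mP hPη hPη0 (-d.e)).2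
  set T1 : ℝ → ℝ := fun τ => ∫ x, η (x + τ • d.e) * ‖gradient d.U x‖ ^ d.p with hT1d
  set T2 : ℝ → ℝ := fun τ : ℝ => ∫ x, (d.U (x - τ • d.e) - d.U x) *
      ⟪aF d.p (gradient (d.fd η τ) x), gradient η x⟫ with hT2d
  set T3 : ℝ → ℝ := fun τ => ∫ x, d.U (x + τ • (-d.e)) * (d.U x ^ (d.p - 1) * η x) with hT3d
  set N0 := ∫ x, ‖gradient d.U x‖ ^ d.p with hN0
  set D0 := ∫ x, d.U x ^ d.p with hD0
  have hlam : HasDerivAt (fun τ : ℝ => d.lam (d.s + τ)) 0 0 := by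
    have h := d.hder
    rw [← add_zero d.s] at h
    exact h.comp_const_add d.s 0
  let Kt : ℝ → ℝ := fun τ => N0 + (T1 τ - T1 0) + d.p * T2 τ -
    d.lam (d.s + τ) * (D0 + d.p * (T3 τ - T3 0))
  have hKd : HasDerivAt Kt ((∫ x, ⟪gradient η x, d.e⟫ * ‖gradient d.U x‖ ^ d.p) +
    d.p * (∫ x, -⟪gradient d.U x, d.e⟫ * ⟪aF d.p (gradient d.U x), gradient η x⟫) -
    (0 * (D0 + d.p * (T3 0 - T3 0)) + d.lam (d.s + 0) *
      (d.p * ∫ x, ⟪gradient d.U x, -d.e⟫ * (d.U x ^ (d.p - 1) * η x)))) 0 :=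
    (((hT1.sub_const _).const_add _).add (hT2.const_mul _)).sub
      (hlam.mul (((hT3.sub_const _).const_mul _).const_add _))
  have hT20 : T2 0 = 0 := by simp [hT2d]
  have hK0 : Kt 0 = 0 := by
    simp only [Kt, hT20, sub_self, mul_zero, add_zero]
    rw [d.energyU] at hN0; rw [hN0, sub_self]
  have hKnn : ∀ᶠ τ in 𝓝 (0 : ℝ), 0 ≤ Kt τ := by
    have : ∀ᶠ τ in 𝓝 (0 : ℝ), |τ| ≤ ε := by
      filter_upwards [Metric.closedBall_mem_nhds (0 : ℝ) hε0] with τ hτ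
      simpa using hτ
    filter_upwards [this] with τ hτ
    have hr := d.ray (d.s + τ) (d.fd η τ) K (hK τ) fun x hx => d.fd_zero hε hτ η1 η0 hx
    -- mass
    have fR : ∀ x ∉ closedBall (0 : E) d.R₁, d.fd η τ x = 0 := fun x hx => by
      rw [fd, hUR x hx, (d.η_ball hε0 hε η1 η0 hx).1]; ring
    have iFM : Integrable fun x => |d.fd η τ x| ^ d.p :=
      integrable_mass hp0 (hK τ).continuous.abs fun x hx => by rw [fR x hx, abs_zero]
    have iFE : Integrable fun x => ‖gradient (d.fd η τ) x‖ ^ d.p := integrable_energy hp (hK τ) fR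
    have iT3 : ∀ τ : ℝ, Integrable fun x => d.U (x + τ • (-d.e)) * (d.U x ^ (d.p - 1) * η x) := fun τ => by
      refine integrable_of_bdd bb bm ?_ (M := M * (M : ℝ) ^ (d.p - 1)) ?_ ?_
      · exact (d.contU.comp (continuous_add_const _)).measurable.mul mP
      · intro x; rw [abs_mul]; exact mul_le_mul (hM _) (hPη x) (abs_nonneg _) M.2
      · intro x hx; rw [hPη0 x hx, mul_zero]
    have iT1 : ∀ τ : ℝ, Integrable fun x => η (x + τ • d.e) * ‖gradient d.U x‖ ^ d.p := fun τ => by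
      refine integrable_of_bdd bb bm ?_ (M := 1 * (d.L : ℝ) ^ d.p) ?_ ?_
      · exact (hη.continuous.comp (continuous_add_const _)).measurable.mul mE
      · intro x; rw [abs_mul]
        refine mul_le_mul (hηb _) ?_ (abs_nonneg _) zero_le_one
        rw [abs_of_nonneg (by positivity)]; exact hEb x
      · intro x hx; rw [hE0 x hx, mul_zero]
    have hmass : D0 + d.p * (T3 τ - T3 0) ≤ ∫ x, |d.fd η τ x| ^ d.p := by
      rw [hD0, hT3d]
      simp only
      have iD : Integrable fun x => d.p * (d.U (x + τ • (-d.e)) * (d.U x ^ (d.p - 1) * η x) -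
          d.U (x + (0 : ℝ) • (-d.e)) * (d.U x ^ (d.p - 1) * η x)) :=
        ((iT3 τ).sub (iT3 0)).const_mul _
      rw [← integral_sub (iT3 τ) (iT3 0), ← integral_const_mul, ← integral_add iM iD]
      refine integral_mono (iM.add iD) iFM fun x => ?_
      have hc := aF_convex hp (d.fd η τ x) (d.U x)
      have e1 : aF d.p (d.U x) = d.U x ^ (d.p - 1) := by
        rcases (d.U_nonneg x).eq_or_lt with h | h
        · rw [← h, aF_zero, Real.zero_rpow (by linarith)]
        · rw [aF, smul_eq_mul, Real.norm_of_nonneg h.le]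
          nth_rewrite 2 [← Real.rpow_one (d.U x)]
          rw [← Real.rpow_add h]; ring_nf
      rw [e1, Real.norm_of_nonneg (d.U_nonneg x), Real.norm_eq_abs] at hc
      have e2 : ⟪d.U x ^ (d.p - 1), d.U x - d.fd η τ x⟫ =
          -(d.U (x + τ • (-d.e)) - d.U x) * (d.U x ^ (d.p - 1) * η x) := by
        rw [fd, smul_neg, ← sub_eq_add_neg]
        simp only [RCLike.inner_apply, conj_trivial]; ring
      rw [e2] at hc
      simp only [zero_smul, add_zero, ← sub_mul]
      nlinarith
    -- energy
    have iT2 : Integrable fun x => (d.U (x - τ • d.e) - d.U x) *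
      ⟪aF d.p (gradient (d.fd η τ) x), gradient η x⟫ := by
      refine integrable_of_bdd bb bm ?_ (M := (d.L * |τ|) * ((K : ℝ) ^ (d.p - 1) * Kη)) ?_ ?_
      · exact (d.lip_dd τ).continuous.measurable.mul
          (((continuous_aF hp).measurable.comp (measurable_gradient _)).inner (measurable_gradient η))
      · intro x
        rw [abs_mul]
        refine mul_le_mul (d.abs_dd τ x) ?_ (abs_nonneg _) (by positivity)
        refine (abs_real_inner_le_norm _ _).trans ?_
        rw [norm_aF hp]
        exact mul_le_mul (Real.rpow_le_rpow (norm_nonneg _) (norm_gradient_le (hK τ) x) (by linarith))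
          (norm_gradient_le hη x) (norm_nonneg _) (by positivity)
      · intro x hx; rw [(d.η_ball hε0 hε η1 η0 hx).2, inner_zero_right, mul_zero]
    have iS : Integrable fun x => η x * ‖gradient d.U (x - τ • d.e)‖ ^ d.p := by
      have := (iT1 τ).comp_sub_right (τ • d.e)
      simpa using this
    have eS : ∫ x, η x * ‖gradient d.U (x - τ • d.e)‖ ^ d.p = T1 τ := by
      rw [hT1d]
      simp only
      rw [← integral_sub_right_eq_self (fun x => η (x + τ • d.e) * ‖gradient d.U x‖ ^ d.p) (τ • d.e)]
      simp
    have iT10 : Integrable fun x => η x * ‖gradient d.U x‖ ^ d.p := by simpa using iT1 0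
    have henergy : ∫ x, ‖gradient (d.fd η τ) x‖ ^ d.p ≤ N0 + (T1 τ - T1 0) + d.p * T2 τ := by
      have e0 : T1 0 = ∫ x, η x * ‖gradient d.U x‖ ^ d.p := by rw [hT1d]; simp
      rw [← eS, e0, hN0, hT2d]
      simp only
      have iS' : Integrable fun x => η x * ‖gradient d.U (x - τ • d.e)‖ ^ d.p -
          η x * ‖gradient d.U x‖ ^ d.p := iS.sub iT10
      have iA : Integrable fun x => ‖gradient d.U x‖ ^ d.p + (η x * ‖gradient d.U (x - τ • d.e)‖ ^ d.p -
          η x * ‖gradient d.U x‖ ^ d.p) := iE.add iS'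
      rw [← integral_sub iS iT10, ← integral_add iE iS', ← integral_const_mul,
        ← integral_add iA (iT2.const_mul _)]
      refine integral_mono_ae iFE (iA.add (iT2.const_mul _)) ?_
      have hsh : ∀ᵐ x, DifferentiableAt ℝ (fun x => d.U (x - τ • d.e)) x := by
        have : LipschitzWith d.L fun x => d.U (x - τ • d.e) := by
          have := d.lipU'.comp (LipschitzWith.id.sub (LipschitzWith.const (τ • d.e)))
          rw [add_zero, mul_one] at this
          exact this
        exact this.ae_differentiableAt
      filter_upwards [hη.ae_differentiableAt (μ := volume), d.lipU'.ae_differentiableAt (μ := volume),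
        hsh] with x h1 h2 h3
      have h3' : HasGradientAt d.U (gradient d.U (x - τ • d.e)) (x - τ • d.e) := by
        have h4 : DifferentiableAt ℝ d.U (x - τ • d.e) := by
          have h5 : DifferentiableAt ℝ (fun x => d.U (x - τ • d.e)) (x - τ • d.e + τ • d.e) := by
            simpa using h3
          have := DifferentiableAt.comp (x - τ • d.e) h5
            (differentiableAt_id.add_const (τ • d.e))
          have e : (fun x => d.U (x - τ • d.e)) ∘ (fun y => id y + τ • d.e) = d.U := by
            ext y; simp
          rwa [e] at this
        exact h4.hasGradientAt
      have hgr := (d.fd_grad (τ := τ) h1.hasGradientAt h2.hasGradientAt h3').gradient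
      have hc := aF_convex hp ((1 - η x) • gradient d.U x + η x • gradient d.U (x - τ • d.e))
        (gradient (d.fd η τ) x)
      have e1 : gradient (d.fd η τ) x - ((1 - η x) • gradient d.U x + η x • gradient d.U (x - τ • d.e))
          = (d.U (x - τ • d.e) - d.U x) • gradient η x := by rw [hgr]; abel
      rw [e1, real_inner_smul_right] at hc
      have hc2 := conv_le' hp (gradient d.U x) (gradient d.U (x - τ • d.e)) (h01 x).1 (h01 x).2
      beta_reduce
      linarith
    have hl := d.lam0 (d.s + τ)
    have : d.lam (d.s + τ) * (D0 + d.p * (T3 τ - T3 0)) ≤ d.lam (d.s + τ) * ∫ x, |d.fd η τ x| ^ d.p := by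
      gcongr
    simp only [Kt]
    linarith
  have hmin : IsLocalMin Kt 0 := by
    filter_upwards [hKnn] with τ hτ
    rw [hK0]; exact hτ
  have := hmin.hasDerivAt_eq_zero hKd
  rw [add_zero, zero_mul, zero_add] at this
  exact this

end
end Dat
end P7
end PL

open MeasureTheory Metric Set Filter
open scoped RealInnerProductSpace ENNReal Topology NNReal

namespace PL
section P8
set_option linter.unusedSectionVars false
set_option linter.unusedVariables false

section general
variable {E : Type*} [NormedAddCommGroup E] [InnerProductSpace ℝ E] [FiniteDimensional ℝ E]
  [MeasurableSpace E] [BorelSpace E]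

lemma swap_exists {x y c : E} (h : ‖x - c‖ = ‖y - c‖) (hxy : x ≠ y) :
    ∃ k : E, ‖k‖ = 1 ∧ sg c k x = y ∧ 0 ≤ ⟪x - c, k⟫ ∧ ∀ e : E, 0 ≤ ⟪x - y, e⟫ → 0 ≤ ⟪k, e⟫ := by
  have hn : 0 < ‖x - y‖ := norm_pos_iff.2 (sub_ne_zero.2 hxy)
  have hk : ‖(‖x - y‖⁻¹ • (x - y))‖ = 1 := by
    rw [norm_smul, norm_inv, norm_norm, inv_mul_cancel₀ hn.ne']
  have key : 2 * ⟪x - c, x - y⟫ = ‖x - y‖ ^ 2 := by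
    have e1 : x - y = (x - c) - (y - c) := by abel
    rw [e1, @norm_sub_sq_real, inner_sub_right, real_inner_self_eq_norm_sq, ← h]; ring
  refine ⟨_, hk, ?_, ?_, ?_⟩
  · rw [sg_apply hk, real_inner_smul_right, smul_smul]
    have : 2 * (‖x - y‖⁻¹ * ⟪x - c, x - y⟫) * ‖x - y‖⁻¹ = 1 := by
      field_simp; linarith
    rw [this, one_smul]; abel
  · rw [real_inner_smul_right]
    have : 0 ≤ ⟪x - c, x - y⟫ := by nlinarith [sq_nonneg ‖x - y‖]
    positivity
  · intro e he
    rw [real_inner_smul_left]; positivity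
end general

namespace Dat
variable {E : Type*} [NormedAddCommGroup E] [InnerProductSpace ℝ E] [FiniteDimensional ℝ E]
  [MeasurableSpace E] [BorelSpace E] (d : Dat E)

lemma U_mono {x y : E} (hx : x ∈ d.A) (h : ‖x - d.c‖ = ‖y - d.c‖)
    (hxy : ⟪y - d.c, d.e⟫ ≤ ⟪x - d.c, d.e⟫) : d.U x ≤ d.U y := by
  rcases eq_or_ne x y with rfl | hne
  · exact le_rfl
  obtain ⟨k, h1, h2, h3, h4⟩ := swap_exists h hne
  have := d.refl_le h1 (h4 d.e (by
    have : x - y = (x - d.c) - (y - d.c) := by abel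
    rw [this, inner_sub_left]; linarith)) hx h3
  rwa [h2] at this

/-- unit normal field -/
noncomputable def nn (x : E) : E := ‖x - d.c‖⁻¹ • (x - d.c)

lemma nn_norm {x : E} (hx : 0 < ‖x - d.c‖) : ‖d.nn x‖ = 1 := by
  rw [nn, norm_smul, norm_inv, norm_norm, inv_mul_cancel₀ hx.ne']

lemma nn_smul {x : E} (hx : 0 < ‖x - d.c‖) : ‖x - d.c‖ • d.nn x = x - d.c := by
  rw [nn, smul_smul, mul_inv_cancel₀ hx.ne', one_smul]

lemma R₀_lt : d.R₀ < d.R₁ - d.s := by linarith [d.hs']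

lemma G_at {x : E} (h1 : d.R₀ ≤ ‖x - d.c‖) (h2 : ‖x - d.c‖ < d.R₁ - d.s) :
    HasGradientAt d.u (d.G x) x := d.hG x (d.norm_lt h2) h1

lemma contG' : ContinuousOn d.G {x | d.R₀ ≤ ‖x - d.c‖ ∧ ‖x - d.c‖ < d.R₁ - d.s} :=
  d.hGc.mono fun x hx => ⟨d.norm_lt hx.2, hx.1⟩

lemma U_eq' {x : E} (h1 : d.R₀ ≤ ‖x - d.c‖) (h2 : ‖x - d.c‖ < d.R₁ - d.s) : d.U x = d.u x := by
  rcases h1.eq_or_lt with h | h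
  · rw [d.u0 x h.symm]; exact d.U_zero fun H => (d.mem_Ω.1 H).2.ne h
  · exact d.U_eq (d.A_sub ⟨h, h2⟩)

lemma hgd {f : E → ℝ} {g x : E} (h : HasGradientAt f g x) {γ : ℝ → E} {v : E} {t : ℝ} (hx : γ t = x)
    (hγ : HasDerivAt γ v t) : HasDerivAt (fun t => f (γ t)) ⟪g, v⟫ t := by
  subst hx
  rw [hasGradientAt_iff_hasFDerivAt] at h
  exact h.comp_hasDerivAt t hγ

lemma ray_deriv {x : E} (hx : ‖x - d.c‖ = d.R₀) :
    HasDerivAt (fun t : ℝ => d.u (x + t • d.nn x)) ⟪d.G x, d.nn x⟫ 0 := by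
  refine hgd (d.G_at hx.ge (by linarith [d.R₀_lt])) (by simp) ?_
  simpa using ((hasDerivAt_id (0 : ℝ)).smul_const (d.nn x)).const_add x

lemma ray_tendsto {x : E} (hx : ‖x - d.c‖ = d.R₀) :
    Tendsto (fun t : ℝ => t⁻¹ * d.U (x + t • d.nn x)) (𝓝[>] 0) (𝓝 ⟪d.G x, d.nn x⟫) := by
  have h := (d.ray_deriv hx)
  rw [hasDerivAt_iff_tendsto_slope_zero] at h
  have h := h.mono_left (nhdsWithin_mono (0 : ℝ) (fun t (ht : t ∈ Ioi 0) => ne_of_gt ht))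
  refine h.congr' ?_
  filter_upwards [Ioo_mem_nhdsGT (show (0 : ℝ) < d.R₁ - d.s - d.R₀ by linarith [d.R₀_lt])] with t ht
  have h0 : 0 < ‖x - d.c‖ := by rw [hx]; exact d.hR₀
  have e : ‖x + t • d.nn x - d.c‖ = d.R₀ + t := by
    have : x + t • d.nn x - d.c = (‖x - d.c‖ + t) • d.nn x := by
      rw [add_smul, d.nn_smul h0]; abel
    rw [this, norm_smul, d.nn_norm h0, hx, mul_one, Real.norm_of_nonneg (by linarith [ht.1, d.hR₀])]
  rw [d.U_eq' (by rw [e]; linarith [ht.1]) (by rw [e]; linarith [ht.2]), zero_add, zero_smul, add_zero,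
    d.u0 x hx, sub_zero, smul_eq_mul]

lemma ray_norm {x : E} (hx : ‖x - d.c‖ = d.R₀) {t : ℝ} (ht : 0 ≤ t) :
    ‖x + t • d.nn x - d.c‖ = d.R₀ + t := by
  have h0 : 0 < ‖x - d.c‖ := by rw [hx]; exact d.hR₀
  have : x + t • d.nn x - d.c = (‖x - d.c‖ + t) • d.nn x := by
    rw [add_smul, d.nn_smul h0]; abel
  rw [this, norm_smul, d.nn_norm h0, hx, mul_one, Real.norm_of_nonneg (by linarith [d.hR₀])]

lemma G_nn_nonneg {x : E} (hx : ‖x - d.c‖ = d.R₀) : 0 ≤ ⟪d.G x, d.nn x⟫ := by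
  refine ge_of_tendsto (d.ray_tendsto hx) ?_
  filter_upwards [self_mem_nhdsWithin] with t (ht : 0 < t)
  have := d.U_nonneg (x + t • d.nn x)
  positivity

lemma G_tan {x v : E} (hx : ‖x - d.c‖ = d.R₀) (hv : ‖v‖ = 1) (hvn : ⟪d.nn x, v⟫ = 0) :
    ⟪d.G x, v⟫ = 0 := by
  have h0 : 0 < ‖x - d.c‖ := by rw [hx]; exact d.hR₀
  have hd : HasDerivAt (fun t : ℝ => d.c + d.R₀ • (Real.cos t • d.nn x + Real.sin t • v))
      (d.R₀ • v) 0 := by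
    have := ((((Real.hasDerivAt_cos 0).smul_const (d.nn x)).add
      ((Real.hasDerivAt_sin 0).smul_const v)).const_smul d.R₀).const_add d.c
    simpa using this
  have h1 := hgd (d.G_at hx.ge (by linarith [d.R₀_lt])) (t := 0) (by
    rw [Real.cos_zero, Real.sin_zero, one_smul, zero_smul, add_zero, ← hx, d.nn_smul h0]; abel) hd
  have h2 : (fun t : ℝ => d.u (d.c + d.R₀ • (Real.cos t • d.nn x + Real.sin t • v))) = fun _ => 0 := by
    ext t
    apply d.u0
    change ‖d.c + d.R₀ • (Real.cos t • d.nn x + Real.sin t • v) - d.c‖ = _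
    rw [add_sub_cancel_left, norm_smul, Real.norm_of_nonneg d.hR₀.le]
    have : ‖Real.cos t • d.nn x + Real.sin t • v‖ ^ 2 = 1 := by
      rw [@norm_add_sq_real, norm_smul, norm_smul, d.nn_norm h0, hv, real_inner_smul_left,
        real_inner_smul_right, hvn]
      simp
    have h : ‖Real.cos t • d.nn x + Real.sin t • v‖ = 1 := by
      rw [← sq_eq_sq₀ (norm_nonneg _) zero_le_one, this, one_pow]
    rw [h, mul_one]
  rw [h2] at h1
  have := h1.unique (hasDerivAt_const (0 : ℝ) (0 : ℝ))
  rw [real_inner_smul_right] at this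
  exact (mul_eq_zero.1 this).resolve_left d.hR₀.ne'

lemma G_normal' {x : E} (hx : ‖x - d.c‖ = d.R₀) : d.G x = ⟪d.G x, d.nn x⟫ • d.nn x := by
  have h0 : 0 < ‖x - d.c‖ := by rw [hx]; exact d.hR₀
  by_contra hne
  set w := d.G x - ⟪d.G x, d.nn x⟫ • d.nn x with hw
  have hw0 : w ≠ 0 := sub_ne_zero.2 hne
  have hwn : ⟪d.nn x, w⟫ = 0 := by
    rw [hw, inner_sub_right, real_inner_smul_right, real_inner_self_eq_norm_sq, d.nn_norm h0,
      real_inner_comm]; ring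
  have hpos : 0 < ‖w‖ := norm_pos_iff.2 hw0
  have := d.G_tan (v := ‖w‖⁻¹ • w) hx (by
    rw [norm_smul, norm_inv, norm_norm, inv_mul_cancel₀ hpos.ne']) (by
    rw [real_inner_smul_right, hwn, mul_zero])
  rw [real_inner_smul_right] at this
  have h1 : ⟪d.G x, w⟫ = 0 := (mul_eq_zero.1 this).resolve_left (inv_ne_zero hpos.ne')
  have h2 : ⟪w, w⟫ = 0 := by
    nth_rewrite 1 [hw]
    rw [inner_sub_left, h1, real_inner_smul_left, hwn]; ring
  exact hw0 (inner_self_eq_zero.1 h2)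

lemma G_norm {x : E} (hx : ‖x - d.c‖ = d.R₀) : ‖d.G x‖ = ⟪d.G x, d.nn x⟫ := by
  have h0 : 0 < ‖x - d.c‖ := by rw [hx]; exact d.hR₀
  have h := congrArg norm (d.G_normal' hx)
  rw [norm_smul, d.nn_norm h0, mul_one, Real.norm_of_nonneg (d.G_nn_nonneg hx)] at h
  exact h

lemma G_normal {x : E} (hx : ‖x - d.c‖ = d.R₀) : d.G x = ‖d.G x‖ • d.nn x := by
  rw [d.G_norm hx]; exact d.G_normal' hx

lemma G_mono {x y : E} (hx : ‖x - d.c‖ = d.R₀) (hy : ‖y - d.c‖ = d.R₀)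
    (hxy : ⟪y - d.c, d.e⟫ ≤ ⟪x - d.c, d.e⟫) : ‖d.G x‖ ≤ ‖d.G y‖ := by
  have h0x : 0 < ‖x - d.c‖ := by rw [hx]; exact d.hR₀
  have h0y : 0 < ‖y - d.c‖ := by rw [hy]; exact d.hR₀
  rw [d.G_norm hx, d.G_norm hy]
  refine le_of_tendsto_of_tendsto (d.ray_tendsto hx) (d.ray_tendsto hy) ?_
  filter_upwards [Ioo_mem_nhdsGT (show (0 : ℝ) < d.R₁ - d.s - d.R₀ by linarith [d.R₀_lt])] with t ht
  have hn := d.ray_norm hx ht.1.le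
  refine mul_le_mul_of_nonneg_left (d.U_mono ⟨?_, ?_⟩ ?_ ?_) (inv_nonneg.2 ht.1.le)
  · rw [hn]; linarith [ht.1]
  · rw [hn]; linarith [ht.2]
  · rw [hn, d.ray_norm hy ht.1.le]
  · have e : ∀ z : E, z + t • d.nn z - d.c = (1 + t * ‖z - d.c‖⁻¹) • (z - d.c) := fun z => by
      rw [nn, add_smul, one_smul, smul_smul]; abel
    rw [e, e, hx, hy, real_inner_smul_left, real_inner_smul_left]
    have := ht.1; have := d.hR₀
    gcongr

end Dat
end P8
end PL

open MeasureTheory Metric Set Filter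
open scoped RealInnerProductSpace ENNReal Topology NNReal Pointwise

namespace PL
section P9
set_option linter.unusedSectionVars false
set_option linter.unusedVariables false

section general
variable {E : Type*} [NormedAddCommGroup E] [InnerProductSpace ℝ E] [FiniteDimensional ℝ E]
  [MeasurableSpace E] [BorelSpace E]

lemma hg_norm_sub {c x : E} (hx : 0 < ‖x - c‖) :
    HasGradientAt (fun y : E => ‖y - c‖) (‖x - c‖⁻¹ • (x - c)) x := by
  have h1 : HasGradientAt (fun y : E => ‖y - c‖ ^ 2) ((2 : ℝ) • (x - c)) x := by
    rw [hasGradientAt_iff_hasFDerivAt]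
    have := (hasStrictFDerivAt_norm_sq (x - c)).hasFDerivAt.comp x ((hasFDerivAt_id x).sub_const c)
    refine this.congr_fderiv ?_
    ext v; simp
  have h2 := hg_comp (f := fun y : E => ‖y - c‖ ^ 2) (φ := Real.sqrt)
    (Real.hasDerivAt_sqrt (x := ‖x - c‖ ^ 2) (by positivity)) h1
  have e1 : (fun y : E => Real.sqrt (‖y - c‖ ^ 2)) = fun y => ‖y - c‖ := by
    ext y; exact Real.sqrt_sq (norm_nonneg _)
  rw [e1, Real.sqrt_sq (norm_nonneg _), smul_smul] at h2
  convert h2 using 2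
  field_simp

lemma cone_vol {C : Set E} (hC : MeasurableSet C) (hinv : ∀ t : ℝ, 0 < t → ∀ x, t • x ∈ C ↔ x ∈ C)
    (c : E) {ρ : ℝ} (hρ : 0 < ρ) :
    (volume : Measure E).real (ball c ρ ∩ {x | x - c ∈ C}) =
      ρ ^ Module.finrank ℝ E * (volume : Measure E).real (ball 0 1 ∩ C) := by
  have e1 : (ball c ρ ∩ {x | x - c ∈ C}) = (fun x => x - c) ⁻¹' (ball 0 ρ ∩ C) := by
    ext x; simp [dist_eq_norm]
  have e2 : ball (0 : E) ρ ∩ C = ρ • (ball (0 : E) 1 ∩ C) := by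
    rw [Set.smul_set_inter₀ hρ.ne', smul_unitBall_of_pos hρ]
    congr 1
    ext x
    rw [Set.mem_smul_set_iff_inv_smul_mem₀ hρ.ne', hinv _ (inv_pos.2 hρ)]
  rw [measureReal_def, measureReal_def, e1,
    (measurePreserving_sub_right volume c).measure_preimage
      (measurableSet_ball.inter hC).nullMeasurableSet, e2, Measure.addHaar_smul, ENNReal.toReal_mul,
    ENNReal.toReal_ofReal (abs_nonneg _), abs_of_nonneg (by positivity)]

lemma cone_shell {C : Set E} (hC : MeasurableSet C) (hinv : ∀ t : ℝ, 0 < t → ∀ x, t • x ∈ C ↔ x ∈ C)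
    (c : E) {a b : ℝ} (ha : 0 < a) (hab : a ≤ b) :
    (volume : Measure E).real ((ball c b \ ball c a) ∩ {x | x - c ∈ C}) =
      (b ^ Module.finrank ℝ E - a ^ Module.finrank ℝ E) * (volume : Measure E).real (ball 0 1 ∩ C) := by
  have hm : MeasurableSet {x | x - c ∈ C} := hC.preimage (measurable_id.sub_const c)
  rw [sub_mul, ← cone_vol hC hinv c (ha.trans_le hab), ← cone_vol hC hinv c ha]
  have : (ball c b \ ball c a) ∩ {x | x - c ∈ C} =
      (ball c b ∩ {x | x - c ∈ C}) \ (ball c a ∩ {x | x - c ∈ C}) := by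
    ext x; simp only [mem_inter_iff, Set.mem_sdiff]; tauto
  rw [this, measureReal_sdiff (inter_subset_inter_left _ (ball_subset_ball hab))
    (measurableSet_ball.inter hm) (measure_inter_lt_top_of_left_ne_top measure_ball_lt_top.ne).ne]

end general

namespace Dat
variable {E : Type*} [NormedAddCommGroup E] [InnerProductSpace ℝ E] [FiniteDimensional ℝ E]
  [MeasurableSpace E] [BorelSpace E] (d : Dat E)

/-- boundary layer cutoff -/
noncomputable def et (ε : ℝ) (x : E) : ℝ := max 0 (min 1 (2 - (‖x - d.c‖ - d.R₀) / ε))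

/-- Hadamard type density -/
noncomputable def HH (x : E) : ℝ :=
  ‖d.G x‖ ^ d.p * ⟪d.nn x, d.e⟫ - d.p * (⟪aF d.p (d.G x), d.nn x⟫ * ⟪d.G x, d.e⟫)

/-- shell -/
def Sh (a b : ℝ) : Set E := ball d.c b \ ball d.c a

lemma mem_Sh {a b : ℝ} {x : E} : x ∈ d.Sh a b ↔ ‖x - d.c‖ < b ∧ a ≤ ‖x - d.c‖ := by
  simp [Sh, dist_eq_norm]

lemma meas_Sh (a b : ℝ) : MeasurableSet (d.Sh a b) := measurableSet_ball.diff measurableSet_ball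

lemma et_lip {ε : ℝ} (hε : 0 < ε) : ∃ K : ℝ≥0, LipschitzWith K (d.et ε) := by
  have h1 : LipschitzWith 1 fun x : E => ‖x - d.c‖ := by
    have := lipschitzWith_one_norm.comp (LipschitzWith.id.sub (LipschitzWith.const d.c) : LipschitzWith (1 + 0) fun x : E => id x - d.c)
    simpa [Function.comp_def] using this
  have h2 : LipschitzWith (Real.toNNReal ε⁻¹) fun t : ℝ => 2 - (t - d.R₀) / ε := by
    refine LipschitzWith.of_dist_le_mul fun a b => ?_
    rw [Real.coe_toNNReal _ (inv_nonneg.2 hε.le), Real.dist_eq, Real.dist_eq]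
    have : 2 - (a - d.R₀) / ε - (2 - (b - d.R₀) / ε) = -(ε⁻¹ * (a - b)) := by field_simp; ring
    rw [this, abs_neg, abs_mul, abs_of_pos (inv_pos.2 hε)]
  exact ⟨_, ((h2.comp h1).const_min 1).const_max 0⟩

lemma et_01 (ε : ℝ) (x : E) : 0 ≤ d.et ε x ∧ d.et ε x ≤ 1 :=
  ⟨le_max_left _ _, max_le zero_le_one (min_le_left _ _)⟩

lemma et_1 {ε : ℝ} (hε : 0 < ε) (x : E) (hx : ‖x - d.c‖ ≤ d.R₀ + ε) : d.et ε x = 1 := by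
  have : 1 ≤ 2 - (‖x - d.c‖ - d.R₀) / ε := by
    have : (‖x - d.c‖ - d.R₀) / ε ≤ 1 := by rw [div_le_one hε]; linarith
    linarith
  rw [et, min_eq_left this, max_eq_right zero_le_one]

lemma et_0 {ε : ℝ} (hε : 0 < ε) (x : E) (hx : d.R₀ + 2 * ε ≤ ‖x - d.c‖) : d.et ε x = 0 := by
  have : 2 - (‖x - d.c‖ - d.R₀) / ε ≤ 0 := by
    have : 2 ≤ (‖x - d.c‖ - d.R₀) / ε := by rw [le_div_iff₀ hε]; linarith
    linarith
  rw [et, max_eq_left]; exact (min_le_right _ _).trans this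

lemma et_grad {ε : ℝ} (hε : 0 < ε) {x : E} (h1 : d.R₀ + ε < ‖x - d.c‖) (h2 : ‖x - d.c‖ < d.R₀ + 2 * ε) :
    gradient (d.et ε) x = (-ε⁻¹) • d.nn x := by
  have h0 : 0 < ‖x - d.c‖ := by linarith [d.hR₀]
  have hφ : HasDerivAt (fun t : ℝ => 2 - (t - d.R₀) / ε) (-ε⁻¹) ‖x - d.c‖ := by
    have := (((hasDerivAt_id ‖x - d.c‖).sub_const d.R₀).div_const ε).const_sub 2
    simpa using this
  have := hg_comp (f := fun y : E => ‖y - d.c‖) hφ (hg_norm_sub h0)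
  refine (this.congr_of_eventuallyEq ?_).gradient
  have hc : Continuous fun x : E => ‖x - d.c‖ := by fun_prop
  filter_upwards [(isOpen_lt continuous_const hc).mem_nhds h1,
    (isOpen_lt hc continuous_const).mem_nhds h2] with y (hy1 : _ < _) (hy2 : _ < _)
  have a1 : 2 - (‖y - d.c‖ - d.R₀) / ε ≤ 1 := by
    have : 1 ≤ (‖y - d.c‖ - d.R₀) / ε := by rw [le_div_iff₀ hε]; linarith
    linarith
  have a2 : 0 ≤ 2 - (‖y - d.c‖ - d.R₀) / ε := by
    have : (‖y - d.c‖ - d.R₀) / ε ≤ 2 := by rw [div_le_iff₀ hε]; linarith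
    linarith
  rw [et, min_eq_right a1, max_eq_right a2]

lemma U_near {x : E} {r : ℝ} (hr : 0 ≤ r) (hx : ‖x - d.c‖ ≤ d.R₀ + r) : d.U x ≤ d.L * r := by
  rcases le_or_gt ‖x - d.c‖ d.R₀ with h | h
  · rw [d.U_zero fun H => (d.mem_Ω.1 H).2.not_ge h]; positivity
  have h0 : 0 < ‖x - d.c‖ := d.hR₀.trans h
  set y := d.c + d.R₀ • d.nn x with hy
  have hyn : ‖y - d.c‖ = d.R₀ := by
    rw [hy, add_sub_cancel_left, norm_smul, d.nn_norm h0, mul_one, Real.norm_of_nonneg d.hR₀.le]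
  have hy0 : d.U y = 0 := d.U_zero fun H => (d.mem_Ω.1 H).2.ne hyn.symm
  have hxy : dist x y = ‖x - d.c‖ - d.R₀ := by
    have : x - y = (‖x - d.c‖ - d.R₀) • d.nn x := by
      rw [sub_smul, d.nn_smul h0, hy]; abel
    rw [dist_eq_norm, this, norm_smul, d.nn_norm h0, mul_one, Real.norm_of_nonneg (by linarith)]
  have := d.lipU'.dist_le_mul x y
  rw [hxy, hy0, Real.dist_eq, sub_zero] at this
  refine (le_abs_self _).trans (this.trans ?_)
  gcongr; linarith

lemma shell_est : ∃ C : ℝ, ∀ ε : ℝ, 0 < ε → 2 * ε < d.R₁ - d.s - d.R₀ →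
    |∫ x in d.Sh (d.R₀ + ε) (d.R₀ + 2 * ε), d.HH x| ≤ C * ε * ε ^ (d.p - 1) := by
  have hp := d.hp
  have hpp : 0 < d.p - 1 := by linarith
  refine ⟨d.lam d.s * (d.p * ((d.L : ℝ) * ((2 * d.L : ℝ) ^ (d.p - 1)) *
    (volume : Measure E).real (closedBall 0 d.R₁))), fun ε hε0 hε => ?_⟩
  obtain ⟨K, hK⟩ := d.et_lip hε0
  have id := d.idC hK (d.et_01 ε) hε0 hε (d.et_1 hε0) (d.et_0 hε0)
  have bb : Bornology.IsBounded (closedBall (0 : E) d.R₁) := isBounded_closedBall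
  have bm : MeasurableSet (closedBall (0 : E) d.R₁) := isClosed_closedBall.measurableSet
  have hg0 : ∀ x ∉ closedBall (0 : E) d.R₁, gradient (d.et ε) x = 0 := fun x hx =>
    (d.η_ball hε0 hε (d.et_1 hε0) (d.et_0 hε0) hx).2
  have i1 : Integrable fun x => ⟪gradient (d.et ε) x, d.e⟫ * ‖gradient d.U x‖ ^ d.p := by
    refine integrable_of_bdd bb bm ?_ (M := K * (d.L : ℝ) ^ d.p) ?_ ?_
    · exact ((measurable_gradient _).inner measurable_const).mul
        ((measurable_gradient d.U).norm.pow_const _)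
    · intro x
      rw [abs_mul]
      refine mul_le_mul ?_ ?_ (abs_nonneg _) K.2
      · refine (abs_real_inner_le_norm _ _).trans ?_
        rw [d.he, mul_one]; exact norm_gradient_le hK x
      · rw [abs_of_nonneg (by positivity)]
        exact Real.rpow_le_rpow (norm_nonneg _) (norm_gradient_le d.lipU' x) (by linarith)
    · intro x hx; rw [hg0 x hx, inner_zero_left, zero_mul]
  have i2 : Integrable fun x => -⟪gradient d.U x, d.e⟫ *
      ⟪aF d.p (gradient d.U x), gradient (d.et ε) x⟫ := by
    refine integrable_of_bdd bb bm ?_ (M := d.L * ((d.L : ℝ) ^ (d.p - 1) * K)) ?_ ?_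
    · exact ((measurable_gradient _).inner measurable_const).neg.mul
        (((continuous_aF hp).measurable.comp (measurable_gradient d.U)).inner (measurable_gradient _))
    · intro x
      rw [abs_mul, abs_neg]
      refine mul_le_mul ?_ ?_ (abs_nonneg _) d.L.2
      · refine (abs_real_inner_le_norm _ _).trans ?_
        rw [d.he, mul_one]; exact norm_gradient_le d.lipU' x
      · refine (abs_real_inner_le_norm _ _).trans ?_
        rw [norm_aF hp]
        exact mul_le_mul (Real.rpow_le_rpow (norm_nonneg _) (norm_gradient_le d.lipU' x) hpp.le)
          (norm_gradient_le hK x) (norm_nonneg _) (by positivity)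
    · intro x hx; rw [hg0 x hx, inner_zero_right, mul_zero]
  have e1 : (∫ x, ⟪gradient (d.et ε) x, d.e⟫ * ‖gradient d.U x‖ ^ d.p) +
    d.p * (∫ x, -⟪gradient d.U x, d.e⟫ * ⟪aF d.p (gradient d.U x), gradient (d.et ε) x⟫) =
      -ε⁻¹ * ∫ x in d.Sh (d.R₀ + ε) (d.R₀ + 2 * ε), d.HH x := by
    rw [← integral_const_mul, ← integral_add i1 (i2.const_mul _), ← integral_indicator (d.meas_Sh _ _),
      ← integral_const_mul]
    have ae1 : ∀ᵐ x : E, x ∉ sphere d.c (d.R₀ + ε) :=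
      measure_eq_zero_iff_ae_notMem.1
        (Measure.addHaar_sphere_of_ne_zero _ _ (by linarith [d.hR₀]))
    have ae2 : ∀ᵐ x : E, x ∉ sphere d.c (d.R₀ + 2 * ε) :=
      measure_eq_zero_iff_ae_notMem.1
        (Measure.addHaar_sphere_of_ne_zero _ _ (by linarith [d.hR₀]))
    refine integral_congr_ae ?_
    filter_upwards [ae1, ae2] with x h1 h2
    rw [mem_sphere, dist_eq_norm] at h1 h2
    by_cases hx : x ∈ d.Sh (d.R₀ + ε) (d.R₀ + 2 * ε)
    · have h := d.mem_Sh.1 hx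
      have h3 : d.R₀ + ε < ‖x - d.c‖ := lt_of_le_of_ne h.2 (Ne.symm h1)
      rw [indicator_of_mem hx, d.et_grad hε0 h3 h.1, d.U_gradient (d.A_sub ⟨by linarith, by linarith⟩),
        real_inner_smul_left, real_inner_smul_right, HH]
      ring
    · have : gradient (d.et ε) x = 0 := by
        by_contra hne
        have := d.gradη_supp hε0 hε (d.et_1 hε0) (d.et_0 hε0) hne
        exact hx (d.mem_Sh.2 ⟨lt_of_le_of_ne this.2 h2, this.1⟩)
      rw [indicator_of_notMem hx, this]; simp
  rw [e1] at id
  have e2 : |∫ x, ⟪gradient d.U x, -d.e⟫ * (d.U x ^ (d.p - 1) * d.et ε x)| ≤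
      (d.L : ℝ) * ((2 * d.L : ℝ) ^ (d.p - 1) * ε ^ (d.p - 1)) *
        (volume : Measure E).real (closedBall 0 d.R₁) := by
    rw [← setIntegral_eq_integral_of_forall_compl_eq_zero (s := closedBall (0 : E) d.R₁)
      (fun x hx => by rw [(d.η_ball hε0 hε (d.et_1 hε0) (d.et_0 hε0) hx).1]; ring)]
    rw [← Real.norm_eq_abs]
    refine norm_setIntegral_le_of_norm_le_const
      (isCompact_closedBall (0 : E) d.R₁).measure_lt_top fun x hx => ?_
    have hU := d.U_nonneg x
    rw [Real.norm_eq_abs, abs_mul]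
    refine mul_le_mul ?_ ?_ (abs_nonneg _) d.L.2
    · refine (abs_real_inner_le_norm _ _).trans ?_
      rw [norm_neg, d.he, mul_one]; exact norm_gradient_le d.lipU' x
    · rw [abs_of_nonneg (mul_nonneg (by positivity) (d.et_01 ε x).1)]
      rcases le_or_gt (d.R₀ + 2 * ε) ‖x - d.c‖ with h | h
      · rw [d.et_0 hε0 x h, mul_zero]; positivity
      · rw [← Real.mul_rpow (by positivity) hε0.le, ← mul_one ((2 * (d.L : ℝ) * ε) ^ _)]
        refine mul_le_mul (Real.rpow_le_rpow hU ?_ hpp.le) (d.et_01 ε x).2 (d.et_01 ε x).1 (by positivity)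
        have := d.U_near (r := 2 * ε) (by positivity) h.le
        linarith
  have e3 : ∫ x in d.Sh (d.R₀ + ε) (d.R₀ + 2 * ε), d.HH x = -(ε * (d.lam d.s * (d.p *
      ∫ x, ⟪gradient d.U x, -d.e⟫ * (d.U x ^ (d.p - 1) * d.et ε x)))) := by
    have : -ε⁻¹ * ∫ x in d.Sh (d.R₀ + ε) (d.R₀ + 2 * ε), d.HH x = d.lam d.s * (d.p *
      ∫ x, ⟪gradient d.U x, -d.e⟫ * (d.U x ^ (d.p - 1) * d.et ε x)) := by linarith
    rw [← this]; field_simp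
  have hl := d.lam0 d.s
  rw [e3, abs_neg, abs_mul, abs_mul, abs_mul, abs_of_pos hε0, abs_of_nonneg hl,
    abs_of_pos (by linarith : 0 < d.p)]
  calc _ ≤ ε * (d.lam d.s * (d.p * ((d.L : ℝ) * ((2 * d.L : ℝ) ^ (d.p - 1) * ε ^ (d.p - 1)) *
        (volume : Measure E).real (closedBall 0 d.R₁)))) := by
        have : 0 ≤ d.p := by linarith
        gcongr
    _ = _ := by ring

end Dat
end P9
end PL

open MeasureTheory Metric Set Filter
open scoped RealInnerProductSpace ENNReal Topology NNReal Pointwise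

namespace PL
section P10
set_option linter.unusedSectionVars false
set_option linter.unusedVariables false
namespace Dat
variable {E : Type*} [NormedAddCommGroup E] [InnerProductSpace ℝ E] [FiniteDimensional ℝ E]
  [MeasurableSpace E] [BorelSpace E] (d : Dat E)

/-- the half open concentric annulus -/
def Kc : Set E := {x | d.R₀ ≤ ‖x - d.c‖ ∧ ‖x - d.c‖ < d.R₁ - d.s}

lemma contNN : ContinuousOn d.nn d.Kc := by
  have h1 : Continuous fun x : E => x - d.c := by fun_prop
  refine (ContinuousOn.inv₀ h1.norm.continuousOn fun x hx => ?_).smul h1.continuousOn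
  exact (d.hR₀.trans_le hx.1).ne'

lemma contHH : ContinuousOn d.HH d.Kc := by
  have hG : ContinuousOn d.G d.Kc := d.contG'
  have hp := d.hp
  have h1 : ContinuousOn (fun x => ‖d.G x‖ ^ d.p) d.Kc :=
    hG.norm.rpow_const fun x _ => Or.inr (by linarith)
  have h2 : ContinuousOn (fun x => aF d.p (d.G x)) d.Kc := (continuous_aF hp).comp_continuousOn hG
  exact (h1.mul (d.contNN.inner continuousOn_const)).sub (continuousOn_const.mul
    ((h2.inner d.contNN).mul (hG.inner continuousOn_const)))

/-- symmetrised density -/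
noncomputable def Hs (x : E) : ℝ := d.HH x + d.HH (sg d.c d.e x)

lemma sg_Kc {x : E} (hx : x ∈ d.Kc) : sg d.c d.e x ∈ d.Kc := by
  rw [Kc, mem_ofPred_eq, norm_sg_sub]; exact hx

lemma contHs : ContinuousOn d.Hs d.Kc :=
  d.contHH.add (d.contHH.comp (continuous_sg _ _).continuousOn fun x hx => d.sg_Kc hx)

lemma HH_S {x : E} (hx : ‖x - d.c‖ = d.R₀) : d.HH x = (1 - d.p) * ‖d.G x‖ ^ d.p * ⟪d.nn x, d.e⟫ := by
  have h : ⟪aF d.p (d.G x), d.nn x⟫ * ⟪d.G x, d.e⟫ = ‖d.G x‖ ^ d.p * ⟪d.nn x, d.e⟫ := by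
    have e1 : ⟪d.G x, d.e⟫ = ‖d.G x‖ * ⟪d.nn x, d.e⟫ := by
      conv_lhs => rw [d.G_normal hx]
      rw [real_inner_smul_left]
    have e2 : ⟪aF d.p (d.G x), d.nn x⟫ * ‖d.G x‖ = ‖d.G x‖ ^ d.p := by
      have h := congrArg (fun v => ⟪aF d.p (d.G x), v⟫) (d.G_normal hx)
      simp only [real_inner_smul_right] at h
      rw [← inner_aF_self d.hp, h]; ring
    rw [e1, ← mul_assoc, e2]
  rw [HH, h]; ring

lemma nn_sg (x : E) : ⟪d.nn (sg d.c d.e x), d.e⟫ = -⟪d.nn x, d.e⟫ := by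
  rw [nn, nn, real_inner_smul_left, real_inner_smul_left, inner_sg d.he, norm_sg_sub]; ring

lemma Hs_S {x : E} (hx : ‖x - d.c‖ = d.R₀) :
    d.Hs x = (d.p - 1) * ((‖d.G (sg d.c d.e x)‖ ^ d.p - ‖d.G x‖ ^ d.p) * ⟪d.nn x, d.e⟫) := by
  rw [Hs, d.HH_S hx, d.HH_S (by rw [norm_sg_sub, hx]), d.nn_sg]; ring

lemma Hs_nonneg {x : E} (hx : ‖x - d.c‖ = d.R₀) : 0 ≤ d.Hs x := by
  have hp := d.hp
  rw [d.Hs_S hx]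
  refine mul_nonneg (by linarith) ?_
  have hσ : ‖sg d.c d.e x - d.c‖ = d.R₀ := by rw [norm_sg_sub, hx]
  have e : ⟪d.nn x, d.e⟫ = d.R₀⁻¹ * ⟪x - d.c, d.e⟫ := by rw [nn, real_inner_smul_left, hx]
  have hR := d.hR₀
  rcases le_total 0 ⟪x - d.c, d.e⟫ with h | h
  · refine mul_nonneg (sub_nonneg.2 ?_) (by rw [e]; positivity)
    refine Real.rpow_le_rpow (norm_nonneg _) (d.G_mono hx hσ ?_) (by linarith)
    rw [inner_sg d.he]; linarith
  · refine mul_nonneg_of_nonpos_of_nonpos (sub_nonpos.2 ?_) (by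
      rw [e]; exact mul_nonpos_of_nonneg_of_nonpos (by positivity) h)
    refine Real.rpow_le_rpow (norm_nonneg _) (d.G_mono hσ hx ?_) (by linarith)
    rw [inner_sg d.he]; linarith

/-- radial projection on the inner sphere -/
noncomputable def Pr (x : E) : E := d.c + d.R₀ • d.nn x

lemma Pr_norm {x : E} (hx : 0 < ‖x - d.c‖) : ‖d.Pr x - d.c‖ = d.R₀ := by
  rw [Pr, add_sub_cancel_left, norm_smul, d.nn_norm hx, mul_one, Real.norm_of_nonneg d.hR₀.le]

lemma Pr_dist {x : E} (hx : d.R₀ ≤ ‖x - d.c‖) : dist x (d.Pr x) = ‖x - d.c‖ - d.R₀ := by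
  have h0 := d.hR₀.trans_le hx
  have : x - d.Pr x = (‖x - d.c‖ - d.R₀) • d.nn x := by
    rw [sub_smul, d.nn_smul h0, Pr]; abel
  rw [dist_eq_norm, this, norm_smul, d.nn_norm h0, mul_one, Real.norm_of_nonneg (by linarith)]

/-- cone over the set where the symmetrised density is large -/
def Co (δ : ℝ) : Set E := {y | y ≠ 0 ∧ δ < d.Hs (d.Pr (y + d.c))}

lemma Pr_cone {t : ℝ} (ht : 0 < t) (y : E) : d.Pr (t • y + d.c) = d.Pr (y + d.c) := by
  rcases eq_or_ne y 0 with rfl | hy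
  · simp
  have := norm_pos_iff.2 hy
  have h2 : (t * ‖y‖)⁻¹ * t = ‖y‖⁻¹ := by field_simp
  rw [Pr, Pr, nn, nn, add_sub_cancel_right, add_sub_cancel_right, norm_smul,
    Real.norm_of_nonneg ht.le, smul_smul _ t, h2]

lemma Co_cone (δ : ℝ) (t : ℝ) (ht : 0 < t) (y : E) : t • y ∈ d.Co δ ↔ y ∈ d.Co δ := by
  simp [Co, d.Pr_cone ht, ht.ne']

lemma Co_open (δ : ℝ) : IsOpen (d.Co δ) := by
  have h0 : IsOpen {y : E | y ≠ 0} := isOpen_ne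
  have hc : ContinuousOn (fun y : E => d.Hs (d.Pr (y + d.c))) {y : E | y ≠ 0} := by
    refine d.contHs.comp (t := d.Kc) ?_ ?_
    · have : ContinuousOn (fun y : E => d.c + d.R₀ • (‖y‖⁻¹ • y)) {y : E | y ≠ 0} := by
        refine continuousOn_const.add (continuousOn_const.smul
          ((ContinuousOn.inv₀ continuous_norm.continuousOn fun x hx => ?_).smul continuousOn_id))
        exact norm_ne_zero_iff.2 hx
      simpa [Pr, nn] using this
    · intro y hy
      have : ‖d.Pr (y + d.c) - d.c‖ = d.R₀ := d.Pr_norm (by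
        rw [add_sub_cancel_right]; exact norm_pos_iff.2 hy)
      exact ⟨this.ge, by rw [this]; exact d.R₀_lt⟩
  exact hc.isOpen_inter_preimage h0 isOpen_Ioi

lemma Hs_main {x0 : E} (hx0 : ‖x0 - d.c‖ = d.R₀) : d.Hs x0 ≤ 0 := by
  by_contra! hpos
  have hR := d.hR₀
  have hRlt := d.R₀_lt
  have hp := d.hp
  obtain ⟨C, hC⟩ := d.shell_est
  set δ := d.Hs x0 / 2 with hδ
  have hδ0 : 0 < δ := by positivity
  set vC := (volume : Measure E).real (ball 0 1 ∩ d.Co δ) with hvC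
  set vB := (volume : Measure E).real (ball 0 1 ∩ univ) with hvB
  have hvB0 : 0 ≤ vB := measureReal_nonneg
  have hvC0 : 0 < vC := by
    have hop : IsOpen (ball (0 : E) 1 ∩ d.Co δ) := isOpen_ball.inter (d.Co_open δ)
    have hne : (ball (0 : E) 1 ∩ d.Co δ).Nonempty := by
      have hxne : x0 - d.c ≠ 0 := norm_pos_iff.1 (by rw [hx0]; exact hR)
      refine ⟨(1 / (2 * d.R₀)) • (x0 - d.c), ?_, ?_⟩
      · rw [mem_ball_zero_iff, norm_smul, hx0, Real.norm_of_nonneg (by positivity)]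
        field_simp; norm_num
      · rw [d.Co_cone _ _ (by positivity)]
        refine ⟨hxne, ?_⟩
        have : d.Pr x0 = x0 := by
          rw [← dist_eq_zero, dist_comm, d.Pr_dist hx0.ge, hx0, sub_self]
        rw [sub_add_cancel, this]; linarith
    exact ENNReal.toReal_pos (hop.measure_pos volume hne).ne'
      (measure_inter_lt_top_of_left_ne_top measure_ball_lt_top.ne).ne
  set δ' := δ * vC / (2 * (vB + 1)) with hδ'
  have hδ'0 : 0 < δ' := by positivity
  have hδv : δ' * vB ≤ δ * vC / 2 := by
    rw [hδ', div_mul_eq_mul_div, div_le_div_iff₀ (by positivity) (by positivity)]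
    have : 0 ≤ δ * vC := by positivity
    nlinarith
  -- uniform continuity
  set ρ := (d.R₁ - d.s - d.R₀) / 2 with hρ
  have hρ0 : 0 < ρ := by rw [hρ]; linarith
  let K' : Set E := {x | d.R₀ ≤ ‖x - d.c‖ ∧ ‖x - d.c‖ ≤ d.R₀ + ρ}
  have hK'c : IsCompact K' := by
    have hc : Continuous fun x : E => ‖x - d.c‖ := by fun_prop
    refine (isCompact_closedBall d.c (d.R₀ + ρ)).of_isClosed_subset
      ((isClosed_le continuous_const hc).inter (isClosed_le hc continuous_const)) fun x hx => ?_
    rw [mem_closedBall, dist_eq_norm]; exact hx.2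
  have hK'K : K' ⊆ d.Kc := fun x hx => ⟨hx.1, lt_of_le_of_lt hx.2 (by rw [hρ]; linarith)⟩
  have huc := hK'c.uniformContinuousOn_of_continuous (d.contHs.mono hK'K)
  obtain ⟨r, hr0, hr⟩ := Metric.uniformContinuousOn_iff.1 huc δ' hδ'0
  -- lower bound for all small ε
  have key : ∀ ε : ℝ, 0 < ε → 2 * ε < ρ → 2 * ε < r →
      (δ * vC / 2) * d.R₀ ^ (Module.finrank ℝ E - 1) ≤ 2 * (C * ε ^ (d.p - 1)) := by
    intro ε hε0 hε1 hε2
    set S := d.Sh (d.R₀ + ε) (d.R₀ + 2 * ε) with hS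
    have hSK : S ⊆ K' := fun x hx => by
      have := d.mem_Sh.1 hx; exact ⟨by linarith [this.2], by linarith [this.1]⟩
    have hSm : MeasurableSet S := d.meas_Sh _ _
    have hSfin : volume S ≠ ⊤ := (lt_of_le_of_lt (measure_mono (hSK)) hK'c.measure_lt_top).ne
    have iH : IntegrableOn d.HH S :=
      ((d.contHH.mono hK'K).integrableOn_compact hK'c).mono_set hSK
    have iHs : IntegrableOn d.Hs S :=
      ((d.contHs.mono hK'K).integrableOn_compact hK'c).mono_set hSK
    have iHσ : IntegrableOn (fun x => d.HH (sg d.c d.e x)) S := by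
      have : IntegrableOn (fun x => d.Hs x - d.HH x) S := iHs.sub iH
      simpa [Hs] using this
    have hsymm : ∫ x in S, d.HH (sg d.c d.e x) = ∫ x in S, d.HH x := by
      rw [← integral_indicator hSm, ← integral_indicator hSm, ← integral_sg d.c d.e]
      refine integral_congr_ae (Eventually.of_forall fun x => ?_)
      have : sg d.c d.e x ∈ S ↔ x ∈ S := by rw [hS, d.mem_Sh, d.mem_Sh, norm_sg_sub]
      by_cases hx : x ∈ S
      · simp only [indicator_of_mem hx, indicator_of_mem (this.2 hx), sg_sg]
      · simp only [indicator_of_notMem hx, indicator_of_notMem (fun h => hx (this.1 h))]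
    have hHs : ∫ x in S, d.Hs x = 2 * ∫ x in S, d.HH x := by
      simp only [Hs]
      rw [integral_add iH iHσ, hsymm]; ring
    have hup : ∫ x in S, d.Hs x ≤ 2 * (C * ε * ε ^ (d.p - 1)) := by
      rw [hHs]
      have := (le_abs_self _).trans (hC ε hε0 (by rw [hρ] at hε1; linarith))
      linarith
    have hpt : ∀ x ∈ S, ({x | x - d.c ∈ d.Co δ}.indicator (fun _ => δ) x - δ') ≤ d.Hs x := by
      intro x hx
      have hxK := hSK hx
      have hx0 : 0 < ‖x - d.c‖ := hR.trans_le hxK.1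
      have hPK : d.Pr x ∈ K' := by
        have := d.Pr_norm hx0; exact ⟨this.ge, by rw [this]; linarith⟩
      have hd := hr x hxK (d.Pr x) hPK (by
        rw [d.Pr_dist hxK.1]; linarith [(d.mem_Sh.1 hx).1])
      rw [Real.dist_eq, abs_lt] at hd
      by_cases hco : x - d.c ∈ d.Co δ
      · rw [indicator_of_mem (show x ∈ {x | x - d.c ∈ d.Co δ} from hco)]
        have := hco.2
        rw [sub_add_cancel] at this
        linarith
      · rw [indicator_of_notMem (show x ∉ {x | x - d.c ∈ d.Co δ} from hco)]
        have := d.Hs_nonneg (d.Pr_norm hx0)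
        linarith
    have hCm : MeasurableSet {x | x - d.c ∈ d.Co δ} :=
      (d.Co_open δ).measurableSet.preimage (measurable_id.sub_const d.c)
    have ic : ∀ a : ℝ, IntegrableOn (fun _ : E => a) S := fun a => integrableOn_const hSfin
    have hlow : δ * (volume : Measure E).real (S ∩ {x | x - d.c ∈ d.Co δ}) -
        δ' * (volume : Measure E).real (S ∩ {x | x - d.c ∈ univ}) ≤ ∫ x in S, d.Hs x := by
      have h1 : ∫ x in S, ({x | x - d.c ∈ d.Co δ}.indicator (fun _ => δ) x - δ') ≤ ∫ x in S, d.Hs x :=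
        setIntegral_mono_on (((ic δ).indicator hCm).sub (ic δ')) iHs hSm hpt
      rw [integral_sub ((ic δ).indicator hCm) (ic δ'), setIntegral_indicator hCm, setIntegral_const,
        setIntegral_const] at h1
      have : S ∩ {x | x - d.c ∈ univ} = S := by simp
      rw [this]
      simp only [smul_eq_mul] at h1
      linarith
    replace hlow := hlow.trans hup
    rw [hS, Sh, cone_shell (d.Co_open δ).measurableSet (d.Co_cone δ) d.c (by linarith) (by linarith),
      cone_shell MeasurableSet.univ (by simp) d.c (by linarith) (by linarith), ← hvC, ← hvB] at hlow
    set κ := (d.R₀ + 2 * ε) ^ Module.finrank ℝ E - (d.R₀ + ε) ^ Module.finrank ℝ E with hκ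
    have hn : 1 ≤ Module.finrank ℝ E := by
      have h1 : 1 < Module.finrank ℝ E := by
        have := d.hrank
        rw [← Module.finrank_eq_rank] at this
        exact_mod_cast this
      exact h1.le
    have hκb : d.R₀ ^ (Module.finrank ℝ E - 1) * ε ≤ κ := by
      obtain ⟨m, hm⟩ := Nat.exists_eq_add_of_le hn
      rw [hκ, hm, add_comm 1 m, Nat.add_sub_cancel, pow_succ, pow_succ]
      have a1 : (d.R₀ + ε) ^ m ≤ (d.R₀ + 2 * ε) ^ m := by gcongr; linarith
      have a2 : d.R₀ ^ m ≤ (d.R₀ + ε) ^ m := by gcongr; linarith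
      nlinarith
    have hκ0 : 0 ≤ κ := le_trans (by positivity) hκb
    have h3 : (δ * vC / 2) * κ ≤ 2 * (C * ε * ε ^ (d.p - 1)) := by
      have := mul_le_mul_of_nonneg_right hδv hκ0
      linarith
    have h4 : (δ * vC / 2) * (d.R₀ ^ (Module.finrank ℝ E - 1) * ε) ≤ 2 * (C * ε * ε ^ (d.p - 1)) :=
      le_trans (by gcongr) h3
    have h5 : ((δ * vC / 2) * d.R₀ ^ (Module.finrank ℝ E - 1)) * ε ≤ (2 * (C * ε ^ (d.p - 1))) * ε := by
      linarith
    exact le_of_mul_le_mul_right h5 hε0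
  have hlim : Tendsto (fun ε : ℝ => 2 * (C * ε ^ (d.p - 1))) (𝓝[>] 0) (𝓝 (2 * (C * 0))) := by
    have : Tendsto (fun ε : ℝ => ε ^ (d.p - 1)) (𝓝 0) (𝓝 ((0 : ℝ) ^ (d.p - 1))) :=
      (Real.continuousAt_rpow_const 0 (d.p - 1) (Or.inr (by linarith))).tendsto
    rw [Real.zero_rpow (by linarith)] at this
    exact ((this.mono_left nhdsWithin_le_nhds).const_mul C).const_mul 2
  have hle := ge_of_tendsto hlim (b := (δ * vC / 2) * d.R₀ ^ (Module.finrank ℝ E - 1)) (by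
    filter_upwards [Ioo_mem_nhdsGT (show (0 : ℝ) < min ρ r / 2 by positivity)] with ε hε
    refine key ε hε.1 ?_ ?_
    · linarith [hε.2, min_le_left ρ r]
    · linarith [hε.2, min_le_right ρ r])
  have : 0 < (δ * vC / 2) * d.R₀ ^ (Module.finrank ℝ E - 1) := by positivity
  linarith

lemma pole_norm (a : ℝ) : ‖d.c + a • d.e - d.c‖ = |a| := by
  rw [add_sub_cancel_left, norm_smul, d.he, mul_one, Real.norm_eq_abs]

lemma pole_inner (a : ℝ) : ⟪d.c + a • d.e - d.c, d.e⟫ = a := by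
  rw [add_sub_cancel_left, real_inner_smul_left, real_inner_self_eq_norm_sq, d.he]; ring

lemma pole_sg (a : ℝ) : sg d.c d.e (d.c + a • d.e) = d.c + (-a) • d.e := by
  rw [sg_apply d.he, d.pole_inner, add_sub_assoc, ← sub_smul]; ring_nf

/-- `|∇u|` is constant on the inner sphere. -/
theorem G_const {x : E} (hx : ‖x - d.c‖ = d.R₀) : ‖d.G x‖ = ‖d.G (d.c + d.R₀ • d.e)‖ := by
  have hR := d.hR₀
  have hp := d.hp
  have n1 : ‖d.c + d.R₀ • d.e - d.c‖ = d.R₀ := by rw [d.pole_norm, abs_of_pos hR]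
  have n2 : ‖d.c + (-d.R₀) • d.e - d.c‖ = d.R₀ := by rw [d.pole_norm, abs_neg, abs_of_pos hR]
  have hb := abs_real_inner_le_norm (x - d.c) d.e
  rw [d.he, mul_one, hx, abs_le] at hb
  have h1 : ‖d.G (d.c + d.R₀ • d.e)‖ ≤ ‖d.G x‖ := d.G_mono n1 hx (by rw [d.pole_inner]; exact hb.2)
  have h2 : ‖d.G x‖ ≤ ‖d.G (d.c + (-d.R₀) • d.e)‖ := d.G_mono hx n2 (by rw [d.pole_inner]; exact hb.1)
  have h3 : ‖d.G (d.c + (-d.R₀) • d.e)‖ ≤ ‖d.G (d.c + d.R₀ • d.e)‖ := by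
    have h := d.Hs_main n1
    rw [d.Hs_S n1, nn, n1, real_inner_smul_left, d.pole_inner, inv_mul_cancel₀ hR.ne', mul_one,
      d.pole_sg] at h
    have h4 : ‖d.G (d.c + (-d.R₀) • d.e)‖ ^ d.p ≤ ‖d.G (d.c + d.R₀ • d.e)‖ ^ d.p := by
      by_contra! h5
      have : 0 < d.p - 1 := by linarith
      nlinarith
    exact (Real.rpow_le_rpow_iff (norm_nonneg _) (norm_nonneg _) (by linarith)).1 h4
  linarith

end Dat
end P10
end PL

open MeasureTheory Metric Set Filter
open scoped RealInnerProductSpace ENNReal Topology NNReal Pointwise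

namespace PL
section P11
set_option linter.unusedSectionVars false
set_option linter.unusedVariables false

variable {E : Type*} [NormedAddCommGroup E] [InnerProductSpace ℝ E] [FiniteDimensional ℝ E]
  [MeasurableSpace E] [BorelSpace E]

/-- hypotheses of the unique continuation lemma -/
structure UC (c e : E) (ρ δ q k K' : ℝ) (w : E → ℝ) (K : ℝ≥0) (F : E → E) : Prop where
  hρ : 0 < ρ
  hδ : 0 < δ
  hq : 1 < q
  hk : 0 < k
  hK' : 0 ≤ K'
  he : ‖e‖ = 1
  hw : LipschitzWith K w
  hw0 : ∀ x, 0 ≤ w x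
  hwz : ∀ x, ‖x - c‖ ≤ ρ → w x = 0
  hF : Measurable F
  F1 : ∀ x, ‖x - (c + ρ • e)‖ < δ → ρ < ‖x - c‖ → k * ‖gradient w x‖ ^ q ≤ ⟪F x, gradient w x⟫
  F2 : ∀ x, ‖x - (c + ρ • e)‖ < δ → ρ < ‖x - c‖ → ‖F x‖ ≤ K' * ‖gradient w x‖ ^ (q - 1)
  F3 : ∀ η > 0, ∃ ε > 0, ∀ x, ‖x - (c + ρ • e)‖ < δ → ρ < ‖x - c‖ → ‖x - c‖ < ρ + ε → ‖F x‖ ≤ η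
  F4 : ∀ (φ : E → ℝ) (Kφ : ℝ≥0), LipschitzWith Kφ φ → (∀ x, 0 ≤ φ x) →
    (∀ x, ¬ (‖x - (c + ρ • e)‖ < δ ∧ ρ < ‖x - c‖) → φ x = 0) →
    0 ≤ ∫ x in {x | ‖x - (c + ρ • e)‖ < δ ∧ ρ < ‖x - c‖}, ⟪F x, gradient φ x⟫

lemma lip_norm_sub (c : E) : LipschitzWith 1 fun x : E => ‖x - c‖ := by
  have := lipschitzWith_one_norm.comp
    (LipschitzWith.id.sub (LipschitzWith.const c) : LipschitzWith (1 + 0) fun x : E => id x - c)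
  simpa [Function.comp_def] using this

/-- outward cutoff -/
noncomputable def chi (c : E) (ρ ε : ℝ) (x : E) : ℝ := max 0 (min 1 ((‖x - c‖ - ρ) / ε))

lemma chi_lip (c : E) (ρ : ℝ) {ε : ℝ} (hε : 0 < ε) : LipschitzWith (Real.toNNReal ε⁻¹) (chi c ρ ε) := by
  have h2 : LipschitzWith (Real.toNNReal ε⁻¹) fun t : ℝ => (t - ρ) / ε := by
    refine LipschitzWith.of_dist_le_mul fun a b => ?_
    rw [Real.coe_toNNReal _ (inv_nonneg.2 hε.le), Real.dist_eq, Real.dist_eq]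
    have : (a - ρ) / ε - (b - ρ) / ε = ε⁻¹ * (a - b) := by field_simp; ring
    rw [this, abs_mul, abs_of_pos (inv_pos.2 hε)]
  have := ((h2.comp (lip_norm_sub c)).const_min 1).const_max 0
  rw [mul_one] at this
  exact this

lemma chi_01 (c : E) (ρ ε : ℝ) (x : E) : 0 ≤ chi c ρ ε x ∧ chi c ρ ε x ≤ 1 :=
  ⟨le_max_left _ _, max_le zero_le_one (min_le_left _ _)⟩

lemma chi_1 {c : E} {ρ ε : ℝ} (hε : 0 < ε) {x : E} (hx : ρ + ε ≤ ‖x - c‖) : chi c ρ ε x = 1 := by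
  have : 1 ≤ (‖x - c‖ - ρ) / ε := by rw [le_div_iff₀ hε]; linarith
  rw [chi, min_eq_left this, max_eq_right zero_le_one]

lemma chi_0 {c : E} {ρ ε : ℝ} (hε : 0 < ε) {x : E} (hx : ‖x - c‖ ≤ ρ) : chi c ρ ε x = 0 := by
  have : (‖x - c‖ - ρ) / ε ≤ 0 := div_nonpos_of_nonpos_of_nonneg (by linarith) hε.le
  rw [chi, max_eq_left]; exact (min_le_right _ _).trans this

lemma chi_grad {c : E} {ρ ε : ℝ} (hε : 0 < ε) {x : E} (hx : ρ + ε < ‖x - c‖) :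
    gradient (chi c ρ ε) x = 0 := by
  have hc : Continuous fun x : E => ‖x - c‖ := by fun_prop
  have : chi c ρ ε =ᶠ[𝓝 x] fun _ => 1 := by
    filter_upwards [(isOpen_lt continuous_const hc).mem_nhds hx] with y hy using chi_1 hε (le_of_lt hy)
  rw [this.gradient_eq]; exact gradient_fun_const x 1

namespace UC
variable {c e : E} {ρ δ q k K' : ℝ} {w : E → ℝ} {K : ℝ≥0} {F : E → E}
  (H : UC c e ρ δ q k K' w K F)

/-- the one sided neighbourhood -/
def D (c e : E) (ρ δ : ℝ) : Set E := {x | ‖x - (c + ρ • e)‖ < δ ∧ ρ < ‖x - c‖}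

lemma D_open (c e : E) (ρ δ : ℝ) : IsOpen (D c e ρ δ) := by
  have h1 : Continuous fun x : E => ‖x - (c + ρ • e)‖ := by fun_prop
  have h2 : Continuous fun x : E => ‖x - c‖ := by fun_prop
  exact (isOpen_lt h1 continuous_const).inter (isOpen_lt continuous_const h2)

lemma D_meas (c e : E) (ρ δ : ℝ) : MeasurableSet (D c e ρ δ) := (D_open c e ρ δ).measurableSet

lemma D_fin (c e : E) (ρ δ : ℝ) : volume (D c e ρ δ) < ⊤ :=
  lt_of_le_of_lt (measure_mono fun x hx => by
    rw [mem_ball, dist_eq_norm]; exact hx.1) (measure_ball_lt_top (x := c + ρ • e) (r := δ))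

include H
lemma F_bdd {x : E} (hx : x ∈ D c e ρ δ) : ‖F x‖ ≤ K' * (K : ℝ) ^ (q - 1) := by
  refine (H.F2 x hx.1 hx.2).trans ?_
  have := H.hK'
  have h := norm_gradient_le H.hw x
  have hq := H.hq
  gcongr

lemma intD {g : E → ℝ} (hg : Measurable g) {M : ℝ} (hM : ∀ x ∈ D c e ρ δ, |g x| ≤ M) :
    IntegrableOn g (D c e ρ δ) := by
  refine Measure.integrableOn_of_bounded (D_fin c e ρ δ).ne hg.aestronglyMeasurable (M := M) ?_
  rw [ae_restrict_iff' (D_meas c e ρ δ)]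
  exact Eventually.of_forall hM

lemma int_F {φ : E → ℝ} {Kφ : ℝ≥0} (hφ : LipschitzWith Kφ φ) {a : E → ℝ} (ha : Measurable a) {M : ℝ}
    (hM : ∀ x, |a x| ≤ M) :
    IntegrableOn (fun x => a x * ⟪F x, gradient φ x⟫) (D c e ρ δ) := by
  refine H.intD (ha.mul (H.hF.inner (measurable_gradient φ))) (M := M * (K' * (K : ℝ) ^ (q - 1) * Kφ)) ?_
  intro x hx
  have h1 := H.F_bdd hx
  rw [abs_mul]
  refine mul_le_mul (hM x) ?_ (abs_nonneg _) ((abs_nonneg _).trans (hM x))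
  refine (abs_real_inner_le_norm _ _).trans ?_
  exact mul_le_mul h1 (norm_gradient_le hφ x) (norm_nonneg _) ((norm_nonneg _).trans h1)

lemma F0 {φ : E → ℝ} {Kφ : ℝ≥0} (hφ : LipschitzWith Kφ φ) (h0 : ∀ x, 0 ≤ φ x) {M : ℝ≥0}
    (hM : ∀ x, φ x ≤ M) (hz : ∀ x, δ ≤ ‖x - (c + ρ • e)‖ → φ x = 0) :
    0 ≤ ∫ x in D c e ρ δ, ⟪F x, gradient φ x⟫ := by
  have hρ := H.hρ
  have haM : ∀ x, |φ x| ≤ M := fun x => by rw [abs_of_nonneg (h0 x)]; exact hM x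
  set n := Module.finrank ℝ E
  set V := (volume : Measure E).real (ball 0 1 ∩ univ) with hV
  set I := ∫ x in D c e ρ δ, ⟪F x, gradient φ x⟫ with hI
  -- main inequality
  have main : ∀ η > 0, ∀ᶠ ε in 𝓝[>] (0 : ℝ),
      0 ≤ (∫ x in D c e ρ δ, chi c ρ ε x * ⟪F x, gradient φ x⟫) +
        M * (η * ε⁻¹) * (((ρ + 2 * ε) ^ n - ρ ^ n) * V) := by
    intro η hη
    obtain ⟨ε0, hε0, hF3⟩ := H.F3 η hη
    filter_upwards [Ioo_mem_nhdsGT (show (0 : ℝ) < ε0 / 2 by positivity)] with ε hε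
    have hεp : 0 < ε := hε.1
    have hχ := chi_lip c ρ hεp
    have hχ1 : ∀ x, |chi c ρ ε x| ≤ (1 : ℝ≥0) := fun x => by
      rw [abs_of_nonneg (chi_01 c ρ ε x).1]; exact (chi_01 c ρ ε x).2
    have hl := lip_mul hφ hχ haM hχ1
    have h4 := H.F4 _ _ hl (fun x => mul_nonneg (h0 x) (chi_01 c ρ ε x).1) (by
      intro x hx
      rw [not_and_or] at hx
      rcases hx with hx | hx
      · rw [hz x (not_lt.1 hx), zero_mul]
      · rw [chi_0 hεp (not_lt.1 hx), mul_zero])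
    have i1 := H.int_F hφ hχ.continuous.measurable hχ1
    have i2 := H.int_F hχ hφ.continuous.measurable haM
    have e1 : ∫ x in D c e ρ δ, ⟪F x, gradient (fun x => φ x * chi c ρ ε x) x⟫ =
        (∫ x in D c e ρ δ, chi c ρ ε x * ⟪F x, gradient φ x⟫) +
        ∫ x in D c e ρ δ, φ x * ⟪F x, gradient (chi c ρ ε) x⟫ := by
      rw [← integral_add i1 i2]
      refine integral_congr_ae (ae_restrict_of_ae ?_)
      filter_upwards [hφ.ae_differentiableAt (μ := volume), hχ.ae_differentiableAt (μ := volume)]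
        with x h1 h2
      rw [(hg_mul h1.hasGradientAt h2.hasGradientAt).gradient]
      simp only [inner_add_right, real_inner_smul_right]
      ring
    have e2 : ∫ x in D c e ρ δ, φ x * ⟪F x, gradient (chi c ρ ε) x⟫ ≤
        M * (η * ε⁻¹) * (((ρ + 2 * ε) ^ n - ρ ^ n) * V) := by
      rw [hV, ← cone_shell MeasurableSet.univ (by simp) c hρ (by linarith)]
      set S := (ball c (ρ + 2 * ε) \ ball c ρ) ∩ {x | x - c ∈ univ} with hS
      have hSm : MeasurableSet S := (measurableSet_ball.diff measurableSet_ball).inter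
        (MeasurableSet.univ.preimage (measurable_id.sub_const c))
      have hSf : volume S < ⊤ := lt_of_le_of_lt (measure_mono (inter_subset_left.trans Set.sdiff_subset))
        (measure_ball_lt_top (x := c) (r := ρ + 2 * ε))
      have ic : Integrable (S.indicator fun _ : E => (M : ℝ) * (η * ε⁻¹)) :=
        (integrable_indicator_iff hSm).2 (integrableOn_const hSf.ne)
      calc _ ≤ ∫ x in D c e ρ δ, S.indicator (fun _ => (M : ℝ) * (η * ε⁻¹)) x := by
            refine setIntegral_mono_on i2 ic.integrableOn (D_meas c e ρ δ) fun x hx => ?_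
            by_cases hxS : x ∈ S
            · rw [indicator_of_mem hxS]
              have hxb : ‖x - c‖ < ρ + 2 * ε := by
                have := hxS.1.1; rwa [mem_ball, dist_eq_norm] at this
              refine (le_abs_self _).trans ?_
              rw [abs_mul]
              refine mul_le_mul (haM x) ?_ (abs_nonneg _) M.2
              refine (abs_real_inner_le_norm _ _).trans ?_
              refine mul_le_mul (hF3 x hx.1 hx.2 (by linarith [hε.2])) ?_ (norm_nonneg _) hη.le
              have := norm_gradient_le hχ x
              rwa [Real.coe_toNNReal _ (inv_nonneg.2 hεp.le)] at this
            · rw [indicator_of_notMem hxS]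
              have : ρ + ε < ‖x - c‖ := by
                by_contra! hh
                refine hxS ⟨⟨?_, ?_⟩, trivial⟩
                · rw [mem_ball, dist_eq_norm]; linarith
                · rw [mem_ball, dist_eq_norm]; linarith [hx.2]
              rw [chi_grad hεp this, inner_zero_right, mul_zero]
        _ ≤ ∫ x, S.indicator (fun _ => (M : ℝ) * (η * ε⁻¹)) x := by
            refine setIntegral_le_integral ic (Eventually.of_forall fun x => ?_)
            exact indicator_nonneg (fun _ _ => by positivity) x
        _ = _ := by
            rw [integral_indicator hSm, setIntegral_const, smul_eq_mul, mul_comm]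
    have h4' : 0 ≤ ∫ x in D c e ρ δ, ⟪F x, gradient (fun x => φ x * chi c ρ ε x) x⟫ := h4
    rw [e1] at h4'
    linarith
  -- limits
  have l1 : Tendsto (fun ε : ℝ => ∫ x in D c e ρ δ, chi c ρ ε x * ⟪F x, gradient φ x⟫) (𝓝[>] 0) (𝓝 I) := by
    refine tendsto_integral_filter_of_dominated_convergence (fun _ => K' * (K : ℝ) ^ (q - 1) * Kφ) ?_ ?_ ?_ ?_
    · filter_upwards [self_mem_nhdsWithin] with ε (hε : 0 < ε)
      exact ((chi_lip c ρ hε).continuous.measurable.mul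
        (H.hF.inner (measurable_gradient φ))).aestronglyMeasurable
    · filter_upwards [self_mem_nhdsWithin] with ε (hε : 0 < ε)
      rw [ae_restrict_iff' (D_meas c e ρ δ)]
      refine Eventually.of_forall fun x hx => ?_
      have h1 := H.F_bdd hx
      have h2 := norm_gradient_le hφ x
      rw [norm_mul, Real.norm_of_nonneg (chi_01 c ρ ε x).1, ← one_mul (K' * _ * _)]
      refine mul_le_mul (chi_01 c ρ ε x).2 ?_ (norm_nonneg _) zero_le_one
      refine (norm_inner_le_norm _ _).trans ?_
      exact mul_le_mul h1 h2 (norm_nonneg _) ((norm_nonneg _).trans h1)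
    · exact integrableOn_const (D_fin c e ρ δ).ne
    · rw [ae_restrict_iff' (D_meas c e ρ δ)]
      refine Eventually.of_forall fun x hx => ?_
      refine tendsto_const_nhds.congr' ?_
      filter_upwards [Ioo_mem_nhdsGT (show (0 : ℝ) < ‖x - c‖ - ρ by linarith [hx.2])] with ε hε
      rw [chi_1 hε.1 (by linarith [hε.2]), one_mul]
  have l2 : Tendsto (fun ε : ℝ => ε⁻¹ * ((ρ + 2 * ε) ^ n - ρ ^ n)) (𝓝[>] 0) (𝓝 (n * ρ ^ (n - 1) * 2)) := by
    have hd : HasDerivAt (fun ε : ℝ => (ρ + 2 * ε) ^ n) (n * ρ ^ (n - 1) * 2) 0 := by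
      have := (((hasDerivAt_id (0 : ℝ)).const_mul 2).const_add ρ).fun_pow n
      simpa using this
    rw [hasDerivAt_iff_tendsto_slope_zero] at hd
    have hd := hd.mono_left (nhdsWithin_mono (0 : ℝ) (fun t (ht : t ∈ Ioi 0) => ne_of_gt ht))
    simpa using hd
  have fin : ∀ η > 0, 0 ≤ I + M * η * (n * ρ ^ (n - 1) * 2) * V := by
    intro η hη
    have := l1.add ((l2.const_mul (M * η)).mul_const V)
    refine ge_of_tendsto this ?_
    filter_upwards [main η hη] with ε hε
    refine hε.trans (le_of_eq ?_)
    ring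
  have l3 : Tendsto (fun η : ℝ => I + M * η * (n * ρ ^ (n - 1) * 2) * V) (𝓝[>] 0) (𝓝 I) := by
    have : Continuous fun η : ℝ => I + M * η * (n * ρ ^ (n - 1) * 2) * V := by fun_prop
    have := this.tendsto 0
    simp only [mul_zero, zero_mul, add_zero] at this
    exact this.mono_left nhdsWithin_le_nhds
  refine ge_of_tendsto l3 ?_
  filter_upwards [self_mem_nhdsWithin] with η hη using fin η hη

end UC
end P11
end PL

open MeasureTheory Metric Set Filter
open scoped RealInnerProductSpace ENNReal Topology NNReal Pointwise

namespace PL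
section P12
set_option linter.unusedSectionVars false
set_option linter.unusedVariables false

variable {E : Type*} [NormedAddCommGroup E] [InnerProductSpace ℝ E] [FiniteDimensional ℝ E]
  [MeasurableSpace E] [BorelSpace E]

lemma lip_comp' {f : E → ℝ} {K : ℝ≥0} (hf : LipschitzWith K f) {s : Set ℝ} (hs : Convex ℝ s)
    (hfs : ∀ x, f x ∈ s) {g g' : ℝ → ℝ} (hg : ∀ t ∈ s, HasDerivAt g (g' t) t) {C : ℝ≥0}
    (hC : ∀ t ∈ s, |g' t| ≤ C) : LipschitzWith (C * K) fun x => g (f x) := by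
  have h : LipschitzOnWith C g s :=
    hs.lipschitzOnWith_of_nnnorm_hasDerivWithin_le (fun t ht => (hg t ht).hasDerivWithinAt) hC
  refine LipschitzWith.of_dist_le_mul fun x y => ?_
  refine (h.dist_le_mul _ (hfs x) _ (hfs y)).trans ?_
  rw [NNReal.coe_mul, mul_assoc]
  exact mul_le_mul_of_nonneg_left (hf.dist_le_mul x y) C.2

lemma young0 {a q ε : ℝ} (ha : 0 ≤ a) (haq : a < q) (hε : 0 < ε) :
    ∃ C : ℝ, ∀ y : ℝ, 0 ≤ y → y ^ a ≤ ε * y ^ q + C := by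
  set Y := ε ^ (1 / (a - q)) with hY
  have hYp : 0 < Y := by positivity
  have hYe : Y ^ (a - q) = ε := by
    rw [hY, ← Real.rpow_mul hε.le, one_div, inv_mul_cancel₀ (by linarith), Real.rpow_one]
  refine ⟨Y ^ a, fun y hy => ?_⟩
  have h0 : 0 ≤ y ^ q := by positivity
  rcases le_total y Y with h | h
  · have := Real.rpow_le_rpow hy h ha
    have : 0 ≤ ε * y ^ q := by positivity
    linarith
  · have hyp : 0 < y := hYp.trans_le h
    have e : y ^ a = y ^ (a - q) * y ^ q := by rw [← Real.rpow_add hyp]; ring_nf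
    have h2 : y ^ (a - q) ≤ ε := by
      rw [← hYe]; exact Real.rpow_le_rpow_of_nonpos hYp h (by linarith)
    have : y ^ (a - q) * y ^ q ≤ ε * y ^ q := by gcongr
    have : 0 ≤ Y ^ a := by positivity
    linarith

lemma young1 {q A B : ℝ} (hq : 1 < q) (hA : 0 < A) (hB : 0 ≤ B) :
    ∃ C : ℝ, ∀ y : ℝ, 0 ≤ y → B * y ^ (q - 1) - A * y ^ q ≤ C - y := by
  obtain ⟨C1, h1⟩ := young0 (a := q - 1) (q := q) (by linarith) (by linarith)
    (show 0 < A / (2 * (B + 1)) by positivity)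
  obtain ⟨C2, h2⟩ := young0 (a := 1) (q := q) (by linarith) (by linarith) (show 0 < A / 2 by positivity)
  refine ⟨B * C1 + C2, fun y hy => ?_⟩
  have h1 := mul_le_mul_of_nonneg_left (h1 y hy) hB
  have h2 := h2 y hy
  rw [Real.rpow_one] at h2
  have h3 : B * (A / (2 * (B + 1)) * y ^ q) ≤ A / 2 * y ^ q := by
    have : B * (A / (2 * (B + 1))) ≤ A / 2 := by
      rw [mul_div_assoc', div_le_div_iff₀ (by positivity) (by positivity)]; nlinarith
    have h0 : 0 ≤ y ^ q := by positivity
    nlinarith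
  nlinarith

namespace UC
variable {c e : E} {ρ δ q k K' : ℝ} {w : E → ℝ} {K : ℝ≥0} {F : E → E}
  (H : UC c e ρ δ q k K' w K F)

/-- cutoff around the pole -/
noncomputable def ze (c e : E) (ρ δ : ℝ) (x : E) : ℝ := 1 - chi (c + ρ • e) (δ / 2) (δ / 2) x

include H
lemma grad_bd : ∃ C : ℝ, ∀ θ : ℝ, 0 < θ →
    ∫ x in D c e ρ δ, ze c e ρ δ x * (‖gradient w x‖ / (w x + θ)) ≤ C := by
  have hq := H.hq; have hk := H.hk; have hK' := H.hK'; have hδ := H.hδ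
  set Mn : ℝ≥0 := Real.toNNReal (δ / 2)⁻¹ with hMn
  obtain ⟨C, hC⟩ := young1 (q := q) (A := (q - 1) * k) (B := q * K' * Mn) hq
    (mul_pos (by linarith) hk) (by positivity)
  refine ⟨C * (volume : Measure E).real (D c e ρ δ), fun θ hθ => ?_⟩
  set ζ := ze c e ρ δ with hζd
  have hζl : LipschitzWith Mn ζ := by
    have := (LipschitzWith.const (1 : ℝ)).sub (chi_lip (c + ρ • e) (δ / 2) (half_pos hδ))
    rw [zero_add] at this
    exact this
  have hζ0 : ∀ x, 0 ≤ ζ x := fun x => by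
    have := (chi_01 (c + ρ • e) (δ / 2) (δ / 2) x).2
    simp only [hζd, ze]; linarith
  have hζ1 : ∀ x, ζ x ≤ 1 := fun x => by
    have := (chi_01 (c + ρ • e) (δ / 2) (δ / 2) x).1
    simp only [hζd, ze]; linarith
  have hζz : ∀ x, δ ≤ ‖x - (c + ρ • e)‖ → ζ x = 0 := fun x hx => by
    simp only [hζd, ze]; rw [chi_1 (half_pos hδ) (by linarith), sub_self]
  have hl1 : LipschitzWith (Real.toNNReal q * Mn) fun x => ζ x ^ q := by
    refine lip_comp' hζl (convex_Icc (0 : ℝ) 1) (fun x => ⟨hζ0 x, hζ1 x⟩) (g := fun t => t ^ q)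
      (g' := fun t => q * t ^ (q - 1))
      (fun t ht => Real.hasDerivAt_rpow_const (Or.inr hq.le)) fun t ht => ?_
    have := ht.1
    rw [Real.coe_toNNReal _ (by linarith), abs_of_nonneg (by positivity)]
    have : t ^ (q - 1) ≤ 1 := Real.rpow_le_one ht.1 ht.2 (by linarith)
    nlinarith
  have hder : ∀ t ∈ Ici (0 : ℝ), HasDerivAt (fun t => (t + θ) ^ (1 - q)) ((1 - q) * (t + θ) ^ (1 - q - 1)) t := by
    intro t ht
    have ht0 : 0 < t + θ := add_pos_of_nonneg_of_pos ht hθ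
    have := (Real.hasDerivAt_rpow_const (p := 1 - q) (Or.inl ht0.ne')).comp t ((hasDerivAt_id t).add_const θ)
    simpa [Function.comp_def] using this
  have hl2 : LipschitzWith (Real.toNNReal ((q - 1) * θ ^ (1 - q - 1)) * K) fun x => (w x + θ) ^ (1 - q) := by
    refine lip_comp' H.hw (convex_Ici (0 : ℝ)) H.hw0 (g := fun t => (t + θ) ^ (1 - q)) hder fun t ht => ?_
    have ht0 : 0 < t + θ := add_pos_of_nonneg_of_pos ht hθ
    have hq1 : 0 < q - 1 := by linarith
    rw [Real.coe_toNNReal _ (by positivity), abs_mul, abs_of_nonneg (by positivity : 0 ≤ (t + θ) ^ (1 - q - 1)),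
      abs_of_neg (by linarith), neg_sub]
    refine mul_le_mul_of_nonneg_left ?_ hq1.le
    exact Real.rpow_le_rpow_of_nonpos hθ (by simpa using ht) (by linarith)
  have hb1 : ∀ x, |ζ x ^ q| ≤ (1 : ℝ≥0) := fun x => by
    have := hζ0 x
    rw [abs_of_nonneg (by positivity)]
    exact Real.rpow_le_one (hζ0 x) (hζ1 x) (by linarith)
  have hb2 : ∀ x, |(w x + θ) ^ (1 - q)| ≤ (Real.toNNReal (θ ^ (1 - q)) : ℝ≥0) := fun x => by
    have ht0 : 0 < w x + θ := add_pos_of_nonneg_of_pos (H.hw0 x) hθ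
    rw [abs_of_nonneg (by positivity), Real.coe_toNNReal _ (by positivity)]
    exact Real.rpow_le_rpow_of_nonpos hθ (by linarith [H.hw0 x]) (by linarith)
  have hφ := lip_mul hl1 hl2 hb1 hb2
  have hF0 := H.F0 hφ (fun x => by
    have ht0 : 0 < w x + θ := add_pos_of_nonneg_of_pos (H.hw0 x) hθ
    have := hζ0 x; positivity) (M := 1 * Real.toNNReal (θ ^ (1 - q))) (fun x => by
      refine (le_abs_self _).trans ?_
      rw [abs_mul, NNReal.coe_mul]
      exact mul_le_mul (hb1 x) (hb2 x) (abs_nonneg _) (NNReal.coe_nonneg _)) (fun x hx => by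
      rw [hζz x hx, Real.zero_rpow (by linarith), zero_mul])
  have iT : IntegrableOn (fun x => ζ x * (‖gradient w x‖ / (w x + θ))) (D c e ρ δ) := by
    refine H.intD (hζl.continuous.measurable.mul ((measurable_gradient w).norm.div
      (H.hw.continuous.measurable.add_const θ))) (M := 1 * (K / θ)) fun x hx => ?_
    have ht0 : 0 < w x + θ := add_pos_of_nonneg_of_pos (H.hw0 x) hθ
    rw [abs_mul, abs_of_nonneg (hζ0 x), abs_of_nonneg (by positivity)]
    refine mul_le_mul (hζ1 x) ?_ (by positivity) zero_le_one
    exact div_le_div₀ K.2 (norm_gradient_le H.hw x) hθ (by linarith [H.hw0 x])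
  have ic : IntegrableOn (fun _ : E => C) (D c e ρ δ) := integrableOn_const (D_fin c e ρ δ).ne
  have i1 : IntegrableOn (fun x => ⟪F x, gradient (fun x => ζ x ^ q * (w x + θ) ^ (1 - q)) x⟫) (D c e ρ δ) := by
    have := H.int_F hφ (a := fun _ => 1) measurable_const (M := 1) (by simp)
    simpa using this
  have hle : ∫ x in D c e ρ δ, ⟪F x, gradient (fun x => ζ x ^ q * (w x + θ) ^ (1 - q)) x⟫ ≤
      ∫ x in D c e ρ δ, (C - ζ x * (‖gradient w x‖ / (w x + θ))) := by
    refine setIntegral_mono_on_ae i1 (ic.sub iT) (D_meas c e ρ δ) ?_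
    filter_upwards [hζl.ae_differentiableAt (μ := volume), H.hw.ae_differentiableAt (μ := volume)]
      with x h1 h2 hx
    have hW : 0 < w x + θ := add_pos_of_nonneg_of_pos (H.hw0 x) hθ
    have g1 := hg_comp (φ := fun t : ℝ => t ^ q)
      (Real.hasDerivAt_rpow_const (x := ζ x) (p := q) (Or.inr hq.le)) h1.hasGradientAt
    have g2 := hg_comp (hder (w x) (H.hw0 x)) h2.hasGradientAt
    rw [(hg_mul g1 g2).gradient]
    simp only [inner_add_right, real_inner_smul_right]
    set T := ‖gradient w x‖ / (w x + θ) with hT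
    have hT0 : 0 ≤ T := by positivity
    have hz := hζ0 x
    have a1 : ⟪F x, gradient ζ x⟫ ≤ K' * ‖gradient w x‖ ^ (q - 1) * Mn := by
      refine (real_inner_le_norm _ _).trans ?_
      exact mul_le_mul (H.F2 x hx.1 hx.2) (norm_gradient_le hζl x) (norm_nonneg _) (by positivity)
    have a2 := H.F1 x hx.1 hx.2
    have b1 : (ζ x * T) ^ (q - 1) = ζ x ^ (q - 1) * (‖gradient w x‖ ^ (q - 1) * (w x + θ) ^ (1 - q)) := by
      rw [Real.mul_rpow hz hT0, hT, Real.div_rpow (norm_nonneg _) hW.le, div_eq_mul_inv,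
        ← Real.rpow_neg hW.le, neg_sub]
    have b2 : (ζ x * T) ^ q = ζ x ^ q * (‖gradient w x‖ ^ q * (w x + θ) ^ (1 - q - 1)) := by
      rw [Real.mul_rpow hz hT0, hT, Real.div_rpow (norm_nonneg _) hW.le, div_eq_mul_inv,
        ← Real.rpow_neg hW.le]; ring_nf
    have hy := hC (ζ x * T) (mul_nonneg hz hT0)
    rw [b1, b2] at hy
    have p1 : 0 ≤ (w x + θ) ^ (1 - q) * (q * ζ x ^ (q - 1)) := by positivity
    have p2 : 0 ≤ ζ x ^ q * ((q - 1) * (w x + θ) ^ (1 - q - 1)) := by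
      have : 0 ≤ q - 1 := by linarith
      positivity
    have m1 := mul_le_mul_of_nonneg_left a1 p1
    have m2 := mul_le_mul_of_nonneg_left a2 p2
    linarith
  rw [integral_sub ic iT, setIntegral_const, smul_eq_mul] at hle
  have hF0' : 0 ≤ ∫ x in D c e ρ δ, ⟪F x, gradient (fun x => ζ x ^ q * (w x + θ) ^ (1 - q)) x⟫ := hF0
  linarith

end UC
end P12
end PL

open MeasureTheory Metric Set Filter
open scoped RealInnerProductSpace ENNReal Topology NNReal Pointwise

namespace PL
section P13
set_option linter.unusedSectionVars false
set_option linter.unusedVariables false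

variable {E : Type*} [NormedAddCommGroup E] [InnerProductSpace ℝ E] [FiniteDimensional ℝ E]
  [MeasurableSpace E] [BorelSpace E]

namespace UC
variable {c e : E} {ρ δ q k K' : ℝ} {w : E → ℝ} {K : ℝ≥0} {F : E → E}

lemma geo (hρ : 0 < ρ) (he : ‖e‖ = 1) {t δ1 : ℝ} (hδ1 : 0 < δ1) (ht : 0 < t) (ht1 : t ≤ 1) (ht2 : t * (2 * ρ + 2) ≤ δ1 ^ 2)
    (ht3 : t ≤ ρ / 16) {x : E} (hx : ρ < ‖x - c‖) (hx2 : ‖x - (c + (ρ / 2) • e)‖ < ρ / 2 + t) :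
    ‖x - (c + ρ • e)‖ < δ1 ∧ ‖x - (c + (ρ / 2) • e)‖ / 2 ≤ ⟪x - (c + (ρ / 2) • e), e⟫ := by
  set y := x - (c + (ρ / 2) • e) with hy
  have e1 : x - c = y + (ρ / 2) • e := by rw [hy]; abel
  have e2 : x - (c + ρ • e) = y - (ρ / 2) • e := by
    have : ρ • e = (ρ / 2) • e + (ρ / 2) • e := by rw [← add_smul]; ring_nf
    rw [hy, this]; abel
  have n1 : ‖x - c‖ ^ 2 = ‖y‖ ^ 2 + ρ * ⟪y, e⟫ + ρ ^ 2 / 4 := by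
    rw [e1, norm_add_sq_real, real_inner_smul_right, norm_smul, he, Real.norm_eq_abs, mul_one, sq_abs]
    ring
  have n2 : ‖x - (c + ρ • e)‖ ^ 2 = ‖y‖ ^ 2 - ρ * ⟪y, e⟫ + ρ ^ 2 / 4 := by
    rw [e2, norm_sub_sq_real, real_inner_smul_right, norm_smul, he, Real.norm_eq_abs, mul_one, sq_abs]
    ring
  have h0 := norm_nonneg y
  have hsq : ρ ^ 2 < ‖x - c‖ ^ 2 := by gcongr
  have hy2 : ‖y‖ ^ 2 < (ρ / 2 + t) ^ 2 := by gcongr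
  constructor
  · have : ‖x - (c + ρ • e)‖ ^ 2 < δ1 ^ 2 := by nlinarith
    exact lt_of_pow_lt_pow_left₀ 2 hδ1.le this
  · have : ρ * (‖y‖ / 2) ≤ ρ * ⟪y, e⟫ := by nlinarith
    exact le_of_mul_le_mul_left this hρ

theorem concl (H : UC c e ρ δ q k K' w K F) :
    ∃ t > 0, ∀ x, ‖x - (c + ρ • e)‖ < t → ρ < ‖x - c‖ → w x = 0 := by
  have hρ := H.hρ; have hδ := H.hδ; have he := H.he
  obtain ⟨C, hC⟩ := H.grad_bd
  set t := min (min 1 ((δ / 2) ^ 2 / (2 * ρ + 2))) (ρ / 16) with ht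
  have htp : 0 < t := by positivity
  have ht1 : t ≤ 1 := (min_le_left _ _).trans (min_le_left _ _)
  have ht2 : t * (2 * ρ + 2) ≤ (δ / 2) ^ 2 := by
    rw [← le_div_iff₀ (by positivity)]; exact (min_le_left _ _).trans (min_le_right _ _)
  have ht3 : t ≤ ρ / 16 := min_le_right _ _
  clear_value t
  have hgeo := fun x hx hx2 => geo (c := c) hρ he (half_pos hδ) htp ht1 ht2 ht3 (x := x) hx hx2
  refine ⟨t, htp, fun y0 hy0 hy0' => ?_⟩
  by_contra hne
  set z := c + (ρ / 2) • e with hz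
  set τ := ρ / 2 + t with hτ
  have hτp : 0 < τ := by positivity
  have hzc : ‖z - c‖ = ρ / 2 := by
    rw [hz, add_sub_cancel_left, norm_smul, he, Real.norm_eq_abs, abs_of_pos (half_pos hρ), mul_one]
  have hzy : ‖y0 - z‖ < τ := by
    have e2 : y0 - z = (y0 - (c + ρ • e)) + (ρ / 2) • e := by
      have : ρ • e = (ρ / 2) • e + (ρ / 2) • e := by rw [← add_smul]; ring_nf
      rw [hz, this]; abel
    have : ‖(ρ / 2) • e‖ = ρ / 2 := by rw [norm_smul, he, Real.norm_eq_abs, abs_of_pos (half_pos hρ), mul_one]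
    have := norm_add_le (y0 - (c + ρ • e)) ((ρ / 2) • e)
    rw [e2]; linarith
  have hwp : 0 < w y0 := lt_of_le_of_ne (H.hw0 y0) (Ne.symm hne)
  have hwc := H.hw.continuous
  set m := w y0 / 2 with hm
  have hmp : 0 < m := half_pos hwp
  have hop : IsOpen {x | ρ < ‖x - c‖ ∧ ‖x - z‖ < τ ∧ m < w x} := by
    have h1 : Continuous fun x : E => ‖x - c‖ := by fun_prop
    have h2 : Continuous fun x : E => ‖x - z‖ := by fun_prop
    exact (isOpen_lt continuous_const h1).inter
      ((isOpen_lt h2 continuous_const).inter (isOpen_lt continuous_const hwc))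
  obtain ⟨r, hr, hball⟩ := Metric.isOpen_iff.1 hop y0 ⟨hy0', hzy, by rw [hm]; linarith⟩
  set β : E → ℝ := fun x => max 0 (τ - ‖x - z‖) with hβ
  have hβl : LipschitzWith 1 β := by
    have h1 : LipschitzWith (0 + 1) fun x : E => τ - ‖x - z‖ := (LipschitzWith.const τ).sub (lip_norm_sub z)
    rw [zero_add] at h1
    exact h1.const_max 0
  have hβ0 : ∀ x, 0 ≤ β x := fun x => le_max_left _ _
  have hβτ : ∀ x, β x ≤ τ := fun x => max_le hτp.le (by have := norm_nonneg (x - z); linarith)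
  have hβz : ∀ x, τ ≤ ‖x - z‖ → β x = 0 := fun x hx => max_eq_left (by linarith)
  have hβs : HasCompactSupport β := HasCompactSupport.intro (isCompact_closedBall z τ) fun x hx => by
    apply hβz; rw [mem_closedBall, dist_eq_norm, not_le] at hx; exact hx.le
  have hβg : ∀ x, x ≠ z → ‖x - z‖ < τ → gradient β x = -(‖x - z‖⁻¹ • (x - z)) := by
    intro x hxz hx
    have hp : 0 < ‖x - z‖ := norm_pos_iff.2 (sub_ne_zero.2 hxz)
    have hev : β =ᶠ[𝓝 x] fun y => τ - ‖y - z‖ := by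
      have hc : Continuous fun x : E => ‖x - z‖ := by fun_prop
      filter_upwards [(isOpen_lt hc continuous_const).mem_nhds hx] with y hy
      exact max_eq_right (by have : ‖y - z‖ < τ := hy; linarith)
    rw [hev.gradient_eq]
    have g0 : HasGradientAt (fun _ : E => τ) (0 : E) x := by
      rw [hasGradientAt_iff_hasFDerivAt, map_zero]; exact hasFDerivAt_const _ _
    rw [(hg_sub g0 (hg_norm_sub hp)).gradient, zero_sub]
  have hxz : ∀ x, ρ < ‖x - c‖ → x ≠ z := by
    rintro x hx rfl; rw [hzc] at hx; linarith
  -- the key estimate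
  have key : ∀ θ : ℝ, 0 < θ →
      (volume : Measure E).real (ball y0 r) * (1 / 2 * (Real.log (m + θ) - Real.log θ)) ≤ τ * C := by
    intro θ hθ
    set Lf : E → ℝ := fun x => Real.log (w x + θ) - Real.log θ with hLf
    have hder : ∀ s ∈ Ici (0 : ℝ), HasDerivAt (fun s => Real.log (s + θ) - Real.log θ) (1 / (s + θ)) s := by
      intro s hs
      have hs' : s + θ ≠ 0 := by have : (0 : ℝ) ≤ s := hs; positivity
      exact (((hasDerivAt_id s).add_const θ).log hs').sub_const _
    have hLl : LipschitzWith (Real.toNNReal (1 / θ) * K) Lf :=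
      lip_comp' H.hw (convex_Ici 0) (fun x => H.hw0 x) hder (fun s hs => by
        have hs' : (0 : ℝ) ≤ s := hs
        rw [abs_of_nonneg (by positivity), Real.coe_toNNReal _ (by positivity)]
        exact one_div_le_one_div_of_le hθ (by linarith))
    have hL0 : ∀ x, 0 ≤ Lf x := fun x => by
      have := Real.log_le_log hθ (show θ ≤ w x + θ by linarith [H.hw0 x])
      simp only [hLf]; linarith
    have hLz : ∀ x, ‖x - c‖ ≤ ρ → Lf x = 0 := fun x hx => by
      simp only [hLf]; rw [H.hwz x hx, zero_add, sub_self]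
    have ibp := LipschitzWith.integral_lineDeriv_mul_eq (μ := volume) hLl hβl hβs e
    -- left side
    have hl : ∫ x, lineDeriv ℝ Lf x e * β x ≤ τ * C := by
      have iG : IntegrableOn (fun x => τ * (ze c e ρ δ x * (‖gradient w x‖ / (w x + θ)))) (D c e ρ δ) := by
        refine H.intD (M := τ * (1 * (K / θ))) ?_ ?_
        · refine measurable_const.mul (Measurable.mul ?_ ((measurable_gradient w).norm.div (hwc.measurable.add_const θ)))
          exact measurable_const.sub (chi_lip _ _ (half_pos hδ)).continuous.measurable
        · intro x hx
          have h1 := chi_01 (c + ρ • e) (δ / 2) (δ / 2) x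
          have hw0 := H.hw0 x
          rw [abs_mul, abs_mul, abs_of_pos hτp, abs_of_nonneg (show 0 ≤ ‖gradient w x‖ / (w x + θ) by positivity)]
          have : |ze c e ρ δ x| ≤ 1 := by rw [ze, abs_le]; constructor <;> linarith [h1.1, h1.2]
          have h3 : ‖gradient w x‖ / (w x + θ) ≤ K / θ :=
            div_le_div₀ K.2 (norm_gradient_le H.hw x) hθ (by linarith)
          gcongr
      have iG' := iG.integrable_indicator (D_meas c e ρ δ)
      have hle : ‖∫ x, lineDeriv ℝ Lf x e * β x‖ ≤
          ∫ x, (D c e ρ δ).indicator (fun x => τ * (ze c e ρ δ x * (‖gradient w x‖ / (w x + θ)))) x := by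
        refine norm_integral_le_of_norm_le iG' ?_
        filter_upwards [ae_gradient_zero H.hw, H.hw.ae_differentiableAt (μ := volume)] with x h0 hd
        have hgx := hg_comp (hder (w x) (H.hw0 x)) hd.hasGradientAt
        have hgx' : HasGradientAt Lf ((1 / (w x + θ)) • gradient w x) x := hgx
        rw [hgx'.hasFDerivAt.differentiableAt.lineDeriv_eq_fderiv, hgx'.hasFDerivAt.fderiv,
          InnerProductSpace.toDual_apply_apply, real_inner_smul_left]
        have hind : 0 ≤ (D c e ρ δ).indicator (fun x => τ * (ze c e ρ δ x * (‖gradient w x‖ / (w x + θ)))) x := by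
          refine indicator_nonneg (fun x hx => ?_) x
          have h1 := (chi_01 (c + ρ • e) (δ / 2) (δ / 2) x).2
          have : 0 ≤ ze c e ρ δ x := by rw [ze]; linarith
          have := H.hw0 x
          positivity
        by_cases h1 : ‖x - c‖ ≤ ρ
        · rw [h0 (H.hwz x h1), inner_zero_left, mul_zero, zero_mul, norm_zero]; exact hind
        by_cases h2 : τ ≤ ‖x - z‖
        · rw [hβz x h2, mul_zero, norm_zero]; exact hind
        push Not at h1 h2
        have hg := (hgeo x h1 h2).1
        rw [indicator_of_mem (show x ∈ D c e ρ δ from ⟨by linarith, h1⟩), ze, chi_0 (half_pos hδ) hg.le, sub_zero, one_mul]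
        have hw0 := H.hw0 x
        rw [norm_mul, norm_mul, Real.norm_eq_abs, Real.norm_eq_abs, Real.norm_eq_abs, abs_of_nonneg (hβ0 x),
          abs_of_nonneg (show 0 ≤ 1 / (w x + θ) by positivity)]
        have hi : |⟪gradient w x, e⟫| ≤ ‖gradient w x‖ := by
          have := abs_real_inner_le_norm (gradient w x) e
          rwa [he, mul_one] at this
        calc 1 / (w x + θ) * |⟪gradient w x, e⟫| * β x ≤ 1 / (w x + θ) * ‖gradient w x‖ * τ := by
              gcongr; exact hβτ x
          _ = _ := by ring
      refine (le_abs_self _).trans (hle.trans ?_)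
      rw [integral_indicator (D_meas c e ρ δ), integral_const_mul]
      exact mul_le_mul_of_nonneg_left (hC θ hθ) hτp.le
    -- right side
    have hr' : (volume : Measure E).real (ball y0 r) * (1 / 2 * (Real.log (m + θ) - Real.log θ)) ≤
        ∫ x, lineDeriv ℝ β x (-e) * Lf x := by
      rw [← smul_eq_mul, ← setIntegral_const, ← integral_indicator measurableSet_ball]
      have hlogm : 0 ≤ 1 / 2 * (Real.log (m + θ) - Real.log θ) := by
        have := Real.log_le_log hθ (show θ ≤ m + θ by linarith)
        linarith
      refine integral_mono_of_nonneg (Eventually.of_forall fun x => indicator_nonneg (fun _ _ => hlogm) x) ?_ ?_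
      · have hcc : ContinuousOn Lf (closedBall z τ) := hLl.continuous.continuousOn
        have hld : ∀ x ∉ closedBall z τ, lineDeriv ℝ β x (-e) = 0 := by
          intro x hx
          have hev : β =ᶠ[𝓝 x] fun _ => 0 := by
            filter_upwards [isClosed_closedBall.isOpen_compl.mem_nhds hx] with y hy
            apply hβz
            rw [mem_compl_iff, mem_closedBall, dist_eq_norm, not_le] at hy
            exact hy.le
          have hd : HasFDerivAt β (0 : E →L[ℝ] ℝ) x := (hasFDerivAt_const (0 : ℝ) x).congr_of_eventuallyEq hev
          rw [hd.differentiableAt.lineDeriv_eq_fderiv, hd.fderiv]; rfl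
        obtain ⟨M, hM⟩ := (isCompact_closedBall z τ).exists_bound_of_continuousOn hcc
        refine integrable_of_bdd (B := closedBall z τ) (M := M) isBounded_closedBall measurableSet_closedBall ?_ ?_ ?_
        · exact (measurable_lineDeriv hβl.continuous).mul hLl.continuous.measurable
        · intro x
          have hM0 : 0 ≤ M := (norm_nonneg _).trans (hM z (mem_closedBall_self hτp.le))
          by_cases hx : x ∈ closedBall z τ
          · rw [abs_mul]
            have h1 : ‖lineDeriv ℝ β x (-e)‖ ≤ 1 := by
              have := norm_lineDeriv_le_of_lipschitz ℝ hβl (x₀ := x) (v := -e)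
              rwa [norm_neg, he, mul_one] at this
            calc _ ≤ 1 * M := mul_le_mul h1 (hM x hx) (abs_nonneg _) zero_le_one
              _ = M := one_mul M
          · rw [hld x hx, zero_mul, abs_zero]; exact hM0
        · intro x hx
          rw [hld x hx, zero_mul]
      · filter_upwards [ae_gradient_zero hβl, hβl.ae_differentiableAt (μ := volume)] with x h0 hd
        rw [hd.lineDeriv_eq_fderiv, hd.hasGradientAt.hasFDerivAt.fderiv,
          InnerProductSpace.toDual_apply_apply, inner_neg_right]
        by_cases h1 : ‖x - c‖ ≤ ρ
        · rw [hLz x h1, mul_zero, indicator_of_notMem]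
          intro hx; have := (hball hx).1; linarith
        by_cases h2 : τ ≤ ‖x - z‖
        · rw [h0 (hβz x h2), inner_zero_left, neg_zero, zero_mul, indicator_of_notMem]
          intro hx; have := (hball hx).2.1; linarith
        push Not at h1 h2
        have hg := (hgeo x h1 h2).2
        have hp : 0 < ‖x - z‖ := norm_pos_iff.2 (sub_ne_zero.2 (hxz x h1))
        rw [hβg x (hxz x h1) h2, inner_neg_left, neg_neg, real_inner_smul_left]
        have h3 : 1 / 2 ≤ ‖x - z‖⁻¹ * ⟪x - z, e⟫ := by
          rw [inv_mul_eq_div, le_div_iff₀ hp]; linarith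
        have hLx := hL0 x
        by_cases hx : x ∈ ball y0 r
        · rw [indicator_of_mem hx]
          have h4 : Real.log (m + θ) - Real.log θ ≤ Lf x := by
            have := Real.log_le_log (show 0 < m + θ by positivity) (show m + θ ≤ w x + θ by linarith [(hball hx).2.2])
            simp only [hLf]; linarith
          exact mul_le_mul h3 h4 (by linarith) (by linarith)
        · rw [indicator_of_notMem hx]
          have : 0 ≤ ‖x - z‖⁻¹ * ⟪x - z, e⟫ := by linarith
          positivity
    linarith
  -- contradiction
  have hv : 0 < (volume : Measure E).real (ball y0 r) :=
    ENNReal.toReal_pos (measure_ball_pos _ _ hr).ne' measure_ball_lt_top.ne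
  set v := (volume : Measure E).real (ball y0 r) with hvd
  set X := 2 * (|τ * C| + 1) / v with hX
  have hk := key (m * Real.exp (-X)) (by positivity)
  rw [Real.log_mul hmp.ne' (Real.exp_pos _).ne', Real.log_exp] at hk
  have h5 : Real.log m ≤ Real.log (m + m * Real.exp (-X)) :=
    Real.log_le_log hmp (by have := Real.exp_pos (-X); nlinarith)
  have h6 : v * (1 / 2 * X) ≤ τ * C := by
    refine le_trans ?_ hk
    gcongr; linarith
  have h7 : v * (1 / 2 * X) = |τ * C| + 1 := by rw [hX]; field_simp
  have := le_abs_self (τ * C)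
  linarith

end UC
end P13
end PL

open MeasureTheory Metric Set Filter
open scoped RealInnerProductSpace ENNReal Topology NNReal Pointwise

namespace PL
section P14
set_option linter.unusedSectionVars false
set_option linter.unusedVariables false

variable {E : Type*} [NormedAddCommGroup E] [InnerProductSpace ℝ E] [FiniteDimensional ℝ E]
  [MeasurableSpace E] [BorelSpace E]

lemma aF_strict {p : ℝ} (hp : 1 < p) {ξ : E} (hξ : ξ ≠ 0) :
    ∃ r > 0, ∃ k > 0, ∃ K' : ℝ, 0 ≤ K' ∧ ∀ a b : E, ‖a - ξ‖ < r → ‖b - ξ‖ < r →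
      k * ‖a - b‖ ^ 2 ≤ ⟪aF p a - aF p b, a - b⟫ ∧ ‖aF p a - aF p b‖ ≤ K' * ‖a - b‖ := by
  set S := ‖ξ‖ ^ 2 with hS
  have hn : 0 < ‖ξ‖ := norm_pos_iff.2 hξ
  have hSp : 0 < S := by positivity
  set κ := (p - 2) / 2 with hκ
  have e0 : (aF p : E → E) = fun x => (‖x‖ ^ 2) ^ κ • x := by
    funext x
    rw [aF, ← Real.rpow_natCast, ← Real.rpow_mul (norm_nonneg _)]
    congr 2; rw [hκ]; push_cast; ring
  have h1 : HasStrictFDerivAt (fun x : E => ‖x‖ ^ 2) (2 • (innerSL ℝ ξ)) ξ := hasStrictFDerivAt_norm_sq ξ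
  have h2 := (Real.hasStrictDerivAt_rpow_const_of_ne hSp.ne' κ).comp_hasStrictFDerivAt ξ h1
  obtain ⟨A, hAv, h3⟩ : ∃ A : E →L[ℝ] E, (∀ v, A v = S ^ κ • v + (κ * S ^ (κ - 1) * (2 * ⟪ξ, v⟫)) • ξ) ∧
      HasStrictFDerivAt (aF p : E → E) A ξ := by
    rw [e0]
    refine ⟨_, ?_, h2.smul (hasStrictFDerivAt_id (𝕜 := ℝ) ξ)⟩
    intro v
    simp [hS, two_mul]
  set k0 := min 1 (p - 1) * S ^ κ with hk0
  have hm : 0 < min 1 (p - 1) := lt_min one_pos (by linarith)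
  have hk0p : 0 < k0 := mul_pos hm (by positivity)
  have hlow : ∀ v, k0 * ‖v‖ ^ 2 ≤ ⟪A v, v⟫ := by
    intro v
    rw [hAv, inner_add_left, real_inner_smul_left, real_inner_smul_left, real_inner_self_eq_norm_sq]
    have hcs : ⟪ξ, v⟫ ^ 2 ≤ S * ‖v‖ ^ 2 := by
      have := abs_real_inner_le_norm ξ v
      rw [← sq_abs, hS, ← mul_pow]; gcongr
    have hSS : S ^ κ = S ^ (κ - 1) * S := by
      nth_rewrite 3 [← Real.rpow_one S]
      rw [← Real.rpow_add hSp]; ring_nf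
    have hT : 0 < S ^ (κ - 1) := by positivity
    have hv : 0 ≤ ‖v‖ ^ 2 := by positivity
    rw [hk0, hSS]
    set T := S ^ (κ - 1)
    have m1 := min_le_left 1 (p - 1)
    have m2 := min_le_right 1 (p - 1)
    set μ := min 1 (p - 1)
    set X := ⟪ξ, v⟫ ^ 2 with hX
    have hX0 : 0 ≤ X := by positivity
    have key : μ * (S * ‖v‖ ^ 2) ≤ S * ‖v‖ ^ 2 + 2 * κ * X := by
      have hY : 0 ≤ S * ‖v‖ ^ 2 := by positivity
      rcases le_total 0 κ with h | h
      · nlinarith [mul_nonneg h hX0]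
      · have : 2 * κ = p - 2 := by rw [hκ]; ring
        nlinarith [mul_le_mul_of_nonpos_left hcs h]
    have := mul_le_mul_of_nonneg_left key hT.le
    calc _ = T * (μ * (S * ‖v‖ ^ 2)) := by ring
      _ ≤ _ := this
      _ = _ := by rw [hX]; ring
  have hlit := h3.isLittleO.def (half_pos hk0p)
  rw [Metric.eventually_nhds_iff] at hlit
  obtain ⟨r, hr, hrb⟩ := hlit
  refine ⟨r, hr, k0 / 2, half_pos hk0p, ‖A‖ + k0 / 2, by positivity, fun a b ha hb => ?_⟩
  have hab := hrb (y := (a, b)) (by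
    rw [Prod.dist_eq, max_lt_iff, dist_eq_norm, dist_eq_norm]; exact ⟨ha, hb⟩)
  simp only at hab
  set Rm := aF p a - aF p b - A (a - b) with hRm
  have e3 : aF p a - aF p b = A (a - b) + Rm := by rw [hRm]; abel
  rw [e3]
  constructor
  · rw [inner_add_left]
    have h4 := hlow (a - b)
    have h5 : -(k0 / 2 * ‖a - b‖ ^ 2) ≤ ⟪Rm, a - b⟫ := by
      have := abs_real_inner_le_norm Rm (a - b)
      have h6 : ‖Rm‖ * ‖a - b‖ ≤ k0 / 2 * ‖a - b‖ * ‖a - b‖ := by gcongr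
      have := neg_abs_le ⟪Rm, a - b⟫
      nlinarith
    linarith
  · refine (norm_add_le _ _).trans ?_
    have := A.le_opNorm (a - b)
    linarith

lemma unif_small {T : Set E} (hT : IsCompact T) {c : E} {ρ : ℝ} {Φ : E → ℝ} (hΦ : ContinuousOn Φ T)
    (hTρ : ∀ x ∈ T, ρ ≤ ‖x - c‖) (h0 : ∀ x ∈ T, ‖x - c‖ = ρ → Φ x = 0) :
    ∀ η > 0, ∃ ε > 0, ∀ x ∈ T, ‖x - c‖ < ρ + ε → Φ x ≤ η := by
  intro η hη
  set T' := T ∩ Φ ⁻¹' Ici η with hT'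
  have hcl : IsClosed T' := hΦ.preimage_isClosed_of_isClosed hT.isClosed isClosed_Ici
  have hc : IsCompact T' := hT.of_isClosed_subset hcl inter_subset_left
  rcases T'.eq_empty_or_nonempty with he | hne
  · refine ⟨1, one_pos, fun x hx _ => ?_⟩
    by_contra h
    have : x ∈ T' := ⟨hx, (not_le.1 h).le⟩
    rw [he] at this; exact this
  · have hcn : Continuous fun x : E => ‖x - c‖ := by fun_prop
    obtain ⟨y, hy, hmin⟩ := hc.exists_isMinOn hne hcn.continuousOn
    have hyρ : ρ < ‖y - c‖ := lt_of_le_of_ne (hTρ y hy.1) fun h => by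
      have h1 := h0 y hy.1 h.symm
      have h2 : η ≤ Φ y := hy.2
      linarith
    refine ⟨‖y - c‖ - ρ, by linarith, fun x hx hlt => ?_⟩
    by_contra h
    have h3 : ‖y - c‖ ≤ ‖x - c‖ := hmin (a := x) ⟨hx, (not_le.1 h).le⟩
    linarith

lemma aF_rf (p : ℝ) (h ξ : E) : aF p (rf h ξ) = rf h (aF p ξ) := by
  rw [aF, aF, LinearIsometryEquiv.norm_map, map_smul]

lemma inner_rf (h a b : E) : ⟪rf h a, b⟫ = ⟪a, rf h b⟫ := by
  conv_lhs => rw [← rf_rf h b]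
  exact LinearIsometryEquiv.inner_map_map _ _ _

lemma set_to_full {O : Set E} (hO : MeasurableSet O) {φ : E → ℝ} {Kφ : ℝ≥0} (hφ : LipschitzWith Kφ φ)
    (h0 : ∀ x, x ∉ O → φ x = 0) (F : E → E) :
    ∫ x in O, ⟪F x, gradient φ x⟫ = ∫ x, ⟪F x, gradient φ x⟫ := by
  refine setIntegral_eq_integral_of_ae_compl_eq_zero ?_
  filter_upwards [ae_gradient_zero hφ] with x hx hxO
  rw [hx (h0 x hxO), inner_zero_right]

namespace Dat
variable (d : Dat E)

lemma x0_norm {ρ δ : ℝ} (hρ : 0 ≤ ρ) {x : E} (hx : ‖x - (d.c + ρ • d.e)‖ ≤ δ) : ‖x - d.c‖ ≤ ρ + δ := by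
  have h := d.pole_norm ρ
  rw [abs_of_nonneg hρ] at h
  have := norm_sub_le_norm_sub_add_norm_sub x (d.c + ρ • d.e) d.c
  linarith

theorem G_ne : d.G (d.c + d.R₀ • d.e) ≠ 0 := by
  intro hG0
  have hR₀ := d.hR₀
  have hlt := d.R₀_lt
  set δ := (d.R₁ - d.s - d.R₀) / 2 with hδ
  have hδp : 0 < δ := by rw [hδ]; linarith
  have hDA : ∀ x, ‖x - (d.c + d.R₀ • d.e)‖ < δ → d.R₀ < ‖x - d.c‖ → x ∈ d.Ω := fun x h1 h2 =>
    d.A_sub ⟨h2, by have := d.x0_norm hR₀.le h1.le; linarith⟩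
  have H : UC d.c d.e d.R₀ δ d.p 1 1 d.U d.L (fun x => aF d.p (gradient d.U x)) := by
    refine ⟨hR₀, hδp, d.hp, one_pos, zero_le_one, d.he, d.lipU', d.U_nonneg, ?_, ?_, ?_, ?_, ?_, ?_⟩
    · intro x hx
      exact d.U_zero fun h => by have := (d.mem_Ω.1 h).2; linarith
    · exact (continuous_aF d.hp).measurable.comp (measurable_gradient _)
    · intro x _ _; rw [inner_aF_self d.hp, one_mul]
    · intro x _ _; rw [norm_aF d.hp, one_mul]
    · have hcn : Continuous fun x : E => ‖x - d.c‖ := by fun_prop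
      have hT : IsCompact (closedBall (d.c + d.R₀ • d.e) δ ∩ {x | d.R₀ ≤ ‖x - d.c‖}) :=
        (isCompact_closedBall _ _).inter_right (isClosed_le continuous_const hcn)
      have hΦ : ContinuousOn (fun x => ‖aF d.p (d.G x)‖)
          (closedBall (d.c + d.R₀ • d.e) δ ∩ {x | d.R₀ ≤ ‖x - d.c‖}) := by
        refine ((continuous_aF d.hp).comp_continuousOn (d.contG'.mono ?_)).norm
        intro x hx
        refine ⟨hx.2, ?_⟩
        have h1 := hx.1
        rw [mem_closedBall, dist_eq_norm] at h1
        have := d.x0_norm hR₀.le h1; linarith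
      have := unif_small hT hΦ (fun x hx => hx.2) (fun x hx h => by
        have h1 := d.G_const h
        rw [hG0, norm_zero, norm_eq_zero] at h1
        rw [h1, aF_zero, norm_zero])
      intro η hη
      obtain ⟨ε, hε, h⟩ := this η hη
      refine ⟨ε, hε, fun x h1 h2 h3 => ?_⟩
      rw [d.U_gradient (hDA x h1 h2)]
      exact h x ⟨by rw [mem_closedBall, dist_eq_norm]; exact h1.le, h2.le⟩ h3
    · intro φ Kφ hφ hφ0 hφz
      have hm := UC.D_meas d.c d.e d.R₀ δ
      have e1 := set_to_full hm hφ (fun x hx => hφz x hx) (fun x => aF d.p (gradient d.U x))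
      have e2 := d.weakU hφ (fun x hx => hφz x fun h => hx (hDA x h.1 h.2))
      rw [e2] at e1
      refine le_of_le_of_eq ?_ e1.symm
      refine mul_nonneg (d.lam0 _) (integral_nonneg fun x => ?_)
      have := d.U_nonneg x
      have := hφ0 x
      positivity
  obtain ⟨t, ht, hcon⟩ := H.concl
  set a := min (t / 2) (δ / 2) with ha
  have hap : 0 < a := by positivity
  have h1 : ‖d.c + (d.R₀ + a) • d.e - (d.c + d.R₀ • d.e)‖ = a := by
    have : d.c + (d.R₀ + a) • d.e - (d.c + d.R₀ • d.e) = a • d.e := by rw [add_smul]; abel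
    rw [this, norm_smul, d.he, mul_one, Real.norm_eq_abs, abs_of_pos hap]
  have h2 : d.R₀ < ‖d.c + (d.R₀ + a) • d.e - d.c‖ := by
    rw [d.pole_norm, abs_of_pos (by linarith)]; linarith
  have h3 := min_le_left (t / 2) (δ / 2)
  have h4 := min_le_right (t / 2) (δ / 2)
  have h5 := hcon _ (by rw [h1]; linarith) h2
  have h6 := d.U_pos (hDA _ (by rw [h1]; linarith) h2)
  linarith

lemma annulus_closure {ρ : ℝ} (hρ : d.R₀ < ρ) :
    {x | d.R₀ < ‖x - d.c‖ ∧ ‖x - d.c‖ ≤ ρ} ⊆ closure {x : E | d.R₀ < ‖x - d.c‖ ∧ ‖x - d.c‖ < ρ} := by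
  rintro x ⟨h1, h2⟩
  have hR₀ := d.hR₀
  have hp : 0 < ‖x - d.c‖ := by linarith
  have ht : Tendsto (fun τ : ℝ => d.c + τ • (x - d.c)) (𝓝[<] 1) (𝓝 x) := by
    have hc : Continuous fun τ : ℝ => d.c + τ • (x - d.c) := by fun_prop
    have := (hc.tendsto 1).mono_left (nhdsWithin_le_nhds (s := Iio 1))
    simpa using this
  refine mem_closure_of_tendsto ht ?_
  have hlt : d.R₀ / ‖x - d.c‖ < 1 := by rw [div_lt_one hp]; exact h1
  filter_upwards [Ioo_mem_nhdsLT hlt] with τ hτ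
  have hτ0 : 0 < τ := lt_trans (by positivity) hτ.1
  have hn : ‖d.c + τ • (x - d.c) - d.c‖ = τ * ‖x - d.c‖ := by
    rw [add_sub_cancel_left, norm_smul, Real.norm_eq_abs, abs_of_pos hτ0]
  have h3 := (div_lt_iff₀ hp).1 hτ.1
  have h4 := hτ.2
  refine ⟨by rw [hn]; exact h3, by rw [hn]; nlinarith⟩

lemma G_sg {h : E} {ρ : ℝ} (hρ : d.R₀ < ρ) (hρ1 : ρ < d.R₁ - d.s)
    (heq : ∀ x, d.R₀ < ‖x - d.c‖ → ‖x - d.c‖ < ρ → d.U (sg d.c h x) = d.U x) {x : E}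
    (hx1 : d.R₀ < ‖x - d.c‖) (hx2 : ‖x - d.c‖ ≤ ρ) : rf h (d.G (sg d.c h x)) = d.G x := by
  have hE : EqOn (fun x => rf h (d.G (sg d.c h x))) d.G {x | d.R₀ < ‖x - d.c‖ ∧ ‖x - d.c‖ < ρ} := by
    rintro y ⟨h1, h2⟩
    have hyA : y ∈ d.A := ⟨h1, by linarith⟩
    have hcn : Continuous fun x : E => ‖x - d.c‖ := by fun_prop
    have hev : (fun y => d.U (sg d.c h y)) =ᶠ[𝓝 y] d.U := by
      filter_upwards [((isOpen_lt continuous_const hcn).inter (isOpen_lt hcn continuous_const)).mem_nhds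
        (⟨h1, h2⟩ : y ∈ {x | d.R₀ < ‖x - d.c‖} ∩ {x | ‖x - d.c‖ < ρ})] with z hz using heq z hz.1 hz.2
    have := hev.gradient_eq
    rw [gradient_sg, d.U_gradient (d.A_sub hyA), d.U_gradient (d.A_sub (d.sg_A hyA))] at this
    exact this
  have hG : ContinuousOn d.G {x | d.R₀ < ‖x - d.c‖ ∧ ‖x - d.c‖ ≤ ρ} :=
    d.contG'.mono fun y hy => ⟨hy.1.le, by linarith [hy.2]⟩
  have hG2 : ContinuousOn (fun x => rf h (d.G (sg d.c h x))) {x | d.R₀ < ‖x - d.c‖ ∧ ‖x - d.c‖ ≤ ρ} := by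
    refine (rf h).continuous.comp_continuousOn (hG.comp (continuous_sg d.c h).continuousOn ?_)
    intro y hy
    refine ⟨?_, ?_⟩ <;> rw [norm_sg_sub]
    exacts [hy.1, hy.2]
  exact hE.of_subset_closure hG2 hG (fun y hy => ⟨hy.1, hy.2.le⟩) (d.annulus_closure hρ) ⟨hx1, hx2⟩

lemma G_sg0 {x : E} (hx : ‖x - d.c‖ = d.R₀) : rf d.e (d.G (sg d.c d.e x)) = d.G x := by
  have h1 : ‖sg d.c d.e x - d.c‖ = d.R₀ := by rw [norm_sg_sub, hx]
  rw [d.G_normal h1, d.G_const h1, d.G_normal hx, d.G_const hx, map_smul, nn, nn, norm_sg_sub, sg_sub, map_smul,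
    rf_rf]

end Dat
end P14
end PL

open MeasureTheory Metric Set Filter
open scoped RealInnerProductSpace ENNReal Topology NNReal Pointwise

namespace PL
section P15
set_option linter.unusedSectionVars false
set_option linter.unusedVariables false

variable {E : Type*} [NormedAddCommGroup E] [InnerProductSpace ℝ E] [FiniteDimensional ℝ E]
  [MeasurableSpace E] [BorelSpace E]
namespace Dat
variable (d : Dat E)

lemma weakV {φ : E → ℝ} {K : ℝ≥0} (hφ : LipschitzWith K φ) (h0 : ∀ x ∉ d.A, φ x = 0) :
    ∫ x, ⟪aF d.p (gradient (fun y => d.U (sg d.c d.e y)) x), gradient φ x⟫ =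
      d.lam d.s * ∫ x, d.U (sg d.c d.e x) ^ (d.p - 1) * φ x := by
  have hψ : LipschitzWith (K * 1) fun y => φ (sg d.c d.e y) := hφ.comp (lip_sg d.c d.e)
  have h := d.weakU hψ (fun x hx => h0 _ fun hA => hx (by
    have := d.A_sub (d.sg_A (h := d.e) hA)
    rwa [sg_sg] at this))
  rw [← integral_sg d.c d.e, ← integral_sg d.c d.e (fun x => d.U x ^ (d.p - 1) * φ (sg d.c d.e x))] at h
  simp only [sg_sg] at h
  rw [← h]
  congr 1; funext x
  rw [gradient_sg, gradient_sg, sg_sg, aF_rf, inner_rf]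

lemma int_aF {f φ : E → ℝ} {K K' : ℝ≥0} (hf : LipschitzWith K f) (hφ : LipschitzWith K' φ)
    (h0 : ∀ x ∉ d.A, φ x = 0) : Integrable fun x => ⟪aF d.p (gradient f x), gradient φ x⟫ := by
  have hp := d.hp
  refine integrable_of_bdd (B := closedBall 0 d.R₁) isBounded_closedBall measurableSet_closedBall
    (((continuous_aF hp).measurable.comp (measurable_gradient f)).inner (measurable_gradient φ))
    (M := (K : ℝ) ^ (d.p - 1) * K') ?_ ?_
  · intro x
    refine (abs_real_inner_le_norm _ _).trans ?_
    refine mul_le_mul ?_ (norm_gradient_le hφ x) (norm_nonneg _) (by positivity)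
    show ‖aF d.p (gradient f x)‖ ≤ _
    rw [norm_aF hp]
    exact Real.rpow_le_rpow (norm_nonneg _) (norm_gradient_le hf x) (by linarith)
  · intro x hx
    have : φ =ᶠ[𝓝 x] 0 := by
      filter_upwards [isClosed_closedBall.isOpen_compl.mem_nhds hx] with y hy
      exact h0 y fun h => hy (d.Ω_bdd (d.A_sub h))
    rw [gradient_eq_zero_of_eventually this, inner_zero_right]

lemma int_Up {f φ : E → ℝ} (hf : Continuous f) (hφ : Continuous φ) (h0 : ∀ x ∉ d.A, φ x = 0) :
    Integrable fun x => f x ^ (d.p - 1) * φ x := by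
  have hp := d.hp
  have hc : Continuous fun x => f x ^ (d.p - 1) * φ x :=
    (hf.rpow_const fun _ => Or.inr (by linarith)).mul hφ
  refine hc.integrable_of_hasCompactSupport (HasCompactSupport.intro (isCompact_closedBall (0 : E) d.R₁) ?_)
  intro x hx
  rw [h0 x fun h => hx (d.Ω_bdd (d.A_sub h)), mul_zero]

theorem extend {ρ : ℝ} (hρ0 : d.R₀ ≤ ρ) (hρ1 : ρ < d.R₁ - d.s)
    (heq : ∀ x, d.R₀ ≤ ‖x - d.c‖ → ‖x - d.c‖ ≤ ρ → d.U (sg d.c d.e x) = d.U x)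
    (hne : d.G (d.c + ρ • d.e) ≠ 0) :
    ∃ t > 0, ∀ x, ‖x - (d.c + ρ • d.e)‖ < t → ρ < ‖x - d.c‖ → d.U (sg d.c d.e x) = d.U x := by
  have hR₀ := d.hR₀
  have hρ : 0 < ρ := by linarith
  have hp := d.hp
  set x0 := d.c + ρ • d.e with hx0
  have hx0n : ‖x0 - d.c‖ = ρ := by rw [hx0, d.pole_norm, abs_of_pos hρ]
  set GV : E → E := fun x => rf d.e (d.G (sg d.c d.e x)) with hGV
  have hGVe : ∀ x, ‖x - d.c‖ = ρ → GV x = d.G x := by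
    intro x hx
    rcases hρ0.eq_or_lt with h | h
    · exact d.G_sg0 (by rw [hx, h])
    · exact d.G_sg h hρ1 (fun y h1 h2 => heq y h1.le h2.le) (by rw [hx]; exact h) hx.le
  set Kρ : Set E := {x | d.R₀ ≤ ‖x - d.c‖ ∧ ‖x - d.c‖ < d.R₁ - d.s} with hKρ
  have hGc : ContinuousOn d.G Kρ := d.contG'
  have hGVc : ContinuousOn GV Kρ := by
    refine (rf d.e).continuous.comp_continuousOn (hGc.comp (continuous_sg d.c d.e).continuousOn ?_)
    intro y hy
    exact d.sg_Kc hy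
  obtain ⟨r, hr, k, hk, K', hK', hst⟩ := aF_strict hp hne
  have hx0K : x0 ∈ Kρ := ⟨by rw [hx0n]; exact hρ0, by rw [hx0n]; exact hρ1⟩
  obtain ⟨δ1, hδ1, hb1⟩ := Metric.continuousWithinAt_iff.1 (hGc x0 hx0K) r hr
  obtain ⟨δ2, hδ2, hb2⟩ := Metric.continuousWithinAt_iff.1 (hGVc x0 hx0K) r hr
  rw [hGVe x0 hx0n] at hb2
  set δ := min (min δ1 δ2) (min (ρ / 2) ((d.R₁ - d.s - ρ) / 2)) with hδ
  have hδp : 0 < δ := by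
    refine lt_min (lt_min hδ1 hδ2) (lt_min (by linarith) (by linarith))
  have k1 : δ ≤ δ1 := (min_le_left _ _).trans (min_le_left _ _)
  have k2 : δ ≤ δ2 := (min_le_left _ _).trans (min_le_right _ _)
  have k3 : δ ≤ ρ / 2 := (min_le_right _ _).trans (min_le_left _ _)
  have k4 : δ ≤ (d.R₁ - d.s - ρ) / 2 := (min_le_right _ _).trans (min_le_right _ _)
  clear_value δ
  have hDA : ∀ x, ‖x - x0‖ < δ → ρ < ‖x - d.c‖ → x ∈ d.A := fun x h1 h2 =>
    ⟨by linarith, by have := d.x0_norm hρ.le h1.le; linarith⟩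
  set V : E → ℝ := fun x => d.U (sg d.c d.e x) with hV
  have hVl : LipschitzWith d.L V := by
    have := d.lipU'.comp (lip_sg d.c d.e)
    rwa [mul_one] at this
  have hVg : ∀ x ∈ d.A, gradient V x = GV x := fun x hx => by
    rw [hV, gradient_sg, d.U_gradient (d.A_sub (d.sg_A hx))]
  have hUV : ∀ x, ‖x - x0‖ < δ → ρ < ‖x - d.c‖ → d.U x ≤ V x := by
    intro x h1 h2
    refine d.refl_le d.he (by rw [real_inner_self_eq_norm_sq, d.he]; norm_num) (hDA x h1 h2) ?_
    have e1 : x - d.c = (x - x0) + (x0 - d.c) := by abel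
    rw [e1, inner_add_left, hx0, d.pole_inner, ← hx0]
    have := neg_le_of_abs_le (abs_real_inner_le_norm (x - x0) d.e)
    rw [d.he, mul_one] at this
    linarith
  set w : E → ℝ := fun x => |V x - d.U x| with hw
  have hwl : LipschitzWith (d.L + d.L) w := by
    refine LipschitzWith.of_dist_le_mul fun x y => ?_
    have := (hVl.sub d.lipU').dist_le_mul x y
    refine le_trans ?_ this
    rw [Real.dist_eq, Real.dist_eq]
    exact abs_abs_sub_abs_le_abs_sub _ _
  have hwg : ∀ x, ‖x - x0‖ < δ → ρ < ‖x - d.c‖ → gradient w x = GV x - d.G x := by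
    intro x h1 h2
    have hev : w =ᶠ[𝓝 x] fun y => V y - d.U y := by
      filter_upwards [(UC.D_open d.c d.e ρ δ).mem_nhds (⟨h1, h2⟩ : x ∈ UC.D d.c d.e ρ δ)] with y hy
      exact abs_of_nonneg (sub_nonneg.2 (hUV y hy.1 hy.2))
    have hA := hDA x h1 h2
    have gV : HasGradientAt V (GV x) x := hasGradientAt_sg (d.U_grad (d.A_sub (d.sg_A hA)))
    rw [hev.gradient_eq, (hg_sub gV (d.U_grad (d.A_sub hA))).gradient]
  have hst' : ∀ x, ‖x - x0‖ < δ → ρ < ‖x - d.c‖ →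
      k * ‖GV x - d.G x‖ ^ 2 ≤ ⟪aF d.p (GV x) - aF d.p (d.G x), GV x - d.G x⟫ ∧
        ‖aF d.p (GV x) - aF d.p (d.G x)‖ ≤ K' * ‖GV x - d.G x‖ := by
    intro x h1 h2
    have hA := hDA x h1 h2
    have hxK : x ∈ Kρ := ⟨hA.1.le, hA.2⟩
    have q1 := hb1 hxK (by rw [dist_eq_norm]; linarith)
    have q2 := hb2 hxK (by rw [dist_eq_norm]; linarith)
    rw [dist_eq_norm] at q1 q2
    exact hst _ _ q2 q1
  have hFx : ∀ x, ‖x - x0‖ < δ → ρ < ‖x - d.c‖ →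
      aF d.p (gradient V x) - aF d.p (gradient d.U x) = aF d.p (GV x) - aF d.p (d.G x) := by
    intro x h1 h2
    have hA := hDA x h1 h2
    rw [hVg x hA, d.U_gradient (d.A_sub hA)]
  have H : UC d.c d.e ρ δ 2 k K' w (d.L + d.L)
      (fun x => aF d.p (gradient V x) - aF d.p (gradient d.U x)) := by
    refine ⟨hρ, hδp, one_lt_two, hk, hK', d.he, hwl, fun x => abs_nonneg _, ?_, ?_, ?_, ?_, ?_, ?_⟩
    · intro x hx
      have : V x = d.U x := by
        rcases le_total d.R₀ ‖x - d.c‖ with h | h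
        · exact heq x h hx
        · have z1 : d.U x = 0 := d.U_zero fun h' => by have := (d.mem_Ω.1 h').2; linarith
          have z2 : V x = 0 := d.U_zero fun h' => by
            have := (d.mem_Ω.1 h').2
            rw [norm_sg_sub] at this; linarith
          rw [z1, z2]
      simp only [hw, this, sub_self, abs_zero]
    · exact ((continuous_aF hp).measurable.comp (measurable_gradient _)).sub
        ((continuous_aF hp).measurable.comp (measurable_gradient _))
    · intro x h1 h2
      rw [hFx x h1 h2, hwg x h1 h2, Real.rpow_two]
      exact (hst' x h1 h2).1
    · intro x h1 h2
      rw [hFx x h1 h2, hwg x h1 h2, show (2 : ℝ) - 1 = 1 by norm_num, Real.rpow_one]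
      exact (hst' x h1 h2).2
    · have hcn : Continuous fun x : E => ‖x - d.c‖ := by fun_prop
      have hT : IsCompact (closedBall x0 δ ∩ {x | ρ ≤ ‖x - d.c‖}) :=
        (isCompact_closedBall _ _).inter_right (isClosed_le continuous_const hcn)
      have hsub : closedBall x0 δ ∩ {x | ρ ≤ ‖x - d.c‖} ⊆ Kρ := by
        intro x hx
        have h2 : ρ ≤ ‖x - d.c‖ := hx.2
        refine ⟨by linarith, ?_⟩
        have h1 := hx.1
        rw [mem_closedBall, dist_eq_norm] at h1
        have := d.x0_norm hρ.le h1; linarith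
      have hΦ : ContinuousOn (fun x => ‖aF d.p (GV x) - aF d.p (d.G x)‖)
          (closedBall x0 δ ∩ {x | ρ ≤ ‖x - d.c‖}) :=
        (((continuous_aF hp).comp_continuousOn (hGVc.mono hsub)).sub
          ((continuous_aF hp).comp_continuousOn (hGc.mono hsub))).norm
      have := unif_small hT hΦ (fun x hx => hx.2) (fun x hx h => by
        rw [hGVe x h, sub_self, norm_zero])
      intro η hη
      obtain ⟨ε, hε, h⟩ := this η hη
      refine ⟨ε, hε, fun x h1 h2 h3 => ?_⟩
      rw [hFx x h1 h2]
      exact h x ⟨by rw [mem_closedBall, dist_eq_norm]; exact h1.le, h2.le⟩ h3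
    · intro φ Kφ hφ hφ0 hφz
      have hm := UC.D_meas d.c d.e ρ δ
      have hφA : ∀ x ∉ d.A, φ x = 0 := fun x hx => hφz x fun h => hx (hDA x h.1 h.2)
      have e1 := set_to_full hm hφ (fun x hx => hφz x hx)
        (fun x => aF d.p (gradient V x) - aF d.p (gradient d.U x))
      refine le_of_le_of_eq ?_ e1.symm
      simp only [inner_sub_left]
      rw [integral_sub (d.int_aF hVl hφ hφA) (d.int_aF d.lipU' hφ hφA), d.weakV hφ hφA,
        d.weakU hφ (fun x hx => hφA x fun h => hx (d.A_sub h)), ← mul_sub,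
        ← integral_sub (d.int_Up hVl.continuous hφ.continuous hφA) (d.int_Up d.contU hφ.continuous hφA)]
      refine mul_nonneg (d.lam0 _) (integral_nonneg fun x => ?_)
      show 0 ≤ V x ^ (d.p - 1) * φ x - d.U x ^ (d.p - 1) * φ x
      by_cases hx : ‖x - x0‖ < δ ∧ ρ < ‖x - d.c‖
      · have h1 := Real.rpow_le_rpow (d.U_nonneg x) (hUV x hx.1 hx.2) (show 0 ≤ d.p - 1 by linarith)
        have := mul_le_mul_of_nonneg_right h1 (hφ0 x)
        linarith
      · rw [hφz x hx, mul_zero, mul_zero, sub_zero]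
  obtain ⟨t, ht, hcon⟩ := H.concl
  refine ⟨t, ht, fun x h1 h2 => ?_⟩
  have := hcon x h1 h2
  exact sub_eq_zero.1 (abs_eq_zero.1 this)

end Dat
end P15
end PL

open MeasureTheory Metric Set Filter
open scoped RealInnerProductSpace ENNReal Topology NNReal Pointwise

namespace PL
section P16
set_option linter.unusedSectionVars false
set_option linter.unusedVariables false

namespace Dat
variable {E : Type*} [NormedAddCommGroup E] [InnerProductSpace ℝ E] [FiniteDimensional ℝ E]
  [MeasurableSpace E] [BorelSpace E]
variable (d : Dat E)

lemma U_sphere {x : E} (hx : ‖x - d.c‖ = d.R₀) : d.U x = 0 :=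
  d.U_zero fun h => by have := (d.mem_Ω.1 h).2; linarith

theorem final : ∃ r₀, d.R₀ < r₀ ∧ r₀ < d.R₁ - d.s ∧
    (∀ x, d.R₀ < ‖x - d.c‖ → ‖x - d.c‖ ≤ r₀ → d.U x = d.U (d.c + ‖x - d.c‖ • d.e)) ∧
    (∀ x, ‖x - d.c‖ = r₀ → d.G x = 0) := by
  have hR₀ := d.hR₀
  have hlt := d.R₀_lt
  have hs := d.hs
  set f : ℝ → ℝ := fun r => d.U (d.c + (-r) • d.e) - d.U (d.c + r • d.e) with hf
  have hfc : Continuous f := by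
    have h1 : Continuous fun r : ℝ => d.c + (-r) • d.e := by fun_prop
    have h2 : Continuous fun r : ℝ => d.c + r • d.e := by fun_prop
    exact (d.contU.comp h1).sub (d.contU.comp h2)
  set Z : Set ℝ := {r | d.R₀ ≤ r ∧ r < d.R₁ - d.s ∧ ∀ q, d.R₀ ≤ q → q ≤ r → f q = 0} with hZ
  have hf0 : f d.R₀ = 0 := by
    have h1 := d.U_sphere (x := d.c + (-d.R₀) • d.e) (by rw [d.pole_norm, abs_neg, abs_of_pos hR₀])
    have h2 := d.U_sphere (x := d.c + d.R₀ • d.e) (by rw [d.pole_norm, abs_of_pos hR₀])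
    simp only [hf, h1, h2, sub_self]
  have hZ0 : d.R₀ ∈ Z := ⟨le_rfl, hlt, fun q h1 h2 => by rw [le_antisymm h2 h1]; exact hf0⟩
  have hZb : BddAbove Z := ⟨d.R₁ - d.s, fun r hr => hr.2.1.le⟩
  set r₀ := sSup Z with hr₀
  have hr0 : d.R₀ ≤ r₀ := le_csSup hZb hZ0
  have hr1 : r₀ ≤ d.R₁ - d.s := csSup_le ⟨_, hZ0⟩ fun r hr => hr.2.1.le
  have hI : ∀ q, d.R₀ ≤ q → q < r₀ → f q = 0 := by
    intro q h1 h2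
    obtain ⟨r, hr, hqr⟩ := exists_lt_of_lt_csSup ⟨_, hZ0⟩ h2
    exact hr.2.2 q h1 hqr.le
  have hIc : ∀ q, d.R₀ ≤ q → q ≤ r₀ → f q = 0 := by
    intro q h1 h2
    rcases hr0.eq_or_lt with h | h
    · have : q = d.R₀ := le_antisymm (by linarith) h1
      rw [this]; exact hf0
    · have hcl : Icc d.R₀ r₀ ⊆ f ⁻¹' {0} := by
        rw [← closure_Ico h.ne]
        exact closure_minimal (fun q hq => hI q hq.1 hq.2) (isClosed_singleton.preimage hfc)
      exact hcl ⟨h1, h2⟩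
  have hr2 : r₀ < d.R₁ - d.s := by
    refine lt_of_le_of_ne hr1 fun h => ?_
    have h1 := hIc r₀ hr0 le_rfl
    rw [h] at h1
    have z1 : d.U (d.c + (d.R₁ - d.s) • d.e) = 0 := d.U_zero fun h' => by
      have h2 := (d.mem_Ω.1 h').1
      rw [c, ← add_smul, norm_smul, d.he, mul_one, Real.norm_eq_abs] at h2
      have := le_abs_self (d.s + (d.R₁ - d.s))
      linarith
    have z2 : 0 < d.U (d.c + (-(d.R₁ - d.s)) • d.e) := by
      refine d.U_pos (d.mem_Ω.2 ⟨?_, ?_⟩)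
      · rw [c, ← add_smul, norm_smul, d.he, mul_one, Real.norm_eq_abs, abs_lt]
        constructor <;> linarith
      · rw [d.pole_norm, abs_neg, abs_of_pos (by linarith)]; exact hlt
    have h3 : d.U (d.c + (-(d.R₁ - d.s)) • d.e) - d.U (d.c + (d.R₁ - d.s) • d.e) = 0 := h1
    linarith
  have hrad : ∀ x, d.R₀ ≤ ‖x - d.c‖ → ‖x - d.c‖ ≤ r₀ → d.U x = d.U (d.c + ‖x - d.c‖ • d.e) := by
    intro x h1 h2
    set r := ‖x - d.c‖ with hr
    have hrp : 0 < r := by linarith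
    have n1 : ‖d.c + r • d.e - d.c‖ = r := by rw [d.pole_norm, abs_of_pos hrp]
    have n2 : ‖d.c + (-r) • d.e - d.c‖ = r := by rw [d.pole_norm, abs_neg, abs_of_pos hrp]
    rcases h1.eq_or_lt with h | h
    · rw [d.U_sphere (x := x) (by rw [← hr, h]), d.U_sphere (by rw [n1, h])]
    have hi := abs_le.1 (abs_real_inner_le_norm (x - d.c) d.e)
    rw [d.he, mul_one] at hi
    have a1 := d.U_mono (x := d.c + r • d.e) (y := x) ⟨by rw [n1]; exact h, by rw [n1]; linarith⟩
      (by rw [n1]) (by rw [d.pole_inner]; exact hi.2)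
    have a2 := d.U_mono (x := x) (y := d.c + (-r) • d.e) ⟨h, by linarith⟩
      (by rw [n2]) (by rw [d.pole_inner]; exact hi.1)
    have a3 : d.U (d.c + (-r) • d.e) - d.U (d.c + r • d.e) = 0 := hIc r h1 h2
    linarith
  have hsym : ∀ h x, d.R₀ ≤ ‖x - d.c‖ → ‖x - d.c‖ ≤ r₀ → d.U (sg d.c h x) = d.U x := by
    intro h x h1 h2
    rw [hrad x h1 h2, hrad (sg d.c h x) (by rw [norm_sg_sub]; exact h1) (by rw [norm_sg_sub]; exact h2),
      norm_sg_sub]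
  have hG0 : d.G (d.c + r₀ • d.e) = 0 := by
    by_contra hne
    obtain ⟨t, ht, hext⟩ := d.extend hr0 hr2 (hsym d.e) hne
    set a := min t (d.R₁ - d.s - r₀) / 2 with ha
    have hm : 0 < min t (d.R₁ - d.s - r₀) := lt_min ht (by linarith)
    have hap : 0 < a := half_pos hm
    have m1 := min_le_left t (d.R₁ - d.s - r₀)
    have m2 := min_le_right t (d.R₁ - d.s - r₀)
    have hmem : r₀ + a ∈ Z := by
      refine ⟨by linarith, by linarith, fun q h1 h2 => ?_⟩
      rcases le_or_gt q r₀ with h | h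
      · exact hIc q h1 h
      have hqp : 0 < q := by linarith
      have e1 : d.c + q • d.e - (d.c + r₀ • d.e) = (q - r₀) • d.e := by rw [sub_smul]; abel
      have := hext (d.c + q • d.e) (by
        rw [e1, norm_smul, d.he, mul_one, Real.norm_eq_abs, abs_of_pos (by linarith)]; linarith) (by
        rw [d.pole_norm, abs_of_pos hqp]; exact h)
      rw [d.pole_sg] at this
      simp only [hf, this, sub_self]
    have := le_csSup hZb hmem
    linarith
  have hr3 : d.R₀ < r₀ := lt_of_le_of_ne hr0 fun h => d.G_ne (by rw [h]; exact hG0)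
  refine ⟨r₀, hr3, hr2, fun x h1 h2 => hrad x h1.le h2, fun x hx => ?_⟩
  rcases eq_or_ne x (d.c + r₀ • d.e) with h | h
  · rw [h]; exact hG0
  have hn : ‖x - d.c‖ = ‖d.c + r₀ • d.e - d.c‖ := by rw [hx, d.pole_norm, abs_of_pos (by linarith)]
  obtain ⟨k, hk1, hk2, -⟩ := swap_exists hn h
  have := d.G_sg (h := k) hr3 hr2 (fun y h1 h2 => hsym k y h1.le h2.le) (x := x) (by rw [hx]; exact hr3) hx.le
  rw [hk2, hG0, map_zero] at this
  exact this.symm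
end Dat

lemma e1_norm {N : ℕ} (hN : 2 ≤ N) : ‖e1 N‖ = 1 := by
  have : e1 N = EuclideanSpace.single (⟨0, by omega⟩ : Fin N) (1 : ℝ) := by
    ext i
    simp [e1, Fin.ext_iff, Pi.single_apply]
  rw [this, EuclideanSpace.norm_single, norm_one]

lemma Om_eq {N : ℕ} {R₀ R₁ : ℝ} (hR₀ : 0 < R₀) (t : ℝ) : Om N R₀ R₁ t = An R₀ R₁ (t • e1 N) := by
  rw [Om, An, closure_ball _ hR₀.ne']

lemma An_closure {E : Type*} [NormedAddCommGroup E] [InnerProductSpace ℝ E] {R₀ R₁ : ℝ} (hR₀ : 0 < R₀) {c x : E}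
    (h1 : ‖x‖ < R₁) (h2 : R₀ ≤ ‖x - c‖) : x ∈ closure (An R₀ R₁ c) := by
  have hp : 0 < ‖x - c‖ := by linarith
  have hc : Continuous fun τ : ℝ => c + τ • (x - c) := by fun_prop
  have hc1 : c + (1 : ℝ) • (x - c) = x := by rw [one_smul]; abel
  have ht : Tendsto (fun τ : ℝ => c + τ • (x - c)) (𝓝[>] 1) (𝓝 x) := by
    have := (hc.tendsto 1).mono_left (nhdsWithin_le_nhds (s := Ioi 1))
    rwa [hc1] at this
  refine mem_closure_of_tendsto ht ?_
  have hb : x ∈ ball (0 : E) R₁ := by simpa using h1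
  filter_upwards [self_mem_nhdsWithin, ht (isOpen_ball.mem_nhds hb)] with τ hτ hτb
  refine ⟨hτb, ?_⟩
  have hτ' : 1 < τ := hτ
  rw [mem_closedBall, dist_eq_norm, add_sub_cancel_left, norm_smul, Real.norm_eq_abs, abs_of_pos (by linarith), not_le]
  nlinarith

end P16
end PL

end PLall

theorem stmt14 (N : ℕ) (hN : 2 ≤ N) (R₀ R₁ : ℝ) (hR₀ : 0 < R₀) (hR : R₀ < R₁)
    (p : ℝ) (hp : 1 < p) (s : ℝ) (hs : 0 < s) (hs' : s < R₁ - R₀)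
    (u : EuclideanSpace ℝ (Fin N) → ℝ)
    (hu : IsFirstEigenfunction p (Om N R₀ R₁ s) (lam1 p (Om N R₀ R₁ s)) u)
    (hd : HasDerivAt (fun t : ℝ => lam1 p (Om N R₀ R₁ t)) 0 s) :
    ∃ r₀ ∈ Set.Ioo R₀ (R₁ - s), ∃ g : ℝ → ℝ,
      (∀ x : EuclideanSpace ℝ (Fin N),
        R₀ < ‖x - s • e1 N‖ → ‖x - s • e1 N‖ < r₀ → u x = g ‖x - s • e1 N‖) ∧
      (∀ x : EuclideanSpace ℝ (Fin N), ‖x - s • e1 N‖ = r₀ → gradient u x = 0) := by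
  have he := PL.e1_norm hN
  have hopen : ∀ t : ℝ, IsOpen (PL.An R₀ R₁ (t • e1 N)) := fun t => isOpen_ball.sdiff isClosed_closedBall
  have hbdd : ∀ t : ℝ, Bornology.IsBounded (PL.An R₀ R₁ (t • e1 N)) := fun t =>
    isBounded_ball.subset Set.sdiff_subset
  have hu' := hu
  rw [PL.Om_eq hR₀] at hu'
  obtain ⟨⟨V, hV, hΩV, huV⟩, hpos, h0, -⟩ := hu'
  obtain ⟨L, hL⟩ := PL.lip_indicator (hopen s) (hbdd s) hV hΩV huV hpos h0
  have hcl : ∀ x : EuclideanSpace ℝ (Fin N), ‖x‖ < R₁ → R₀ ≤ ‖x - s • e1 N‖ → x ∈ V := fun x h1 h2 =>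
    hΩV (PL.An_closure hR₀ h1 h2)
  let d : PL.Dat (EuclideanSpace ℝ (Fin N)) :=
    { p := p, R₀ := R₀, R₁ := R₁, s := s, lam := fun t => lam1 p (Om N R₀ R₁ t), e := e1 N, u := u,
      G := gradient u, L := L, hp := hp, hR₀ := hR₀, hs := hs, hs' := by linarith, he := he
      hrank := by
        rw [← Module.finrank_eq_rank, finrank_euclideanSpace_fin]
        exact_mod_cast (by omega : 1 < N)
      lipU := hL
      hG := fun x h1 h2 =>
        ((huV.differentiableOn one_ne_zero).differentiableAt (hV.mem_nhds (hcl x h1 h2))).hasGradientAt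
      hGc := by
        have hc : ContinuousOn (fderiv ℝ u) V := huV.continuousOn_fderiv_of_isOpen hV le_rfl
        exact ((InnerProductSpace.toDual ℝ _).symm.continuous.comp_continuousOn hc).mono
          fun x hx => hcl x hx.1 hx.2
      u0 := by
        intro x hx
        have hxn : ‖x‖ < R₁ := by
          have h1 := norm_le_norm_sub_add x (s • e1 N)
          rw [norm_smul, he, mul_one, Real.norm_of_nonneg hs.le] at h1
          linarith
        refine h0 x ?_
        rw [(hopen s).frontier_eq]
        refine ⟨PL.An_closure hR₀ hxn hx.ge, fun h => h.2 ?_⟩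
        rw [mem_closedBall, dist_eq_norm, hx]
      upos := hpos
      ray := fun t f K hf hf0 => by
        rw [PL.Om_eq hR₀]
        exact PL.rayleigh hp (hopen t) (hbdd t) hf hf0
      weak := fun f K hf hf0 => by
        have h2 := hu
        rw [PL.Om_eq hR₀] at h2
        simp only [PL.Om_eq hR₀]
        exact PL.weak_lip hp (hopen s) (hbdd s) h2 hL hf hf0
      lam0 := fun t => PL.lam1_nonneg _ _
      hder := hd }
  obtain ⟨r₀, h1, h2, h3, h4⟩ := d.final
  refine ⟨r₀, ⟨h1, h2⟩, fun r => d.U (d.c + r • d.e), fun x hx1 hx2 => ?_, h4⟩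
  exact (d.U_eq (x := x) (d.A_sub ⟨hx1, hx2.trans h2⟩)).symm.trans (h3 x hx1 hx2.le)
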